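/- Let r ≥ 130 be an integer and let a ∈ (0, (r-129)/256). Then there exist l₀ = l₀(r,a) ∈ ℕ and ξ = ξ(r,a) > 0 such that for every ℓ ∈ rℤ² with |ℓ|_∞ ≥ l₀, any linearly edge-reinforced random walk measure P on G_r with constant initial weights a started at 0 satisfies P[τ_ℓ < τ_0] ≤ (r/|ℓ|_∞)^{1+ξ}. -/

import Mathlib

open MeasureTheory
open scoped ENNReal Classical

namespace ERRWZ2

/-- The vertex set `V_r` of the diluted lattice `G_r`. -/
def Vr (r : ℕ) : Set (ℤ × ℤ) := {x | (r : ℤ) ∣ x.1 ∨ (r : ℤ) ∣ x.2}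

/-- The set `L_r = rℤ²` of four-way crossings. -/
def Lr (r : ℕ) : Set (ℤ × ℤ) := {x | (r : ℤ) ∣ x.1 ∧ (r : ℤ) ∣ x.2}

/-- Maximum norm on `ℤ²`. -/
def linf (v : ℤ × ℤ) : ℤ := max |v.1| |v.2|

/-- Adjacency in `G_r`: both endpoints in `V_r` and Euclidean distance one. -/
def AdjG (r : ℕ) (u v : ℤ × ℤ) : Prop :=
  u ∈ Vr r ∧ v ∈ Vr r ∧ (u.1 - v.1) ^ 2 + (u.2 - v.2) ^ 2 = 1

/-- Weight at time `t` of the undirected edge `{x,y}` for the trajectory `u`. -/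
noncomputable def wt (a : ℝ) (u : ℕ → ℤ × ℤ) (t : ℕ) (x y : ℤ × ℤ) : ℝ :=
  a + (((Finset.range t).filter fun s =>
    (u s = x ∧ u (s + 1) = y) ∨ (u s = y ∧ u (s + 1) = x)).card : ℝ)

/-- Total weight at time `t` of all edges of `G_r` incident to the current position `u t`. -/
noncomputable def totWt (r : ℕ) (a : ℝ) (u : ℕ → ℤ × ℤ) (t : ℕ) : ℝ :=
  ∑ d ∈ ({(1, 0), (-1, 0), (0, 1), (0, -1)} : Finset (ℤ × ℤ)),
    if AdjG r (u t) (u t + d) then wt a u t (u t) (u t + d) else 0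

/-- Hitting time `τ_A = inf{t ≥ 1 : X_t ∈ A}` (with value `⊤` if the set is never hit). -/
noncomputable def tau (A : Set (ℤ × ℤ)) (X : ℕ → ℤ × ℤ) : ℕ∞ :=
  sInf ((fun t : ℕ => (t : ℕ∞)) '' {t : ℕ | 1 ≤ t ∧ X t ∈ A})

/-- `P` is a linearly edge-reinforced random walk on `G_r` with constant initial
weights `a`, started at `(0,0)`. -/
def IsERRW (r : ℕ) (a : ℝ) (P : Measure (ℕ → ℤ × ℤ)) : Prop :=
  IsProbabilityMeasure P ∧
    ∀ (n : ℕ) (u : ℕ → ℤ × ℤ),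
      P {X | ∀ t ≤ n, X t = u t} =
        if u 0 = (0, 0) ∧ ∀ t < n, AdjG r (u t) (u (t + 1)) then
          ENNReal.ofReal (∏ t ∈ Finset.range n, wt a u t (u t) (u (t + 1)) / totWt r a u t)
        else 0

end ERRWZ2

namespace ERRWZ2

theorem lintegral_Ioi_eq_lintegral_exp (F : ℝ → ℝ≥0∞) :
    ∫⁻ y in Set.Ioi (0 : ℝ), F y = ∫⁻ τ, ENNReal.ofReal (Real.exp τ) * F (Real.exp τ) := by
  have h := lintegral_image_eq_lintegral_abs_deriv_mul (s := Set.univ) (f := Real.exp)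
    (f' := Real.exp) MeasurableSet.univ (fun x _ => (Real.hasDerivAt_exp x).hasDerivWithinAt)
    Real.exp_injective.injOn F
  rw [Set.image_univ, Real.range_exp] at h
  simpa [abs_of_pos (Real.exp_pos _)] using h

theorem lintegral_comp_mul_left_real (F : ℝ → ℝ≥0∞) {c : ℝ} (hc : c ≠ 0) :
    ∫⁻ τ, F τ = ENNReal.ofReal |c| * ∫⁻ τ, F (c * τ) := by
  have h := lintegral_image_eq_lintegral_abs_deriv_mul (s := Set.univ) (f := fun x => c * x)
    (f' := fun _ => c) MeasurableSet.univ
    (fun x _ => by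
      simpa using (((hasDerivAt_id x).const_mul c).hasDerivWithinAt (s := Set.univ)))
    (mul_right_injective₀ hc).injOn F
  rw [Set.image_univ, (mul_left_surjective₀ hc).range_eq] at h
  rw [setLIntegral_univ, setLIntegral_univ, lintegral_const_mul' _ _ ENNReal.ofReal_ne_top] at h
  exact h

theorem lintegral_exp_gamma {b c : ℝ} (hb : 0 < b) (hc : 0 < c) :
    ∫⁻ τ, ENNReal.ofReal (Real.exp (b * τ - c * Real.exp τ)) =
      ENNReal.ofReal ((1 / c) ^ b * Real.Gamma b) := by
  have h1 := Real.integral_rpow_mul_exp_neg_mul_Ioi hb hc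
  have hpos : 0 < (1 / c) ^ b * Real.Gamma b :=
    mul_pos (Real.rpow_pos_of_pos (by positivity) _) (Real.Gamma_pos_of_pos hb)
  have hintegrable : Integrable (fun t => t ^ (b - 1) * Real.exp (-(c * t)))
      (volume.restrict (Set.Ioi (0 : ℝ))) := by
    by_contra hcon
    rw [integral_undef hcon] at h1
    linarith
  rw [← h1, ofReal_integral_eq_lintegral_ofReal hintegrable, lintegral_Ioi_eq_lintegral_exp]
  · refine lintegral_congr fun τ => ?_
    rw [← ENNReal.ofReal_mul (Real.exp_pos _).le]
    congr 1
    rw [← Real.exp_mul, ← Real.exp_add, ← Real.exp_add]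
    congr 1
    ring
  · filter_upwards [ae_restrict_mem measurableSet_Ioi] with t ht
    have : (0 : ℝ) < t := ht
    positivity

/-- The one-dimensional integral of inverse Gaussian type. -/
theorem lintegral_inverse_gaussian {b : ℝ} (hb : 0 ≤ b) :
    ∫⁻ y in Set.Ioi (0 : ℝ),
        ENNReal.ofReal (Real.exp (-(y + b ^ 2 / y) / 2) / Real.sqrt y) =
      ENNReal.ofReal (Real.sqrt (2 * Real.pi) * Real.exp (-b)) := by
  rcases hb.eq_or_lt with rfl | hb
  · rw [lintegral_Ioi_eq_lintegral_exp]
    have := lintegral_exp_gamma (b := 1 / 2) (c := 1 / 2) (by norm_num) (by norm_num)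
    rw [Real.Gamma_one_half_eq] at this
    convert this using 2
    · ext τ
      rw [← ENNReal.ofReal_mul (Real.exp_pos _).le]
      congr 1
      rw [← Real.exp_half, div_eq_mul_inv, ← Real.exp_neg, ← Real.exp_add, ← Real.exp_add]
      congr 1
      ring
    · rw [Real.sqrt_mul (by norm_num), neg_zero, Real.exp_zero, mul_one, ← Real.sqrt_eq_rpow]
      norm_num
  · rw [lintegral_Ioi_eq_lintegral_exp]
    -- shift so that the exponent becomes `-b cosh τ`
    set G : ℝ → ℝ≥0∞ := fun τ => ENNReal.ofReal (Real.sqrt b * Real.exp (τ / 2 - b * Real.cosh τ))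
      with hG
    have h1 : ∫⁻ τ, ENNReal.ofReal (Real.exp τ) *
        ENNReal.ofReal (Real.exp (-(Real.exp τ + b ^ 2 / Real.exp τ) / 2) / Real.sqrt (Real.exp τ))
        = ∫⁻ τ, G τ := by
      rw [← lintegral_add_right_eq_self _ (Real.log b)]
      refine lintegral_congr fun τ => ?_
      rw [hG, ← ENNReal.ofReal_mul (Real.exp_pos _).le]
      congr 1
      rw [← Real.exp_half, div_eq_mul_inv, ← Real.exp_neg, ← Real.exp_add, ← Real.exp_add]
      have : Real.sqrt b = Real.exp (Real.log b / 2) := by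
        rw [Real.exp_half, Real.exp_log hb]
      rw [this, ← Real.exp_add]
      congr 1
      rw [Real.exp_add, Real.exp_log hb, Real.cosh_eq, Real.exp_neg]
      field_simp
      ring
    have h2 : ∫⁻ τ, G τ = ∫⁻ τ, G (-τ) := by
      have := lintegral_comp_mul_left_real G (c := -1) (by norm_num)
      simpa using this
    have h3 : 2 * ∫⁻ τ, G τ = ∫⁻ τ, ENNReal.ofReal
        (2 * Real.sqrt b * Real.cosh (τ / 2) * Real.exp (- b * Real.cosh τ)) := by
      rw [two_mul]
      nth_rw 2 [h2]
      rw [← lintegral_add_left]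
      · refine lintegral_congr fun τ => ?_
        rw [hG, ← ENNReal.ofReal_add (by positivity) (by positivity)]
        congr 1
        rw [Real.cosh_neg, sub_eq_add_neg, sub_eq_add_neg, Real.exp_add, Real.exp_add,
          Real.cosh_eq (τ / 2)]
        ring_nf
      · rw [hG]; fun_prop
    have h4 : ∫⁻ τ, ENNReal.ofReal
        (2 * Real.sqrt b * Real.cosh (τ / 2) * Real.exp (- b * Real.cosh τ)) =
        2 * ∫⁻ τ, ENNReal.ofReal (Real.cosh τ) * ENNReal.ofReal
        (2 * Real.sqrt b * Real.exp (- b) * Real.exp (-(2 * b) * Real.sinh τ ^ 2)) := by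
      rw [lintegral_comp_mul_left_real _ (c := 2) (by norm_num)]
      congr 1
      · simp
      refine lintegral_congr fun τ => ?_
      rw [← ENNReal.ofReal_mul (Real.cosh_pos _).le]
      congr 1
      rw [mul_assoc _ (Real.exp (-b)), ← Real.exp_add, Real.cosh_two_mul, Real.cosh_sq]
      ring_nf
    have h5 : ∫⁻ τ, ENNReal.ofReal (Real.cosh τ) * ENNReal.ofReal
        (2 * Real.sqrt b * Real.exp (- b) * Real.exp (-(2 * b) * Real.sinh τ ^ 2)) =
        ∫⁻ z, ENNReal.ofReal (2 * Real.sqrt b * Real.exp (- b) * Real.exp (-(2 * b) * z ^ 2)) := by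
      have h := lintegral_image_eq_lintegral_abs_deriv_mul (s := Set.univ) (f := Real.sinh)
        (f' := Real.cosh) MeasurableSet.univ
        (fun x _ => (Real.hasDerivAt_sinh x).hasDerivWithinAt)
        Real.sinh_injective.injOn
        (fun z => ENNReal.ofReal (2 * Real.sqrt b * Real.exp (- b) * Real.exp (-(2 * b) * z ^ 2)))
      rw [Set.image_univ, Real.sinh_surjective.range_eq] at h
      simpa [abs_of_pos (Real.cosh_pos _)] using h.symm
    have h6 : ∫⁻ z, ENNReal.ofReal
        (2 * Real.sqrt b * Real.exp (- b) * Real.exp (-(2 * b) * z ^ 2)) =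
        ENNReal.ofReal (Real.sqrt (2 * Real.pi) * Real.exp (-b)) := by
      rw [← ofReal_integral_eq_lintegral_ofReal]
      · rw [integral_const_mul, integral_gaussian]
        congr 1
        have : Real.sqrt (Real.pi / (2 * b)) = Real.sqrt (2 * Real.pi) / (2 * Real.sqrt b) := by
          rw [Real.sqrt_eq_iff_mul_self_eq (by positivity) (by positivity)]
          field_simp
          rw [Real.sq_sqrt hb.le, Real.sq_sqrt (by positivity)]
          ring
        rw [this]
        have := Real.sqrt_pos.2 hb
        field_simp
      · exact (integrable_exp_neg_mul_sq (by positivity)).const_mul _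
      · exact Filter.Eventually.of_forall fun z => by positivity
    rw [h1, ← h6, ← h5]
    have := h3.trans h4
    exact (ENNReal.mul_right_inj (by norm_num) (by norm_num)).1 this

/-- The matrix `diag(h) - W`. -/
noncomputable def hMat {ι : Type*} [DecidableEq ι] (W : Matrix ι ι ℝ) (h : ι → ℝ) : Matrix ι ι ℝ :=
  Matrix.diagonal h - W

section Schur

variable {α : Type*} [Fintype α] [DecidableEq α]

theorem schur_det {A : Matrix α α ℝ} (w : α → ℝ) (d : ℝ) (hA : A.PosDef) :
    (Matrix.fromBlocks A (Matrix.of fun i (_ : Unit) => -w i) (Matrix.of fun (_ : Unit) i => -w i)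
      (Matrix.of fun _ _ => d)).det = A.det * (d - w ⬝ᵥ A⁻¹.mulVec w) := by
  have := hA.isUnit.invertible
  rw [Matrix.det_fromBlocks₁₁, Matrix.det_unique (n := Unit)]
  congr 1
  simp only [Matrix.sub_apply, Matrix.of_apply, Matrix.mul_apply, dotProduct, Matrix.mulVec,
    Matrix.invOf_eq_nonsing_inv]
  congr 1
  simp only [Finset.sum_mul, Finset.mul_sum]
  rw [Finset.sum_comm]
  refine Finset.sum_congr rfl fun i _ => Finset.sum_congr rfl fun j _ => ?_
  ring

theorem schur_posDef_iff {A : Matrix α α ℝ} (w : α → ℝ) (d : ℝ) :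
    (Matrix.fromBlocks A (Matrix.of fun i (_ : Unit) => -w i) (Matrix.of fun (_ : Unit) i => -w i)
      (Matrix.of fun _ _ => d)).PosDef ↔ A.PosDef ∧ 0 < d - w ⬝ᵥ A⁻¹.mulVec w := by
  set B : Matrix α Unit ℝ := Matrix.of fun i (_ : Unit) => -w i with hB
  have hBt : (Matrix.of fun (_ : Unit) i => -w i) = B.conjTranspose := by
    ext i j; simp [hB]
  have key : A.PosDef → ((Matrix.fromBlocks A B B.conjTranspose
      (Matrix.of fun _ _ => d)).PosDef ↔ 0 < d - w ⬝ᵥ A⁻¹.mulVec w) := by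
    intro hA
    have := hA.isUnit.invertible
    have hdet := schur_det w d hA
    rw [hBt, ← hB] at hdet
    have hs : (Matrix.of fun (_ _ : Unit) => d) - B.conjTranspose * A⁻¹ * B =
        Matrix.diagonal (fun _ => d - w ⬝ᵥ A⁻¹.mulVec w) := by
      ext i j
      simp only [Matrix.sub_apply, Matrix.of_apply, Matrix.mul_apply, dotProduct, Matrix.mulVec,
        Matrix.conjTranspose_apply, hB, star_trivial, Matrix.diagonal_apply, if_pos]
      congr 1
      simp only [Finset.sum_mul, Finset.mul_sum]
      rw [Finset.sum_comm]
      refine Finset.sum_congr rfl fun i _ => Finset.sum_congr rfl fun j _ => ?_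
      ring
    have h1 := Matrix.PosDef.fromBlocks₁₁ B (Matrix.of fun (_ _ : Unit) => d) hA
    rw [hs, Matrix.posSemidef_diagonal_iff] at h1
    have h2 : (Matrix.fromBlocks A B B.conjTranspose (Matrix.of fun _ _ => d)).PosSemidef ↔
        0 ≤ d - w ⬝ᵥ A⁻¹.mulVec w := h1.trans ⟨fun h => h (), fun h _ => h⟩
    constructor
    · intro h
      refine lt_of_le_of_ne (h2.1 h.posSemidef) fun h0 => ?_
      have := h.det_pos
      rw [hdet, ← h0, mul_zero] at this
      exact lt_irrefl _ this
    · intro h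
      rw [(h2.2 h.le).posDef_iff_isUnit, Matrix.isUnit_iff_isUnit_det, hdet]
      exact (mul_pos hA.det_pos h).ne'.isUnit
  rw [hBt]
  constructor
  · intro h
    have hA : A.PosDef := by
      have := h.submatrix (e := (Sum.inl : α → α ⊕ Unit)) Sum.inl_injective
      convert this using 1
      rfl
    exact ⟨hA, (key hA).1 h⟩
  · rintro ⟨hA, h⟩
    exact (key hA).2 h

theorem schur_quad {A : Matrix α α ℝ} (w η : α → ℝ) (d c : ℝ) (hA : A.PosDef)
    (hs : 0 < d - w ⬝ᵥ A⁻¹.mulVec w) :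
    Sum.elim η (fun _ : Unit => c) ⬝ᵥ (Matrix.fromBlocks A (Matrix.of fun i (_ : Unit) => -w i)
      (Matrix.of fun (_ : Unit) i => -w i) (Matrix.of fun _ _ => d))⁻¹.mulVec
        (Sum.elim η (fun _ : Unit => c)) =
      η ⬝ᵥ A⁻¹.mulVec η + (c + w ⬝ᵥ A⁻¹.mulVec η) ^ 2 / (d - w ⬝ᵥ A⁻¹.mulVec w) := by
  have hH := (schur_posDef_iff (A := A) w d).2 ⟨hA, hs⟩
  set H := Matrix.fromBlocks A (Matrix.of fun i (_ : Unit) => -w i)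
      (Matrix.of fun (_ : Unit) i => -w i) (Matrix.of fun _ _ => d) with hHdef
  set s := d - w ⬝ᵥ A⁻¹.mulVec w with hsdef
  set z0 := (c + w ⬝ᵥ A⁻¹.mulVec η) / s with hz0
  set z1 : α → ℝ := A⁻¹.mulVec (η + z0 • w) with hz1
  have hAdet : IsUnit A.det := (Matrix.isUnit_iff_isUnit_det _).1 hA.isUnit
  have hHdet : IsUnit H.det := (Matrix.isUnit_iff_isUnit_det _).1 hH.isUnit
  have hz0s : z0 * s = c + w ⬝ᵥ A⁻¹.mulVec η := div_mul_cancel₀ _ hs.ne'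
  have hz1' : z1 = A⁻¹.mulVec η + z0 • A⁻¹.mulVec w := by
    rw [hz1, Matrix.mulVec_add, Matrix.mulVec_smul]
  have hsol : H.mulVec (Sum.elim z1 fun _ => z0) = Sum.elim η fun _ => c := by
    rw [hHdef, Matrix.fromBlocks_mulVec]
    congr 1
    · have : A.mulVec z1 = η + z0 • w := by
        rw [hz1, Matrix.mulVec_mulVec, Matrix.mul_nonsing_inv _ hAdet, Matrix.one_mulVec]
      simp only [Sum.elim_comp_inl, Sum.elim_comp_inr, this]
      ext i
      simp [Matrix.mulVec, dotProduct]
      ring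
    · ext i
      have : w ⬝ᵥ z1 = w ⬝ᵥ A⁻¹.mulVec η + z0 * (w ⬝ᵥ A⁻¹.mulVec w) := by
        rw [hz1', dotProduct_add, dotProduct_smul, smul_eq_mul]
      have h2 : (Matrix.of fun (_ : Unit) i => -w i).mulVec z1 i = - (w ⬝ᵥ z1) := by
        simp [Matrix.mulVec, dotProduct]
      simp only [Sum.elim_comp_inl, Sum.elim_comp_inr, Pi.add_apply, h2, this]
      simp only [Matrix.mulVec, dotProduct, Matrix.of_apply, Finset.univ_unique,
        Finset.sum_singleton] at *
      rw [hsdef] at hz0s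
      linarith
  have hinv : H⁻¹.mulVec (Sum.elim η fun _ => c) = Sum.elim z1 fun _ => z0 := by
    rw [← hsol, Matrix.mulVec_mulVec, Matrix.nonsing_inv_mul _ hHdet, Matrix.one_mulVec]
  rw [hinv, sumElim_dotProduct_sumElim]
  have hsymm : η ⬝ᵥ A⁻¹.mulVec w = w ⬝ᵥ A⁻¹.mulVec η := by
    have hT : A⁻¹.transpose = A⁻¹ := by
      have := hA.inv.isHermitian
      rwa [Matrix.IsHermitian, Matrix.conjTranspose_eq_transpose_of_trivial] at this
    rw [dotProduct_comm, ← Matrix.vecMul_transpose, hT, Matrix.dotProduct_mulVec]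
  rw [hz1', dotProduct_add, dotProduct_smul, smul_eq_mul, hsymm]
  simp only [dotProduct, Finset.univ_unique, Finset.sum_singleton]
  simp only [dotProduct] at hz0s hz0
  rw [hz0]
  field_simp
  ring

end Schur

/-- A positive definite matrix with nonpositive off-diagonal entries has a nonnegative inverse. -/
theorem inv_mulVec_nonneg {α : Type*} [Fintype α] [DecidableEq α] {A : Matrix α α ℝ} (hA : A.PosDef)
    (hoff : ∀ i j, i ≠ j → A i j ≤ 0) {η : α → ℝ} (hη : ∀ i, 0 ≤ η i) (i : α) :
    0 ≤ A⁻¹.mulVec η i := by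
  set x := A⁻¹.mulVec η with hx
  have hAdet : IsUnit A.det := (Matrix.isUnit_iff_isUnit_det _).1 hA.isUnit
  have hAx : A.mulVec x = η := by
    rw [hx, Matrix.mulVec_mulVec, Matrix.mul_nonsing_inv _ hAdet, Matrix.one_mulVec]
  set m : α → ℝ := fun i => max (-x i) 0 with hm
  by_contra hneg
  push Not at hneg
  have hm0 : m ≠ 0 := by
    intro h
    have := congrFun h i
    simp [hm] at this
    linarith
  have h1 := hA.dotProduct_mulVec_pos hm0
  have h2 : m ⬝ᵥ A.mulVec (m + x) ≤ 0 := by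
    simp only [dotProduct, Matrix.mulVec, Finset.mul_sum]
    refine Finset.sum_nonpos fun i _ => Finset.sum_nonpos fun j _ => ?_
    have hmi : 0 ≤ m i := le_max_right _ _
    have hmx : 0 ≤ (m + x) j := by
      have := le_max_left (-x j) 0
      simp only [Pi.add_apply, hm]; linarith
    by_cases hij : i = j
    · subst hij
      have : m i * (m + x) i = 0 := by
        simp only [Pi.add_apply, hm]
        rcases le_total (-x i) 0 with h | h
        · rw [max_eq_right h]; ring
        · rw [max_eq_left h]; ring
      rw [mul_left_comm, this, mul_zero]
    · have := mul_nonneg hmi hmx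
      nlinarith [hoff i j hij]
  have h3 : 0 ≤ m ⬝ᵥ A.mulVec x := by
    rw [hAx]
    exact Finset.sum_nonneg fun i _ => mul_nonneg (le_max_right _ _) (hη i)
  rw [Matrix.mulVec_add, dotProduct_add] at h2
  simp only [star_trivial] at h1
  linarith

theorem lintegral_sum_unit {α : Type*} [Fintype α] (F : (α ⊕ Unit → ℝ) → ℝ≥0∞) (hF : Measurable F) :
    ∫⁻ h, F h = ∫⁻ h' : α → ℝ, ∫⁻ y : ℝ, F (Sum.elim h' fun _ => y) := by
  have e1 := (volume_measurePreserving_sumPiEquivProdPi (fun _ : α ⊕ Unit => ℝ)).symm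
  rw [MeasurePreserving.lintegral_map_equiv _ _ e1, Measure.volume_eq_prod, lintegral_prod]
  · refine lintegral_congr fun h' => ?_
    have e2 := (volume_preserving_funUnique Unit ℝ).symm
    rw [MeasurePreserving.lintegral_map_equiv _ _ e2]
    refine lintegral_congr fun y => ?_
    congr 1
  · exact (hF.comp (MeasurableEquiv.measurable _)).aemeasurable

/-- The (unnormalised) density of the random Schrödinger operator. -/
noncomputable def stz {ι : Type*} [Fintype ι] [DecidableEq ι] (W : Matrix ι ι ℝ) (η h : ι → ℝ) :
    ℝ≥0∞ :=
  if (hMat W h).PosDef then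
    ENNReal.ofReal (Real.exp (-(∑ i, ∑ j, hMat W h i j + η ⬝ᵥ (hMat W h)⁻¹.mulVec η) / 2) /
      Real.sqrt (hMat W h).det)
  else 0

section Meas

variable {ι : Type*} [Fintype ι] [DecidableEq ι] (W : Matrix ι ι ℝ)

theorem continuous_hMat : Continuous (hMat W) := by
  refine continuous_matrix fun i j => ?_
  simp only [hMat, Matrix.sub_apply, Matrix.diagonal_apply]
  split_ifs <;> fun_prop

theorem hMat_isHermitian (hW : W.IsSymm) (h : ι → ℝ) : (hMat W h).IsHermitian := by
  rw [Matrix.IsHermitian, Matrix.conjTranspose_eq_transpose_of_trivial, hMat,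
    Matrix.transpose_sub, Matrix.diagonal_transpose, hW.eq]

theorem measurableSet_posDef (hW : W.IsSymm) : MeasurableSet {h | (hMat W h).PosDef} := by
  have : {h | (hMat W h).PosDef} =
      (⋂ x : ι → ℝ, {h | 0 ≤ x ⬝ᵥ (hMat W h).mulVec x}) ∩ {h | (hMat W h).det = 0}ᶜ := by
    ext h
    simp only [Set.mem_ofPred_eq, Set.mem_inter_iff, Set.mem_iInter, Set.mem_compl_iff]
    constructor
    · intro H
      refine ⟨fun x => ?_, H.det_pos.ne'⟩
      have := H.posSemidef.dotProduct_mulVec_nonneg x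
      simpa using this
    · rintro ⟨H1, H2⟩
      have : (hMat W h).PosSemidef :=
        Matrix.PosSemidef.of_dotProduct_mulVec_nonneg (hMat_isHermitian W hW h)
          (fun x => by simpa using H1 x)
      rw [this.posDef_iff_isUnit, Matrix.isUnit_iff_isUnit_det]
      exact Ne.isUnit H2
  rw [this]
  have hc := continuous_hMat W
  refine MeasurableSet.inter (IsClosed.measurableSet (isClosed_iInter fun x => ?_))
    (IsClosed.measurableSet ?_).compl
  · exact isClosed_le continuous_const (by fun_prop)
  · exact isClosed_eq hc.matrix_det continuous_const

theorem measurable_stz (hW : W.IsSymm) (η : ι → ℝ) : Measurable (stz W η) := by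
  have hc := continuous_hMat W
  refine Measurable.ite (measurableSet_posDef W hW) ?_ measurable_const
  refine ENNReal.measurable_ofReal.comp (Measurable.div ?_ ?_)
  · refine Real.measurable_exp.comp ?_
    refine Measurable.div_const (Measurable.neg (Measurable.add ?_ ?_)) _
    · refine Continuous.measurable ?_
      refine continuous_finsetSum _ fun i _ => continuous_finsetSum _ fun j _ => ?_
      exact hc.matrix_elem i j
    · simp only [dotProduct, Matrix.mulVec, Matrix.inv_def, Ring.inverse_eq_inv', Matrix.smul_apply,
        smul_eq_mul]
      refine Finset.measurable_sum _ fun i _ => Measurable.const_mul ?_ _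
      refine Finset.measurable_sum _ fun j _ => Measurable.mul_const ?_ _
      exact (hc.matrix_det.measurable.inv).mul (hc.matrix_adjugate.matrix_elem i j).measurable
  · exact (Real.continuous_sqrt.comp hc.matrix_det).measurable

end Meas

theorem stz_reindex {α β : Type*} [Fintype α] [DecidableEq α] [Fintype β] [DecidableEq β]
    (e : α ≃ β) (W : Matrix β β ℝ) (η h : β → ℝ) :
    stz W η h = stz (W.submatrix e e) (η ∘ e) (h ∘ e) := by
  have h1 : hMat (W.submatrix e e) (h ∘ e) = (hMat W h).submatrix e e := by
    ext i j
    simp [hMat, Matrix.diagonal_apply]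
  have h2 : ((hMat W h).submatrix e e).PosDef ↔ (hMat W h).PosDef := by
    constructor
    · intro H
      have := H.submatrix (e := e.symm) e.symm.injective
      simpa using this
    · intro H
      exact H.submatrix e.injective
  unfold stz
  rw [h1]
  simp only [h2]
  congr 3
  swap
  · rw [Matrix.det_submatrix_equiv_self]
  rw [Matrix.inv_submatrix_equiv, Matrix.submatrix_mulVec_equiv]
  congr 3
  congr 1
  · rw [← e.sum_comp]
    refine Finset.sum_congr rfl fun i _ => ?_
    rw [← e.sum_comp]
    rfl
  · have : (η ∘ e) ∘ e.symm = η := by ext; simp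
    rw [this]
    simp only [dotProduct]
    rw [← e.sum_comp]
    rfl

/-- The statement of the integral formula for the random Schrödinger operator. -/
def StzFormula (ι : Type*) [Fintype ι] : Prop :=
  ∀ [DecidableEq ι] (W : Matrix ι ι ℝ) (η : ι → ℝ), W.IsSymm → (∀ i j, 0 ≤ W i j) →
    (∀ i, W i i = 0) → (∀ i, 0 ≤ η i) →
    ∫⁻ h : ι → ℝ, stz W η h =
      ENNReal.ofReal (Real.sqrt (2 * Real.pi) ^ (Fintype.card ι) * Real.exp (-∑ i, η i))

theorem StzFormula.congr {α β : Type*} [Fintype α] [Fintype β] (e : α ≃ β) (hα : StzFormula α) :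
    StzFormula β := by
  intro _ W η hW hW0 hWd hη
  classical
  have h1 := volume_measurePreserving_piCongrLeft (fun _ : β => ℝ) e
  rw [MeasurePreserving.lintegral_map_equiv _ _ h1]
  have h2 : ∀ h : α → ℝ, stz W η (MeasurableEquiv.piCongrLeft (fun _ : β => ℝ) e h) =
      stz (W.submatrix e e) (η ∘ e) h := by
    intro h
    rw [stz_reindex e]
    congr 1
    ext i
    simp [MeasurableEquiv.coe_piCongrLeft, Equiv.piCongrLeft_apply_apply]
  simp only [h2]
  rw [hα (W.submatrix e e) (η ∘ e) (hW.submatrix e) (fun i j => hW0 _ _) (fun i => hWd _)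
    (fun i => hη _), Fintype.card_congr e]
  congr 3
  rw [← e.sum_comp]
  rfl

theorem stzFormula_empty {α : Type*} [Fintype α] [IsEmpty α] : StzFormula α := by
  intro _ W η hW hW0 hWd hη
  have : ∀ h : α → ℝ, stz W η h = 1 := by
    intro h
    have hp : (hMat W h).PosDef := by
      refine Matrix.PosDef.of_dotProduct_mulVec_pos (hMat_isHermitian W hW h) fun x hx => ?_
      exact absurd (Subsingleton.elim x 0) hx
    simp [stz, hp]
  simp [this, volume_pi]

theorem lintegral_inverse_gaussian_shift {b : ℝ} (hb : 0 ≤ b) (c : ℝ) :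
    ∫⁻ y : ℝ, (if 0 < y - c then
      ENNReal.ofReal (Real.exp (-((y - c) + b ^ 2 / (y - c)) / 2) / Real.sqrt (y - c)) else 0) =
    ENNReal.ofReal (Real.sqrt (2 * Real.pi) * Real.exp (-b)) := by
  rw [lintegral_sub_right_eq_self (μ := (volume : Measure ℝ)) (fun y : ℝ => if 0 < y then
      ENNReal.ofReal (Real.exp (-(y + b ^ 2 / y) / 2) / Real.sqrt y) else 0) c,
    ← lintegral_inverse_gaussian hb, ← lintegral_indicator measurableSet_Ioi]
  rfl

theorem StzFormula.sum_unit {α : Type*} [Fintype α] (hα : StzFormula α) :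
    StzFormula (α ⊕ Unit) := by
  intro inst W η hW hW0 hWd hη
  have hdα : DecidableEq α := Classical.decEq α
  obtain rfl : inst = instDecidableEqSum := Subsingleton.elim _ _
  rw [lintegral_sum_unit _ (measurable_stz W hW η)]
  set W' : Matrix α α ℝ := W.submatrix Sum.inl Sum.inl with hW'
  set w : α → ℝ := fun i => W (Sum.inl i) (Sum.inr ()) with hw
  set η' : α → ℝ := fun i => η (Sum.inl i) with hη'
  set c : ℝ := η (Sum.inr ()) with hc
  have hW's : W'.IsSymm := hW.submatrix _
  have hη0 : η = Sum.elim η' (fun _ : Unit => c) := by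
    ext i; cases i <;> rfl
  have hblock : ∀ (h' : α → ℝ) (y : ℝ), hMat W (Sum.elim h' fun _ => y) =
      Matrix.fromBlocks (hMat W' h') (Matrix.of fun i (_ : Unit) => -w i)
      (Matrix.of fun (_ : Unit) i => -w i) (Matrix.of fun _ _ => y) := by
    intro h' y
    ext i j
    rcases i with i | i <;> rcases j with j | j
    · simp [hMat, Matrix.diagonal_apply, hW']
    · simp [hMat, hw]
    · have := hW.apply (Sum.inl j) (Sum.inr ())
      simp [hMat, hw, ← this]
    · simp [hMat, hWd]
  have hin : ∀ h' : α → ℝ, ∫⁻ y : ℝ, stz W η (Sum.elim h' fun _ => y) =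
      ENNReal.ofReal (Real.sqrt (2 * Real.pi) * Real.exp (∑ i, w i - c)) * stz W' (η' + w) h' := by
    intro h'
    by_cases hp : (hMat W' h').PosDef
    swap
    · have : ∀ y, stz W η (Sum.elim h' fun _ => y) = 0 := by
        intro y
        rw [stz, if_neg]
        rw [hblock, schur_posDef_iff]
        tauto
      simp only [this, lintegral_zero]
      rw [stz, if_neg hp, mul_zero]
    set A := hMat W' h' with hA
    have hG : ∀ ζ : α → ℝ, (∀ i, 0 ≤ ζ i) → ∀ i, 0 ≤ A⁻¹.mulVec ζ i := by
      intro ζ hζ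
      refine inv_mulVec_nonneg hp (fun i j hij => ?_) hζ
      simp [hA, hMat, hij, hW', hW0]
    have hb : 0 ≤ c + w ⬝ᵥ A⁻¹.mulVec η' :=
      add_nonneg (hη _) (Finset.sum_nonneg fun i _ => mul_nonneg (hW0 _ _) (hG _ (fun i => hη _) i))
    have hdet := hp.det_pos
    have hsymm : η' ⬝ᵥ A⁻¹.mulVec w = w ⬝ᵥ A⁻¹.mulVec η' := by
      have hT : A⁻¹.transpose = A⁻¹ := by
        have := hp.inv.isHermitian
        rwa [Matrix.IsHermitian, Matrix.conjTranspose_eq_transpose_of_trivial] at this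
      rw [dotProduct_comm, ← Matrix.vecMul_transpose, hT, Matrix.dotProduct_mulVec]
    have hpt : ∀ y, stz W η (Sum.elim h' fun _ => y) =
        ENNReal.ofReal (Real.exp (-(∑ i, ∑ j, A i j - 2 * ∑ i, w i + w ⬝ᵥ A⁻¹.mulVec w
          + η' ⬝ᵥ A⁻¹.mulVec η') / 2) / Real.sqrt A.det) *
        (if 0 < y - w ⬝ᵥ A⁻¹.mulVec w then
          ENNReal.ofReal (Real.exp (-((y - w ⬝ᵥ A⁻¹.mulVec w) + (c + w ⬝ᵥ A⁻¹.mulVec η') ^ 2 /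
            (y - w ⬝ᵥ A⁻¹.mulVec w)) / 2) / Real.sqrt (y - w ⬝ᵥ A⁻¹.mulVec w)) else 0) := by
      intro y
      rw [stz, hblock, ← hA, schur_posDef_iff]
      by_cases hs : 0 < y - w ⬝ᵥ A⁻¹.mulVec w
      swap
      · rw [if_neg (fun h => hs h.2), if_neg hs, mul_zero]
      rw [if_pos ⟨hp, hs⟩, if_pos hs, ← ENNReal.ofReal_mul (by positivity), schur_det _ _ hp, hη0,
        schur_quad _ _ _ _ hp hs, Real.sqrt_mul hdet.le, div_mul_div_comm, ← Real.exp_add]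
      congr 3
      simp only [Fintype.sum_sum_type, Matrix.fromBlocks_apply₁₁, Matrix.fromBlocks_apply₁₂,
        Matrix.fromBlocks_apply₂₁, Matrix.fromBlocks_apply₂₂, Matrix.of_apply,
        Finset.univ_unique, Finset.sum_singleton, Finset.sum_add_distrib, Finset.sum_neg_distrib]
      ring
    simp only [hpt]
    rw [lintegral_const_mul']
    swap
    · exact ENNReal.ofReal_ne_top
    rw [lintegral_inverse_gaussian_shift hb, stz, if_pos hp, ← ENNReal.ofReal_mul (by positivity),
      ← ENNReal.ofReal_mul (by positivity)]
    congr 1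
    rw [div_mul_eq_mul_div, ← mul_div_assoc]
    congr 1
    rw [mul_left_comm, ← Real.exp_add, mul_assoc, ← Real.exp_add]
    congr 2
    rw [← hA, Matrix.mulVec_add, add_dotProduct, dotProduct_add, dotProduct_add, hsymm]
    ring
  simp only [hin]
  rw [lintegral_const_mul']
  swap
  · exact ENNReal.ofReal_ne_top
  rw [hα W' (η' + w) hW's (fun i j => hW0 _ _) (fun i => hWd _)
    (fun i => add_nonneg (hη _) (hW0 _ _)), ← ENNReal.ofReal_mul (by positivity)]
  congr 1
  rw [Fintype.card_sum, Fintype.card_unit, pow_succ, mul_mul_mul_comm, ← Real.exp_add, mul_comm (_ ^ _)]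
  congr 2
  simp only [Fintype.sum_sum_type, Finset.univ_unique, Finset.sum_singleton, Pi.add_apply,
    Finset.sum_add_distrib]
  simp only [hη', hc]
  ring_nf

/-- The integral formula of Sabot, Tarrès and Zeng. -/
theorem stzFormula (ι : Type*) [Fintype ι] : StzFormula ι := by
  intro _
  revert ‹DecidableEq ι›
  change StzFormula ι
  refine Fintype.induction_empty_option (P := fun α _ => StzFormula α) ?_ stzFormula_empty ?_ ι
  · intro α β _ e h
    exact @StzFormula.congr α β (Fintype.ofEquiv β e.symm) _ e h
  · intro α _ h
    exact StzFormula.congr (Equiv.optionEquivSumPUnit α).symm h.sum_unit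

section ChangeOfVariables

variable {ι : Type*} [Fintype ι]

/-- The potential for which `exp ∘ t` solves the Schrödinger equation with source `η`. -/
noncomputable def pot (W : Matrix ι ι ℝ) (η t : ι → ℝ) (i : ι) : ℝ :=
  ∑ j, W i j * Real.exp (t j - t i) + η i * Real.exp (-t i)

theorem pot_mul_exp (W : Matrix ι ι ℝ) (η t : ι → ℝ) (i : ι) :
    pot W η t i * Real.exp (t i) = ∑ j, W i j * Real.exp (t j) + η i := by
  rw [pot, add_mul, Finset.sum_mul, mul_assoc, ← Real.exp_add]
  congr 1
  · refine Finset.sum_congr rfl fun j _ => ?_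
    rw [mul_assoc, ← Real.exp_add]
    ring_nf
  · simp

variable [DecidableEq ι] {W : Matrix ι ι ℝ} {η : ι → ℝ}

theorem hMat_mulVec (h x : ι → ℝ) (i : ι) :
    (hMat W h).mulVec x i = h i * x i - ∑ j, W i j * x j := by
  rw [hMat, Matrix.sub_mulVec, Pi.sub_apply, Matrix.mulVec_diagonal]
  rfl

theorem hMat_pot_mulVec (t : ι → ℝ) :
    (hMat W (pot W η t)).mulVec (fun i => Real.exp (t i)) = η := by
  ext i
  rw [hMat_mulVec, pot_mul_exp]
  ring

theorem hMat_pot_quad (hW : W.IsSymm) (t φ : ι → ℝ) :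
    (fun i => Real.exp (t i) * φ i) ⬝ᵥ
      (hMat W (pot W η t)).mulVec (fun i => Real.exp (t i) * φ i) =
    (1 / 2) * ∑ i, ∑ j, W i j * Real.exp (t i) * Real.exp (t j) * (φ i - φ j) ^ 2 +
      ∑ i, η i * Real.exp (t i) * φ i ^ 2 := by
  have h1 : ∀ i, (Real.exp (t i) * φ i) *
      (hMat W (pot W η t)).mulVec (fun i => Real.exp (t i) * φ i) i =
      ∑ j, (W i j * Real.exp (t i) * Real.exp (t j) * φ i ^ 2 -
        W i j * Real.exp (t i) * Real.exp (t j) * (φ i * φ j)) +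
        η i * Real.exp (t i) * φ i ^ 2 := by
    intro i
    rw [hMat_mulVec, ← mul_assoc, pot_mul_exp, Finset.sum_sub_distrib, mul_sub, Finset.mul_sum]
    simp only [add_mul, mul_add, Finset.sum_mul, Finset.mul_sum]
    rw [add_sub_right_comm]
    congr 1
    · congr 1
      · refine Finset.sum_congr rfl fun j _ => ?_
        ring
      · refine Finset.sum_congr rfl fun j _ => ?_
        ring
    · ring
  have h2 : ∑ i, ∑ j, W i j * Real.exp (t i) * Real.exp (t j) * φ i ^ 2 =
      ∑ i, ∑ j, W i j * Real.exp (t i) * Real.exp (t j) * φ j ^ 2 := by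
    rw [Finset.sum_comm]
    refine Finset.sum_congr rfl fun i _ => Finset.sum_congr rfl fun j _ => ?_
    rw [hW.apply]
    ring
  have h3 : ∑ i, ∑ j, W i j * Real.exp (t i) * Real.exp (t j) * (φ i - φ j) ^ 2 =
      ∑ i, ∑ j, W i j * Real.exp (t i) * Real.exp (t j) * φ i ^ 2 +
      ∑ i, ∑ j, W i j * Real.exp (t i) * Real.exp (t j) * φ j ^ 2 -
      2 * ∑ i, ∑ j, W i j * Real.exp (t i) * Real.exp (t j) * (φ i * φ j) := by
    simp only [← Finset.sum_add_distrib, ← Finset.sum_sub_distrib, Finset.mul_sum]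
    refine Finset.sum_congr rfl fun i _ => Finset.sum_congr rfl fun j _ => ?_
    ring
  simp only [dotProduct]
  rw [Finset.sum_congr rfl fun i _ => h1 i, Finset.sum_add_distrib, h3, ← h2]
  simp only [Finset.sum_sub_distrib]
  ring

/-- The weights and the source see every vertex. -/
def Conn (W : Matrix ι ι ℝ) (η : ι → ℝ) : Prop :=
  ∀ φ : ι → ℝ, (∀ i j, 0 < W i j → φ i = φ j) → (∀ i, 0 < η i → φ i = 0) → φ = 0

theorem hMat_pot_posDef (hW : W.IsSymm) (hW0 : ∀ i j, 0 ≤ W i j) (hη : ∀ i, 0 ≤ η i)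
    (hc : Conn W η) (t : ι → ℝ) : (hMat W (pot W η t)).PosDef := by
  refine Matrix.PosDef.of_dotProduct_mulVec_pos (hMat_isHermitian W hW _) fun x hx => ?_
  set φ : ι → ℝ := fun i => x i / Real.exp (t i) with hφ
  have hxφ : x = fun i => Real.exp (t i) * φ i := by
    ext i
    simp only [hφ]
    field_simp
  rw [star_trivial, hxφ, hMat_pot_quad hW]
  have p1 : ∀ i j, 0 ≤ W i j * Real.exp (t i) * Real.exp (t j) * (φ i - φ j) ^ 2 := fun i j => by
    have := hW0 i j; positivity
  have p2 : ∀ i, 0 ≤ η i * Real.exp (t i) * φ i ^ 2 := fun i => by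
    have := hη i; positivity
  have s1 : 0 ≤ ∑ i, ∑ j, W i j * Real.exp (t i) * Real.exp (t j) * (φ i - φ j) ^ 2 :=
    Finset.sum_nonneg fun i _ => Finset.sum_nonneg fun j _ => p1 i j
  have s2 : 0 ≤ ∑ i, η i * Real.exp (t i) * φ i ^ 2 := Finset.sum_nonneg fun i _ => p2 i
  by_contra hneg
  push Not at hneg
  have z1 : ∑ i, ∑ j, W i j * Real.exp (t i) * Real.exp (t j) * (φ i - φ j) ^ 2 = 0 := by linarith
  have z2 : ∑ i, η i * Real.exp (t i) * φ i ^ 2 = 0 := by linarith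
  have h0 : φ = 0 := by
    refine hc φ (fun i j hij => ?_) fun i hi => ?_
    · have := (Finset.sum_eq_zero_iff_of_nonneg fun i _ => Finset.sum_nonneg fun j _ => p1 i j).1 z1
        i (Finset.mem_univ _)
      have := (Finset.sum_eq_zero_iff_of_nonneg fun j _ => p1 i j).1 this j (Finset.mem_univ _)
      have e : 0 < W i j * Real.exp (t i) * Real.exp (t j) := by positivity
      have := (mul_eq_zero.1 this).resolve_left e.ne'
      exact sub_eq_zero.1 (pow_eq_zero_iff (two_ne_zero) |>.1 this)
    · have := (Finset.sum_eq_zero_iff_of_nonneg fun i _ => p2 i).1 z2 i (Finset.mem_univ _)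
      have e : 0 < η i * Real.exp (t i) := by positivity
      have := (mul_eq_zero.1 this).resolve_left e.ne'
      exact pow_eq_zero_iff (two_ne_zero) |>.1 this
  apply hx
  rw [hxφ, h0]
  ext i
  simp

theorem pot_injective (hW : W.IsSymm) (hW0 : ∀ i j, 0 ≤ W i j) (hη : ∀ i, 0 ≤ η i)
    (hc : Conn W η) : Function.Injective (pot W η) := by
  intro t t' htt
  have h1 := hMat_pot_mulVec (W := W) (η := η) t
  have h2 := hMat_pot_mulVec (W := W) (η := η) t'
  have hp := hMat_pot_posDef hW hW0 hη hc t'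
  rw [htt] at h1
  have h3 := Matrix.mulVec_injective_of_isUnit hp.isUnit (h1.trans h2.symm)
  ext i
  exact Real.exp_injective (congrFun h3 i)

theorem range_pot (hW : W.IsSymm) (hW0 : ∀ i j, 0 ≤ W i j) (hη : ∀ i, 0 ≤ η i)
    (hc : Conn W η) : Set.range (pot W η) = {h | (hMat W h).PosDef} := by
  ext h
  constructor
  · rintro ⟨t, rfl⟩
    exact hMat_pot_posDef hW hW0 hη hc t
  intro hp
  simp only [Set.mem_ofPred_eq] at hp
  set g := (hMat W h)⁻¹.mulVec η with hg
  have hHdet : IsUnit (hMat W h).det := (Matrix.isUnit_iff_isUnit_det _).1 hp.isUnit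
  have hHg : (hMat W h).mulVec g = η := by
    rw [hg, Matrix.mulVec_mulVec, Matrix.mul_nonsing_inv _ hHdet, Matrix.one_mulVec]
  have hg0 : ∀ i, 0 ≤ g i := by
    refine inv_mulVec_nonneg hp (fun i j hij => ?_) hη
    simp [hMat, hij, hW0]
  have heq : ∀ i, h i * g i - ∑ j, W i j * g j = η i := fun i => by
    rw [← hMat_mulVec, hHg]
  have hz : ∀ i, g i = 0 → η i = 0 ∧ ∀ j, W i j * g j = 0 := by
    intro i hi
    have h1 := heq i
    rw [hi, mul_zero, zero_sub] at h1
    have p : ∀ j, 0 ≤ W i j * g j := fun j => mul_nonneg (hW0 _ _) (hg0 _)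
    have s := Finset.sum_nonneg fun j (_ : j ∈ Finset.univ) => p j
    have := hη i
    refine ⟨by linarith, fun j => ?_⟩
    exact (Finset.sum_eq_zero_iff_of_nonneg fun j _ => p j).1 (by linarith) j (Finset.mem_univ _)
  have hφ := hc (fun i => if g i = 0 then 1 else 0) (fun i j hij => by
      have key : ∀ i j, 0 < W i j → g i = 0 → g j = 0 := fun i j hij hi =>
        (mul_eq_zero.1 ((hz i hi).2 j)).resolve_left hij.ne'
      have h1 := key i j hij
      have h2 := key j i (by rwa [hW.apply])
      by_cases hi : g i = 0
      · simp [hi, h1 hi]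
      · have : g j ≠ 0 := fun h => hi (h2 h)
        simp [hi, this]) (fun i hi => by
      rw [if_neg]
      intro h
      exact hi.ne' (hz i h).1)
  have hgpos : ∀ i, 0 < g i := by
    intro i
    refine lt_of_le_of_ne (hg0 i) fun h => ?_
    have := congrFun hφ i
    simp [← h] at this
  refine ⟨fun i => Real.log (g i), ?_⟩
  ext i
  have h1 := pot_mul_exp W η (fun i => Real.log (g i)) i
  simp only [Real.exp_log (hgpos _)] at h1
  have h2 : h i * g i = ∑ j, W i j * g j + η i := by linarith [heq i]
  exact mul_right_cancel₀ (hgpos i).ne' (h1.trans h2.symm)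

theorem hasFDerivAt_pot (t : ι → ℝ) :
    HasFDerivAt (pot W η) (Matrix.toLin' (Matrix.diagonal (fun i => -Real.exp (-t i)) *
      hMat W (pot W η t) * Matrix.diagonal (fun i => Real.exp (t i)))).toContinuousLinearMap t := by
  rw [hasFDerivAt_pi']
  intro i
  have hp : ∀ j, HasFDerivAt (fun t : ι → ℝ => t j) (ContinuousLinearMap.proj (R := ℝ) j) t :=
    fun j => hasFDerivAt_apply j t
  have h1 : HasFDerivAt (fun t => pot W η t i) (∑ j, W i j • (Real.exp (t j - t i) •
      ((ContinuousLinearMap.proj (R := ℝ) j : (ι → ℝ) →L[ℝ] ℝ) - ContinuousLinearMap.proj (R := ℝ) i))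
      + η i • (Real.exp (-t i) • -(ContinuousLinearMap.proj (R := ℝ) i : (ι → ℝ) →L[ℝ] ℝ))) t := by
    refine HasFDerivAt.add (HasFDerivAt.fun_sum fun j _ => ?_) ?_
    · exact (((hp j).sub (hp i)).exp).const_mul _
    · exact ((hp i).neg.exp).const_mul _
  refine h1.congr_fderiv ?_
  ext x
  simp only [add_apply, sum_apply,
    smul_apply, sub_apply, ContinuousLinearMap.proj_apply,
    neg_apply, smul_eq_mul, ContinuousLinearMap.comp_apply,
    LinearMap.coe_toContinuousLinearMap', Matrix.toLin'_apply]
  rw [← Matrix.mulVec_mulVec, ← Matrix.mulVec_mulVec, Matrix.mulVec_diagonal, hMat_mulVec]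
  simp only [Matrix.mulVec_diagonal]
  rw [← mul_assoc (pot W η t i), pot_mul_exp]
  simp only [mul_sub, Finset.sum_sub_distrib, Finset.mul_sum, add_mul, mul_add, Finset.sum_mul]
  have e1 : ∀ j, Real.exp (t j - t i) = Real.exp (-t i) * Real.exp (t j) := fun j => by
    rw [← Real.exp_add]; ring_nf
  simp only [e1]
  have e2 : ∑ j, -Real.exp (-t i) * (W i j * Real.exp (t j) * x i) =
    - ∑ j, W i j * (Real.exp (-t i) * Real.exp (t j) * x i) := by
    rw [← Finset.sum_neg_distrib]
    exact Finset.sum_congr rfl fun j _ => by ring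
  have e3 : ∑ j, -Real.exp (-t i) * (W i j * (Real.exp (t j) * x j)) =
    - ∑ j, W i j * (Real.exp (-t i) * Real.exp (t j) * x j) := by
    rw [← Finset.sum_neg_distrib]
    exact Finset.sum_congr rfl fun j _ => by ring
  rw [e2, e3]
  ring

/-- The supersymmetric hyperbolic sigma-model measure has an explicit total mass. -/
theorem lintegral_exp_sqrt_det (hW : W.IsSymm) (hW0 : ∀ i j, 0 ≤ W i j) (hWd : ∀ i, W i i = 0)
    (hη : ∀ i, 0 ≤ η i) (hc : Conn W η) :
    ∫⁻ t : ι → ℝ, ENNReal.ofReal (Real.exp (-(∑ i, (pot W η t i - ∑ j, W i j +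
      η i * Real.exp (t i))) / 2) * Real.sqrt (hMat W (pot W η t)).det) =
      ENNReal.ofReal (Real.sqrt (2 * Real.pi) ^ (Fintype.card ι) * Real.exp (-∑ i, η i)) := by
  rw [← stzFormula ι W η hW hW0 hWd hη]
  have h1 : ∫⁻ h : ι → ℝ, stz W η h = ∫⁻ h in pot W η '' Set.univ, stz W η h := by
    rw [Set.image_univ, range_pot hW hW0 hη hc, ← lintegral_indicator (measurableSet_posDef W hW)]
    refine lintegral_congr fun h => ?_
    by_cases hp : (hMat W h).PosDef
    · rw [Set.indicator_of_mem (by exact hp)]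
    · rw [Set.indicator_of_notMem (by exact hp), stz, if_neg hp]
  rw [h1, lintegral_image_eq_lintegral_abs_det_fderiv_mul volume MeasurableSet.univ
    (fun t _ => (hasFDerivAt_pot t).hasFDerivWithinAt) (pot_injective hW hW0 hη hc).injOn,
    setLIntegral_univ]
  refine lintegral_congr fun t => ?_
  have hp := hMat_pot_posDef hW hW0 hη hc t
  have hd := hp.det_pos
  have hdet : |(Matrix.toLin' (Matrix.diagonal (fun i => -Real.exp (-t i)) *
      hMat W (pot W η t) * Matrix.diagonal
        (fun i => Real.exp (t i)))).toContinuousLinearMap.det| = (hMat W (pot W η t)).det := by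
    rw [ContinuousLinearMap.det, LinearMap.coe_toContinuousLinearMap, LinearMap.det_toLin',
      Matrix.det_mul, Matrix.det_mul, Matrix.det_diagonal, Matrix.det_diagonal, abs_mul, abs_mul,
      Finset.abs_prod, Finset.abs_prod, abs_of_pos hd, mul_right_comm, ← Finset.prod_mul_distrib]
    rw [Finset.prod_eq_one, one_mul]
    intro i _
    rw [abs_neg, abs_of_pos (Real.exp_pos _), abs_of_pos (Real.exp_pos _), ← Real.exp_add]
    simp
  have hHdet : IsUnit (hMat W (pot W η t)).det := (Matrix.isUnit_iff_isUnit_det _).1 hp.isUnit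
  have hg : (hMat W (pot W η t))⁻¹.mulVec η = fun i => Real.exp (t i) := by
    have := congrArg (hMat W (pot W η t))⁻¹.mulVec (hMat_pot_mulVec (W := W) (η := η) t)
    rw [Matrix.mulVec_mulVec, Matrix.nonsing_inv_mul _ hHdet, Matrix.one_mulVec] at this
    exact this.symm
  rw [hdet, stz, if_pos hp, ← ENNReal.ofReal_mul hd.le, hg]
  congr 1
  have key : ∀ x d : ℝ, d * (x / Real.sqrt d) = x * Real.sqrt d := fun x d => by
    rw [mul_div_assoc', mul_comm, mul_div_assoc, Real.div_sqrt]
  rw [key]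
  have : ∑ i, (pot W η t i - ∑ j, W i j + η i * Real.exp (t i)) =
      ∑ i, ∑ j, hMat W (pot W η t) i j + η ⬝ᵥ fun i => Real.exp (t i) := by
    rw [Finset.sum_add_distrib]
    congr 1
    refine Finset.sum_congr rfl fun i _ => ?_
    simp [hMat, Matrix.diagonal_apply]
  rw [this]

end ChangeOfVariables

/-- A weighted sum over maps of squared minors computes the determinant of a Gram matrix. -/
theorem factorial_mul_det_gram {ι E : Type*} [Fintype ι] [DecidableEq ι] [Fintype E]
    (x : E → ℝ) (b : E → ι → ℝ) :
    ((Fintype.card ι).factorial : ℝ) * (Matrix.of fun i j => ∑ e, x e * b e i * b e j).det =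
      ∑ σ : ι → E, (∏ i, x (σ i)) * (Matrix.of fun i j => b (σ i) j).det ^ 2 := by
  have h1 : (Matrix.of fun i j => ∑ e, x e * b e i * b e j).det =
      ∑ σ : ι → E, (∏ i, x (σ i)) * ((∏ i, b (σ i) i) * (Matrix.of fun i j => b (σ i) j).det) := by
    have e1 : (Matrix.of fun i j => ∑ e, x e * b e i * b e j) =
        (fun i => ∑ e, (x e * b e i) • b e : Matrix ι ι ℝ) := by
      ext i j
      simp
    have := (Matrix.detRowAlternating (n := ι) (R := ℝ)).toMultilinearMap.map_sum
      (fun (i : ι) (e : E) => (x e * b e i) • b e)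
    rw [e1]
    refine this.trans (Finset.sum_congr rfl fun σ _ => ?_)
    have h2 := Matrix.det_mul_column (fun i => x (σ i) * b (σ i) i)
      (Matrix.of fun i j => b (σ i) j)
    rw [← mul_assoc, ← Finset.prod_mul_distrib, ← h2]
    rfl
  have h2 : ∀ π : Equiv.Perm ι, (Matrix.of fun i j => ∑ e, x e * b e i * b e j).det =
      ∑ σ : ι → E, (∏ i, x (σ i)) * (Matrix.of fun i j => b (σ i) j).det *
        (((Equiv.Perm.sign π : ℤ) : ℝ) * ∏ i, b (σ (π i)) i) := by
    intro π
    rw [h1, ← (Equiv.arrowCongr π.symm (Equiv.refl E)).sum_comp]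
    refine Finset.sum_congr rfl fun σ _ => ?_
    have e1 : (Matrix.of fun i j => b (σ (π i)) j).det =
        ((Equiv.Perm.sign π : ℤ) : ℝ) * (Matrix.of fun i j => b (σ i) j).det := by
      rw [← Matrix.det_permute]
      rfl
    have e2 : ∏ i, x (σ (π i)) = ∏ i, x (σ i) := Equiv.prod_comp π fun i => x (σ i)
    simp only [Equiv.arrowCongr_apply, Equiv.symm_symm, Equiv.coe_refl, Function.comp_apply, id]
    rw [e1, e2]
    ring
  have h3 : ∑ _π : Equiv.Perm ι, (Matrix.of fun i j => ∑ e, x e * b e i * b e j).det =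
      ((Fintype.card ι).factorial : ℝ) * (Matrix.of fun i j => ∑ e, x e * b e i * b e j).det := by
    rw [Finset.sum_const, Finset.card_univ, Fintype.card_perm, nsmul_eq_mul]
  rw [← h3, Finset.sum_congr rfl fun π _ => h2 π, Finset.sum_comm]
  refine Finset.sum_congr rfl fun σ _ => ?_
  rw [← Finset.mul_sum, sq, mul_assoc]
  congr 2
  rw [Matrix.det_apply']
  rfl

theorem det_gram_nonneg {ι E : Type*} [Fintype ι] [DecidableEq ι] [Fintype E]
    (x : E → ℝ) (hx : ∀ e, 0 ≤ x e) (b : E → ι → ℝ) :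
    0 ≤ (Matrix.of fun i j => ∑ e, x e * b e i * b e j).det := by
  have h := factorial_mul_det_gram x b
  have h0 : (0 : ℝ) < ((Fintype.card ι).factorial : ℝ) := by exact_mod_cast Nat.factorial_pos _
  refine nonneg_of_mul_nonneg_right ?_ h0
  rw [h]
  exact Finset.sum_nonneg fun σ _ => mul_nonneg (Finset.prod_nonneg fun i _ => hx _) (sq_nonneg _)

theorem det_gram_sq_le {ι E : Type*} [Fintype ι] [DecidableEq ι] [Fintype E]
    (x y z : E → ℝ) (hy : ∀ e, 0 ≤ y e) (hz : ∀ e, 0 ≤ z e) (hxyz : ∀ e, x e ^ 2 = y e * z e)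
    (b : E → ι → ℝ) :
    (Matrix.of fun i j => ∑ e, x e * b e i * b e j).det ^ 2 ≤
      (Matrix.of fun i j => ∑ e, y e * b e i * b e j).det *
      (Matrix.of fun i j => ∑ e, z e * b e i * b e j).det := by
  have h0 : (0 : ℝ) < ((Fintype.card ι).factorial : ℝ) := by exact_mod_cast Nat.factorial_pos _
  refine le_of_mul_le_mul_left ?_ (mul_pos h0 h0)
  rw [mul_mul_mul_comm, factorial_mul_det_gram, factorial_mul_det_gram, ← sq, ← mul_pow,
    factorial_mul_det_gram]
  refine Finset.sum_sq_le_sum_mul_sum_of_sq_le_mul _ (fun σ _ => ?_) (fun σ _ => ?_)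
    fun σ _ => le_of_eq ?_
  · exact mul_nonneg (Finset.prod_nonneg fun i _ => hy _) (sq_nonneg _)
  · exact mul_nonneg (Finset.prod_nonneg fun i _ => hz _) (sq_nonneg _)
  · rw [mul_mul_mul_comm, ← Finset.prod_mul_distrib, mul_pow, ← Finset.prod_pow]
    simp only [hxyz]
    ring

/-- A finite directed multigraph without loops. -/
structure Gr (V E : Type*) where
  /-- source of an edge -/
  s : E → V
  /-- target of an edge -/
  t : E → V
  ne : ∀ e, s e ≠ t e

namespace Gr

variable {V E : Type*} [Fintype V] [DecidableEq V] [Fintype E] (G : Gr V E)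

/-- Signed incidence. -/
def inc (e : E) (v : V) : ℝ := (if G.s e = v then 1 else 0) - (if G.t e = v then 1 else 0)

/-- Sum of a weight over the edges at a vertex. -/
def vsum (x : E → ℝ) (v : V) : ℝ :=
  ∑ e, x e * ((if G.s e = v then 1 else 0) + (if G.t e = v then 1 else 0))

/-- Total weight between two vertices. -/
def wmat (x : E → ℝ) (i j : V) : ℝ :=
  ∑ e, x e * ((if G.s e = i then 1 else 0) * (if G.t e = j then 1 else 0) +
    (if G.s e = j then 1 else 0) * (if G.t e = i then 1 else 0))

/-- The weighted graph Laplacian. -/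
def lap (x : E → ℝ) : Matrix V V ℝ := Matrix.of fun i j => ∑ e, x e * G.inc e i * G.inc e j

/-- The determinant of the Laplacian with the row and column of `r` removed. -/
noncomputable def treeDet (r : V) (x : E → ℝ) : ℝ :=
  (Matrix.of fun i j : {v // v ≠ r} => ∑ e, x e * G.inc e i * G.inc e j).det

/-- Connectedness, phrased through functions constant along edges. -/
def Connected : Prop := ∀ φ : V → ℝ, (∀ e, φ (G.s e) = φ (G.t e)) → ∀ v w, φ v = φ w

theorem wmat_comm (x : E → ℝ) (i j : V) : G.wmat x i j = G.wmat x j i := by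
  unfold wmat
  exact Finset.sum_congr rfl fun e _ => by ring

theorem wmat_self (x : E → ℝ) (i : V) : G.wmat x i i = 0 := by
  unfold wmat
  refine Finset.sum_eq_zero fun e _ => ?_
  have := G.ne e
  by_cases h : G.s e = i
  · have h2 : G.t e ≠ i := fun h3 => this (h.trans h3.symm)
    simp [h2]
  · simp [h]

theorem lap_apply (x : E → ℝ) (i j : V) :
    G.lap x i j = (if i = j then G.vsum x i else 0) - G.wmat x i j := by
  by_cases hij : i = j
  · subst hij
    simp only [lap, Matrix.of_apply, if_true, vsum, wmat, ← Finset.sum_sub_distrib, inc]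
    refine Finset.sum_congr rfl fun e _ => ?_
    split_ifs <;> ring
  · simp only [lap, Matrix.of_apply, if_neg hij, wmat, zero_sub, inc, ← Finset.sum_neg_distrib]
    refine Finset.sum_congr rfl fun e _ => ?_
    have h0 : ∀ k : V, (if k = i then (1 : ℝ) else 0) * (if k = j then 1 else 0) = 0 := by
      intro k
      by_cases h1 : k = i
      · rw [if_neg (fun h2 => hij (h1.symm.trans h2)), mul_zero]
      · rw [if_neg h1, zero_mul]
    linear_combination x e * h0 (G.s e) + x e * h0 (G.t e)

theorem inc_sum (φ : V → ℝ) (e : E) : ∑ v, G.inc e v * φ v = φ (G.s e) - φ (G.t e) := by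
  simp [inc, sub_mul, Finset.sum_sub_distrib]

theorem lap_mulVec (x : E → ℝ) (φ : V → ℝ) (i : V) :
    (G.lap x).mulVec φ i = ∑ e, x e * G.inc e i * (φ (G.s e) - φ (G.t e)) := by
  simp only [lap, Matrix.mulVec, dotProduct, Matrix.of_apply, Finset.sum_mul]
  rw [Finset.sum_comm]
  refine Finset.sum_congr rfl fun e _ => ?_
  rw [← inc_sum, Finset.mul_sum]
  exact Finset.sum_congr rfl fun v _ => by ring

theorem lap_ker (x : E → ℝ) (hx : ∀ e, 0 < x e) (hc : G.Connected) (φ : V → ℝ)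
    (h : (G.lap x).mulVec φ = 0) (v w : V) : φ v = φ w := by
  refine hc φ (fun e => ?_) v w
  have h1 : ∑ i, φ i * (G.lap x).mulVec φ i = 0 := by simp [h]
  have h2 : ∑ i, φ i * (G.lap x).mulVec φ i = ∑ e, x e * (φ (G.s e) - φ (G.t e)) ^ 2 := by
    simp only [lap_mulVec, Finset.mul_sum]
    rw [Finset.sum_comm]
    refine Finset.sum_congr rfl fun e _ => ?_
    have h3 : ∀ c : ℝ, ∑ i, φ i * (x e * G.inc e i * c) = x e * c * ∑ i, G.inc e i * φ i := by
      intro c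
      rw [Finset.mul_sum]
      exact Finset.sum_congr rfl fun i _ => by ring
    rw [h3, inc_sum]
    ring
  rw [h2] at h1
  have h3 := (Finset.sum_eq_zero_iff_of_nonneg fun e _ =>
    mul_nonneg (hx e).le (sq_nonneg _)).1 h1 e (Finset.mem_univ _)
  have := (mul_eq_zero.1 h3).resolve_left (hx e).ne'
  exact sub_eq_zero.1 (pow_eq_zero_iff two_ne_zero |>.1 this)

theorem lap_isSymm (x : E → ℝ) : (G.lap x).IsSymm := by
  ext i j
  simp only [lap, Matrix.transpose_apply, Matrix.of_apply]
  exact Finset.sum_congr rfl fun e _ => by ring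

theorem adjugate_lap_eq (r : V) (x : E → ℝ) : (G.lap x).adjugate r r = G.treeDet r x := by
  rw [Matrix.adjugate_apply, Matrix.twoBlockTriangular_det _ (fun v => v ≠ r)]
  · have h2 : (((G.lap x).updateRow r (Pi.single r 1)).toSquareBlockProp fun i => ¬ i ≠ r).det = 1 := by
      have hu : Unique {v : V // ¬ v ≠ r} := ⟨⟨⟨r, by simp⟩⟩, fun v => Subtype.ext (by simpa using v.2)⟩
      rw [Matrix.det_unique]
      have : ((default : {v : V // ¬ v ≠ r}) : V) = r := by simpa using (default : {v : V // ¬ v ≠ r}).2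
      simp [Matrix.toSquareBlockProp, this]
    rw [h2, mul_one, treeDet]
    congr 1
    ext i j
    simp [Matrix.toSquareBlockProp, lap, Matrix.updateRow_ne i.2]
  · intro i hi j hj
    have : i = r := by simpa using hi
    subst this
    simp [hj]

theorem treeDet_root (r r' : V) (x : E → ℝ) (hx : ∀ e, 0 < x e) (hc : G.Connected) :
    G.treeDet r x = G.treeDet r' x := by
  have hdet : (G.lap x).det = 0 := by
    rw [← Matrix.exists_mulVec_eq_zero_iff]
    refine ⟨fun _ => 1, fun h => one_ne_zero (congrFun h r), ?_⟩
    ext i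
    simp [lap_mulVec]
  have hcol : ∀ k, (G.lap x).mulVec (fun i => (G.lap x).adjugate i k) = 0 := by
    intro k
    have h := Matrix.mul_adjugate (G.lap x)
    rw [hdet, zero_smul] at h
    ext i
    exact congrFun (congrFun h i) k
  have hsym : (G.lap x).adjugate.transpose = (G.lap x).adjugate := by
    rw [Matrix.adjugate_transpose, G.lap_isSymm]
  have h1 : (G.lap x).adjugate r r = (G.lap x).adjugate r' r := G.lap_ker x hx hc _ (hcol r) r r'
  have h2 : (G.lap x).adjugate r r' = (G.lap x).adjugate r' r' := G.lap_ker x hx hc _ (hcol r') r r'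
  have h3 : (G.lap x).adjugate r' r = (G.lap x).adjugate r r' := congrFun (congrFun hsym r) r'
  rw [← adjugate_lap_eq, ← adjugate_lap_eq, h1, h3, h2]

theorem treeDet_nonneg (r : V) (x : E → ℝ) (hx : ∀ e, 0 ≤ x e) : 0 ≤ G.treeDet r x :=
  det_gram_nonneg x hx fun e (i : {v // v ≠ r}) => G.inc e i

theorem treeDet_sq_le (r : V) (x y z : E → ℝ) (hy : ∀ e, 0 ≤ y e) (hz : ∀ e, 0 ≤ z e)
    (hxyz : ∀ e, x e ^ 2 = y e * z e) : G.treeDet r x ^ 2 ≤ G.treeDet r y * G.treeDet r z :=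
  det_gram_sq_le x y z hy hz hxyz fun e (i : {v // v ≠ r}) => G.inc e i

theorem treeDet_smul (r : V) (c : ℝ) (x : E → ℝ) :
    G.treeDet r (fun e => c * x e) = c ^ (Fintype.card {v // v ≠ r}) * G.treeDet r x := by
  rw [treeDet, treeDet, ← Matrix.det_smul]
  congr 1
  ext i j
  simp [Finset.mul_sum, mul_assoc]

theorem continuous_treeDet (r : V) : Continuous (G.treeDet r) := by
  refine Continuous.matrix_det (continuous_matrix fun i j => ?_)
  simp only [Matrix.of_apply]
  fun_prop

theorem continuous_vsum (v : V) : Continuous fun x => G.vsum x v := by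
  unfold vsum
  fun_prop

theorem sum_wmat (x : E → ℝ) (φ : V → ℝ) (i : V) :
    ∑ j, G.wmat x i j * φ j = ∑ e, x e * ((if G.s e = i then 1 else 0) * φ (G.t e) +
      (if G.t e = i then 1 else 0) * φ (G.s e)) := by
  simp only [wmat, Finset.sum_mul]
  rw [Finset.sum_comm]
  refine Finset.sum_congr rfl fun e _ => ?_
  simp [mul_add, add_mul, Finset.sum_add_distrib]

theorem sum_vsum (x : E → ℝ) : ∑ v, G.vsum x v = 2 * ∑ e, x e := by
  simp only [vsum]
  rw [Finset.sum_comm, Finset.mul_sum]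
  refine Finset.sum_congr rfl fun e _ => ?_
  rw [← Finset.mul_sum, Finset.sum_add_distrib]
  simp
  ring

end Gr

/-- Extension of a function by zero at `r`. -/
def ext0 {V : Type*} [DecidableEq V] (r : V) (t : {v // v ≠ r} → ℝ) (v : V) : ℝ :=
  if h : v = r then 0 else t ⟨v, h⟩

theorem ext0_self {V : Type*} [DecidableEq V] (r : V) (t : {v // v ≠ r} → ℝ) : ext0 r t r = 0 := by
  simp [ext0]

theorem ext0_coe {V : Type*} [DecidableEq V] (r : V) (t : {v // v ≠ r} → ℝ) (i : {v // v ≠ r}) :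
    ext0 r t i = t i := by
  simp [ext0, i.2]

namespace Gr

variable {V E : Type*} [Fintype V] [DecidableEq V] [Fintype E] (G : Gr V E)

/-- Edge weights rescaled by a vertex function, in logarithmic coordinates. -/
noncomputable def xw (u : E → ℝ) (τ : V → ℝ) (e : E) : ℝ := Real.exp (u e + τ (G.s e) + τ (G.t e))

theorem wmat_xw (u : E → ℝ) (τ : V → ℝ) (i j : V) :
    G.wmat (G.xw u τ) i j = Real.exp (τ i) * G.wmat (fun e => Real.exp (u e)) i j *
      Real.exp (τ j) := by
  simp only [wmat, Finset.mul_sum, Finset.sum_mul, xw, Real.exp_add]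
  refine Finset.sum_congr rfl fun e _ => ?_
  have h0 : ∀ k l : V, (if k = l then (1 : ℝ) else 0) * Real.exp (τ k) =
      (if k = l then 1 else 0) * Real.exp (τ l) := by
    intro k l
    split_ifs with h
    · rw [h]
    · simp
  linear_combination Real.exp (u e) * (((if G.t e = j then 1 else 0) * Real.exp (τ (G.t e))) *
    h0 (G.s e) i + ((if G.s e = i then 1 else 0) * Real.exp (τ i)) * h0 (G.t e) j +
    ((if G.t e = i then 1 else 0) * Real.exp (τ (G.t e))) * h0 (G.s e) j +
    ((if G.s e = j then 1 else 0) * Real.exp (τ j)) * h0 (G.t e) i)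

theorem vsum_eq_sum_wmat (x : E → ℝ) (i : V) : G.vsum x i = ∑ j, G.wmat x i j := by
  have := G.sum_wmat x (fun _ => 1) i
  simp only [mul_one] at this
  rw [this, vsum]

theorem wmat_nonneg (x : E → ℝ) (hx : ∀ e, 0 ≤ x e) (i j : V) : 0 ≤ G.wmat x i j := by
  refine Finset.sum_nonneg fun e _ => mul_nonneg (hx e) ?_
  split_ifs <;> norm_num

theorem wmat_edge_pos (x : E → ℝ) (hx : ∀ e, 0 < x e) (e : E) : 0 < G.wmat x (G.s e) (G.t e) := by
  refine Finset.sum_pos' (fun e _ => mul_nonneg (hx e).le ?_) ⟨e, Finset.mem_univ _, ?_⟩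
  · split_ifs <;> norm_num
  · refine mul_pos (hx e) ?_
    simp only [if_true]
    split_ifs <;> norm_num

/-- The total mass of the sigma-model measure on a finite connected graph. -/
theorem lintegral_sigma_model (hc : G.Connected) (r : V) (u : E → ℝ) :
    ∫⁻ t : {v // v ≠ r} → ℝ, ENNReal.ofReal (Real.exp (-(∑ v, Real.exp (-2 * ext0 r t v) *
      G.vsum (G.xw u (ext0 r t)) v) / 2) * (∏ i, Real.exp (-t i)) *
      Real.sqrt (G.treeDet r (G.xw u (ext0 r t)))) =
    ENNReal.ofReal (Real.sqrt (2 * Real.pi) ^ (Fintype.card {v // v ≠ r}) *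
      Real.exp (-∑ e, Real.exp (u e))) := by
  set y : E → ℝ := fun e => Real.exp (u e) with hy
  have hy0 : ∀ e, 0 < y e := fun e => Real.exp_pos _
  set W : Matrix {v // v ≠ r} {v // v ≠ r} ℝ := Matrix.of fun i j => G.wmat y i j with hW
  set η : {v // v ≠ r} → ℝ := fun i => G.wmat y i r with hη
  have hWs : W.IsSymm := by
    ext i j
    exact G.wmat_comm y _ _
  have hWW : ∀ i j, 0 < W i j ↔ 0 < G.wmat y i j := fun _ _ => Iff.rfl
  have hconn : Conn W η := by
    intro φ h1 h2
    have h3 : ∀ e, ext0 r φ (G.s e) = ext0 r φ (G.t e) := by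
      intro e
      have hp := G.wmat_edge_pos y hy0 e
      by_cases hs : G.s e = r
      · by_cases ht : G.t e = r
        · rw [hs, ht]
        · rw [hs, ext0_self]
          have := h2 ⟨G.t e, ht⟩ (by
            simp only [hη]; rw [wmat_comm, ← hs]; exact hp)
          simp [ext0, ht, this]
      · by_cases ht : G.t e = r
        · rw [ht, ext0_self]
          have := h2 ⟨G.s e, hs⟩ (by
            simp only [hη]; rw [← ht]; exact hp)
          simp [ext0, hs, this]
        · have := h1 ⟨G.s e, hs⟩ ⟨G.t e, ht⟩ hp
          simp [ext0, hs, ht, this]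
    ext i
    have := hc _ h3 i r
    rwa [ext0_self, ext0_coe] at this
  have hsplit : ∀ (x : E → ℝ) (i : V), G.vsum x i = G.wmat x i r +
      ∑ j : {v // v ≠ r}, G.wmat x i j := fun x i => by
    rw [vsum_eq_sum_wmat, Fintype.sum_eq_add_sum_subtype_ne _ r]
  have hpot : ∀ (t : {v // v ≠ r} → ℝ) (i : {v // v ≠ r}), pot W η t i =
      Real.exp (-2 * ext0 r t i) * G.vsum (G.xw u (ext0 r t)) i := by
    intro t i
    rw [hsplit]
    simp only [wmat_xw, ext0_self, ext0_coe, Real.exp_zero, mul_one]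
    rw [pot, mul_add, add_comm, Finset.mul_sum]
    congr 1
    · rw [← mul_assoc, ← Real.exp_add, mul_comm]
      ring_nf
      rfl
    · refine Finset.sum_congr rfl fun j _ => ?_
      rw [sub_eq_add_neg, Real.exp_add]
      have : Real.exp (-t i) = Real.exp (-2 * t i) * Real.exp (t i) := by
        rw [← Real.exp_add]; ring_nf
      rw [this]
      simp only [hW, Matrix.of_apply]
      ring
  have hdet : ∀ t : {v // v ≠ r} → ℝ, G.treeDet r (G.xw u (ext0 r t)) =
      (∏ i, Real.exp (t i)) ^ 2 * (hMat W (pot W η t)).det := by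
    intro t
    rw [sq, mul_assoc, ← Matrix.det_mul_row, ← Matrix.det_mul_column, treeDet]
    congr 1
    ext i j
    have := G.lap_apply (G.xw u (ext0 r t)) i j
    simp only [lap, Matrix.of_apply] at this
    simp only [Matrix.of_apply]
    rw [this, wmat_xw, ext0_coe, ext0_coe, hMat, Matrix.sub_apply, Matrix.diagonal_apply, hpot]
    by_cases hij : i = j
    · subst hij
      have e2 : Real.exp (-2 * ext0 r t i) * Real.exp (t i) * Real.exp (t i) = 1 := by
        rw [← Real.exp_add, ← Real.exp_add, ext0_coe]
        ring_nf
        simp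
      simp only [if_true, hW, Matrix.of_apply]
      linear_combination (-1) * G.vsum (G.xw u (ext0 r t)) i * e2
    · have : (i : V) ≠ j := fun h => hij (Subtype.ext h)
      simp only [if_neg this, if_neg hij, hW, Matrix.of_apply]
      ring
  have hmass : ∑ e, y e = (∑ i, ∑ j, W i j) / 2 + ∑ i, η i := by
    have h1 := G.sum_vsum y
    rw [Fintype.sum_eq_add_sum_subtype_ne _ r, hsplit] at h1
    rw [Finset.sum_congr rfl fun (i : {v // v ≠ r}) _ => hsplit y i, Finset.sum_add_distrib,
      wmat_self] at h1
    have h2 : ∑ j : {v // v ≠ r}, G.wmat y r j = ∑ i, η i :=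
      Finset.sum_congr rfl fun j _ => G.wmat_comm _ _ _
    have h3 : ∑ i : {v // v ≠ r}, G.wmat y i r = ∑ i, η i := rfl
    have h4 : ∑ i : {v // v ≠ r}, ∑ j : {v // v ≠ r}, G.wmat y i j = ∑ i, ∑ j, W i j := rfl
    rw [h2, h3, h4] at h1
    linarith
  have hmain := lintegral_exp_sqrt_det hWs (fun i j => G.wmat_nonneg y (fun e => (hy0 e).le) i j)
    (fun i => G.wmat_self y i) (fun i => G.wmat_nonneg y (fun e => (hy0 e).le) i r) hconn
  have hsum : ∀ t : {v // v ≠ r} → ℝ, ∑ v, Real.exp (-2 * ext0 r t v) *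
      G.vsum (G.xw u (ext0 r t)) v = ∑ i, (pot W η t i + η i * Real.exp (t i)) := by
    intro t
    rw [Fintype.sum_eq_add_sum_subtype_ne _ r, Finset.sum_add_distrib, add_comm]
    congr 1
    · exact Finset.sum_congr rfl fun i _ => (hpot t i).symm
    · rw [hsplit]
      simp only [wmat_xw, ext0_self, ext0_coe, Real.exp_zero, mul_zero, one_mul, wmat_self,
        zero_add]
      refine Finset.sum_congr rfl fun j _ => ?_
      rw [wmat_comm]
  have hR : Real.sqrt (2 * Real.pi) ^ (Fintype.card {v // v ≠ r}) * Real.exp (-∑ e, y e) =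
      Real.exp (-(∑ i, ∑ j, W i j) / 2) *
      (Real.sqrt (2 * Real.pi) ^ (Fintype.card {v // v ≠ r}) * Real.exp (-∑ i, η i)) := by
    rw [mul_left_comm, ← Real.exp_add, hmass]
    ring_nf
  rw [hR, ENNReal.ofReal_mul (Real.exp_pos _).le, ← hmain, ← lintegral_const_mul' _ _
    ENNReal.ofReal_ne_top]
  refine lintegral_congr fun t => ?_
  rw [← ENNReal.ofReal_mul (Real.exp_pos _).le]
  congr 1
  rw [← mul_assoc, ← Real.exp_add, hdet, Real.sqrt_mul (sq_nonneg _), Real.sqrt_sq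
    (Finset.prod_nonneg fun i _ => (Real.exp_pos _).le), hsum, ← mul_assoc, mul_assoc (Real.exp _),
    ← Finset.prod_mul_distrib, Finset.prod_eq_one, mul_one]
  · congr 2
    simp only [Finset.sum_add_distrib, Finset.sum_sub_distrib]
    ring
  · intro i _
    rw [← Real.exp_add]
    simp

end Gr

theorem lintegral_prod_pi {ι : Type*} [Fintype ι] (f : ι → ℝ → ℝ≥0∞) (hf : ∀ i, Measurable (f i)) :
    ∫⁻ x : ι → ℝ, ∏ i, f i (x i) = ∏ i, ∫⁻ y, f i y := by
  revert f
  refine Fintype.induction_empty_option (P := fun α _ => ∀ f : α → ℝ → ℝ≥0∞,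
    (∀ i, Measurable (f i)) → ∫⁻ x : α → ℝ, ∏ i, f i (x i) = ∏ i, ∫⁻ y, f i y) ?_ ?_ ?_ ι
  · intro α β _ e h f hf
    have hα := Fintype.ofEquiv β e.symm
    have h' := h (fun i => f (e i)) fun i => hf _
    have h1 := volume_measurePreserving_piCongrLeft (fun _ : β => ℝ) e
    rw [MeasurePreserving.lintegral_map_equiv _ _ h1, ← e.prod_comp]
    have h2 : ∀ x : α → ℝ, ∏ i, f i (MeasurableEquiv.piCongrLeft (fun _ : β => ℝ) e x i) =
        ∏ i, f (e i) (x i) := by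
      intro x
      rw [← e.prod_comp]
      simp [MeasurableEquiv.coe_piCongrLeft, Equiv.piCongrLeft_apply_apply]
    simp only [h2]
    convert h'
  · intro f _
    simp [volume_pi]
  · intro α _ h f hf
    have h1 := volume_measurePreserving_piCongrLeft (fun _ : Option α => ℝ)
      (Equiv.optionEquivSumPUnit.{0} α).symm
    rw [MeasurePreserving.lintegral_map_equiv _ _ h1, ← (Equiv.optionEquivSumPUnit.{0} α).symm.prod_comp]
    have h2 : ∀ x : α ⊕ Unit → ℝ, ∏ i, f i (MeasurableEquiv.piCongrLeft (fun _ : Option α => ℝ)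
        (Equiv.optionEquivSumPUnit.{0} α).symm x i) =
        (∏ i, f (some i) (x (Sum.inl i))) * f none (x (Sum.inr ())) := by
      intro x
      rw [← (Equiv.optionEquivSumPUnit.{0} α).symm.prod_comp]
      have h4 : ∀ i, MeasurableEquiv.piCongrLeft (fun _ : Option α => ℝ)
          (Equiv.optionEquivSumPUnit.{0} α).symm x ((Equiv.optionEquivSumPUnit.{0} α).symm i) = x i :=
        fun i => Equiv.piCongrLeft_apply_apply _ _ _ i
      refine (Finset.prod_congr rfl fun i _ => congrArg _ (h4 i)).trans ?_
      simp
    refine (lintegral_congr h2).trans ?_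
    rw [lintegral_sum_unit]
    · have h3 : ∀ x : α → ℝ, ∫⁻ y, (∏ i, f (some i) (x i)) * f none y =
          (∏ i, f (some i) (x i)) * ∫⁻ y, f none y := fun x => lintegral_const_mul _ (hf _)
      refine (lintegral_congr h3).trans ?_
      rw [lintegral_mul_const, h (fun i => f (some i)) fun i => hf _]
      · simp
      · exact Finset.measurable_prod _ fun i _ => (hf _).comp (measurable_pi_apply i)
    · refine Measurable.mul (Finset.measurable_prod _ fun i _ => ?_) ?_
      · exact (hf _).comp (measurable_pi_apply _)
      · exact (hf _).comp (measurable_pi_apply _)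

/-- The one-dimensional normalisation `2 ^ (b / 2) Γ(b / 2)`. -/
noncomputable def lam (b : ℝ) : ℝ := 2 ^ (b / 2) * Real.Gamma (b / 2)

theorem lam_pos {b : ℝ} (hb : 0 < b) : 0 < lam b :=
  mul_pos (by positivity) (Real.Gamma_pos_of_pos (by positivity))

theorem lam_add_two {b : ℝ} (hb : 0 < b) : lam (b + 2) = b * lam b := by
  unfold lam
  rw [show (b + 2) / 2 = b / 2 + 1 by ring, Real.Gamma_add_one (by positivity),
    Real.rpow_add_one (by norm_num)]
  ring

theorem lintegral_lam {b x : ℝ} (hb : 0 < b) (hx : 0 < x) :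
    ∫⁻ c : ℝ, ENNReal.ofReal (Real.exp (b / 2 * c - x / 2 * Real.exp c)) =
      ENNReal.ofReal (x ^ (-b / 2) * lam b) := by
  rw [lintegral_exp_gamma (by positivity) (by positivity), lam, ← mul_assoc]
  congr 2
  rw [one_div, inv_div, Real.div_rpow (by norm_num) hx.le, neg_div, Real.rpow_neg hx.le]
  field_simp

theorem lintegral_lam_neg {b x : ℝ} (hb : 0 < b) (hx : 0 < x) :
    ∫⁻ t : ℝ, ENNReal.ofReal (Real.exp (-b * t - x / 2 * Real.exp (-2 * t))) =
      ENNReal.ofReal (x ^ (-b / 2) * (lam b / 2)) := by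
  have h := lintegral_comp_mul_left_real
    (fun c => ENNReal.ofReal (Real.exp (b / 2 * c - x / 2 * Real.exp c))) (c := -2) (by norm_num)
  rw [lintegral_lam hb hx] at h
  have e : ∀ t : ℝ, b / 2 * (-2 * t) - x / 2 * Real.exp (-2 * t) =
      -b * t - x / 2 * Real.exp (-2 * t) := fun t => by ring
  simp only [e] at h
  have h2 : x ^ (-b / 2) * lam b = |(-2 : ℝ)| * (x ^ (-b / 2) * (lam b / 2)) := by
    rw [abs_neg, abs_of_pos (by norm_num : (0 : ℝ) < 2)]; ring
  rw [h2, ENNReal.ofReal_mul (abs_nonneg _)] at h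
  refine ((ENNReal.mul_right_inj ?_ ENNReal.ofReal_ne_top).1 h).symm
  simp

namespace Gr

variable {V E : Type*} [Fintype V] [DecidableEq V] [Fintype E] (G : Gr V E)

theorem vsum_pos (hc : G.Connected) (hV : Nontrivial V) (x : E → ℝ) (hx : ∀ e, 0 < x e) (v : V) :
    0 < G.vsum x v := by
  by_contra h
  have h1 : ∀ e, 0 ≤ x e * ((if G.s e = v then (1 : ℝ) else 0) + (if G.t e = v then 1 else 0)) :=
    fun e => mul_nonneg (hx e).le (by split_ifs <;> norm_num)
  have h2 : ∀ e, G.s e ≠ v ∧ G.t e ≠ v := by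
    intro e
    by_contra hne
    apply h
    refine Finset.sum_pos' (fun e _ => h1 e) ⟨e, Finset.mem_univ _, mul_pos (hx e) ?_⟩
    by_cases h3 : G.s e = v
    · rw [if_pos h3]; split_ifs <;> norm_num
    · have h4 : G.t e = v := by tauto
      rw [if_pos h4, if_neg h3]; norm_num
  obtain ⟨w, hw⟩ := exists_ne v
  have := hc (fun k => if k = v then 1 else 0) (fun e => by simp [h2 e]) v w
  simp [hw] at this

theorem sum_vsum_mul (a : E → ℝ) (τ : V → ℝ) :
    ∑ v, G.vsum a v * τ v = ∑ e, a e * (τ (G.s e) + τ (G.t e)) := by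
  simp only [vsum, Finset.sum_mul]
  rw [Finset.sum_comm]
  refine Finset.sum_congr rfl fun e _ => ?_
  simp [mul_add, add_mul, Finset.sum_add_distrib]

/-- The magic formula density in its natural gauge. -/
theorem lintegral_magic (hc : G.Connected) (hV : Nontrivial V) (r : V) (a : E → ℝ)
    (ha : ∀ e, 0 < a e) :
    (∫⁻ u : E → ℝ, ENNReal.ofReal (Real.exp (∑ e, a e * u e) *
      Real.exp (-G.vsum (fun e => Real.exp (u e)) r / 2) *
      (∏ i : {v // v ≠ r}, G.vsum (fun e => Real.exp (u e)) i ^ (-(G.vsum a i + 1) / 2)) *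
      Real.sqrt (G.treeDet r fun e => Real.exp (u e)))) *
      ENNReal.ofReal (∏ i : {v // v ≠ r}, (lam (G.vsum a i + 1) / 2)) =
    ENNReal.ofReal (Real.sqrt (2 * Real.pi) ^ (Fintype.card {v // v ≠ r}) *
      ∏ e, Real.Gamma (a e)) := by
  set K : (E → ℝ) → ({v // v ≠ r} → ℝ) → ℝ := fun u t =>
    Real.exp (∑ e, a e * u e) * (Real.exp (-(∑ v, Real.exp (-2 * ext0 r t v) *
      G.vsum (G.xw u (ext0 r t)) v) / 2) * (∏ i, Real.exp (-t i)) *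
      Real.sqrt (G.treeDet r (G.xw u (ext0 r t)))) with hK
  have hext : ∀ v, Continuous fun t : {v // v ≠ r} → ℝ => ext0 r t v := by
    intro v
    unfold ext0
    split_ifs <;> fun_prop
  have hvs : ∀ v, Continuous fun x => G.vsum x v := G.continuous_vsum
  have htd := G.continuous_treeDet r
  have hxw : Continuous fun p : (E → ℝ) × ({v // v ≠ r} → ℝ) => G.xw p.1 (ext0 r p.2) := by
    unfold xw
    fun_prop
  have hKc : Continuous (Function.uncurry K) := by
    simp only [hK]
    unfold Function.uncurry
    fun_prop
  -- integrating `t` first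
  have step1 : ∫⁻ u : E → ℝ, ∫⁻ t, ENNReal.ofReal (K u t) =
      ENNReal.ofReal (Real.sqrt (2 * Real.pi) ^ (Fintype.card {v // v ≠ r}) *
      ∏ e, Real.Gamma (a e)) := by
    have h1 : ∀ u : E → ℝ, ∫⁻ t, ENNReal.ofReal (K u t) =
        ENNReal.ofReal (Real.sqrt (2 * Real.pi) ^ (Fintype.card {v // v ≠ r})) *
        ∏ e, ENNReal.ofReal (Real.exp (a e * u e - 1 * Real.exp (u e))) := by
      intro u
      simp only [hK, ENNReal.ofReal_mul (Real.exp_pos (∑ e, a e * u e)).le]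
      rw [lintegral_const_mul' _ _ ENNReal.ofReal_ne_top, G.lintegral_sigma_model hc r u,
        ← ENNReal.ofReal_prod_of_nonneg (fun _ _ => (Real.exp_pos _).le),
        ← ENNReal.ofReal_mul (Real.exp_pos _).le, ← ENNReal.ofReal_mul (by positivity),
        mul_left_comm, ← Real.exp_add, ← Real.exp_sum, Finset.sum_sub_distrib, sub_eq_add_neg]
      simp
    simp only [h1]
    rw [lintegral_const_mul' _ _ ENNReal.ofReal_ne_top,
      lintegral_prod_pi (fun e y => ENNReal.ofReal (Real.exp (a e * y - 1 * Real.exp y)))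
        (fun e => by fun_prop), ENNReal.ofReal_mul (by positivity),
      ENNReal.ofReal_prod_of_nonneg (fun e _ => (Real.Gamma_pos_of_pos (ha e)).le)]
    congr 1
    refine Finset.prod_congr rfl fun e _ => ?_
    rw [lintegral_exp_gamma (ha e) one_pos]
    simp
  -- integrating `u` first
  have step2 : ∫⁻ u : E → ℝ, ∫⁻ t, ENNReal.ofReal (K u t) =
      ∫⁻ t, ∫⁻ u : E → ℝ, ENNReal.ofReal (K u t) :=
    lintegral_lintegral_swap (ENNReal.measurable_ofReal.comp hKc.measurable).aemeasurable
  set L : (E → ℝ) → ({v // v ≠ r} → ℝ) → ℝ := fun u t =>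
    Real.exp (∑ e, a e * u e) * Real.exp (-G.vsum (fun e => Real.exp (u e)) r / 2) *
      Real.sqrt (G.treeDet r fun e => Real.exp (u e)) *
      ∏ i : {v // v ≠ r}, Real.exp (-(G.vsum a i + 1) * t i -
        G.vsum (fun e => Real.exp (u e)) i / 2 * Real.exp (-2 * t i)) with hL
  have hLc : Continuous (Function.uncurry L) := by
    simp only [hL]
    unfold Function.uncurry
    fun_prop
  have step3 : ∀ t : {v // v ≠ r} → ℝ, ∫⁻ u : E → ℝ, ENNReal.ofReal (K u t) =
      ∫⁻ u : E → ℝ, ENNReal.ofReal (L u t) := by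
    intro t
    rw [← lintegral_add_right_eq_self (μ := (volume : Measure (E → ℝ)))
      (fun u => ENNReal.ofReal (L u t)) (fun e => ext0 r t (G.s e) + ext0 r t (G.t e))]
    refine lintegral_congr fun u => ?_
    congr 1
    have e1 : (fun e => Real.exp ((u + fun e => ext0 r t (G.s e) + ext0 r t (G.t e)) e)) =
        G.xw u (ext0 r t) := by
      ext e
      simp only [xw, Pi.add_apply]
      ring_nf
    have e2 : Real.exp (∑ e, a e * (u + fun e => ext0 r t (G.s e) + ext0 r t (G.t e)) e) =
        Real.exp (∑ e, a e * u e) * ∏ i : {v // v ≠ r}, Real.exp (G.vsum a i * t i) := by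
      rw [← Real.exp_sum, ← Real.exp_add]
      congr 1
      have := G.sum_vsum_mul a (ext0 r t)
      rw [Fintype.sum_eq_add_sum_subtype_ne _ r, ext0_self, mul_zero, zero_add] at this
      simp only [ext0_coe] at this
      rw [this, ← Finset.sum_add_distrib]
      exact Finset.sum_congr rfl fun e _ => by simp only [Pi.add_apply]; ring
    simp only [hL, hK]
    rw [e1, e2]
    set x := G.xw u (ext0 r t) with hx
    have e3 : Real.exp (-(∑ v, Real.exp (-2 * ext0 r t v) * G.vsum x v) / 2) =
        Real.exp (-G.vsum x r / 2) *
        ∏ i : {v // v ≠ r}, Real.exp (-(G.vsum x i / 2 * Real.exp (-2 * t i))) := by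
      rw [← Real.exp_sum, ← Real.exp_add, Fintype.sum_eq_add_sum_subtype_ne _ r]
      congr 1
      simp only [ext0_self, ext0_coe, mul_zero, Real.exp_zero, one_mul]
      rw [neg_add, add_div, ← Finset.sum_neg_distrib, Finset.sum_div]
      congr 1
      exact Finset.sum_congr rfl fun i _ => by ring
    have e4 : ∏ i : {v // v ≠ r}, Real.exp (-(G.vsum a i + 1) * t i -
        G.vsum x i / 2 * Real.exp (-2 * t i)) =
        (∏ i : {v // v ≠ r}, Real.exp (-(G.vsum a i * t i))) *
        (∏ i : {v // v ≠ r}, Real.exp (-t i)) *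
        ∏ i : {v // v ≠ r}, Real.exp (-(G.vsum x i / 2 * Real.exp (-2 * t i))) := by
      rw [← Finset.prod_mul_distrib, ← Finset.prod_mul_distrib]
      refine Finset.prod_congr rfl fun i _ => ?_
      rw [← Real.exp_add, ← Real.exp_add]
      ring_nf
    have e5 : (∏ i : {v // v ≠ r}, Real.exp (G.vsum a i * t i)) *
        (∏ i : {v // v ≠ r}, Real.exp (-(G.vsum a i * t i))) = 1 := by
      rw [← Finset.prod_mul_distrib]
      refine Finset.prod_eq_one fun i _ => ?_
      rw [← Real.exp_add]
      simp
    rw [e3, e4]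
    linear_combination (-1) * Real.exp (∑ e, a e * u e) * Real.exp (-G.vsum x r / 2) *
      Real.sqrt (G.treeDet r x) * (∏ i : {v // v ≠ r}, Real.exp (-t i)) *
      (∏ i : {v // v ≠ r}, Real.exp (-(G.vsum x i / 2 * Real.exp (-2 * t i)))) * e5
  rw [← step1, step2, lintegral_congr step3, lintegral_lintegral_swap
    (by exact (ENNReal.measurable_ofReal.comp (hLc.comp continuous_swap).measurable).aemeasurable),
    ← lintegral_mul_const' _ _ ENNReal.ofReal_ne_top]
  refine lintegral_congr fun u => ?_
  have hx : ∀ i, 0 < G.vsum (fun e => Real.exp (u e)) i :=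
    G.vsum_pos hc hV _ fun e => Real.exp_pos _
  have hai : ∀ i, 0 < G.vsum a i := G.vsum_pos hc hV _ ha
  have hp0 : 0 ≤ ∏ i : {v // v ≠ r}, G.vsum (fun e => Real.exp (u e)) i ^ (-(G.vsum a i + 1) / 2) :=
    Finset.prod_nonneg fun i _ => Real.rpow_nonneg (hx i).le _
  set C := Real.exp (∑ e, a e * u e) * Real.exp (-G.vsum (fun e => Real.exp (u e)) r / 2) *
      Real.sqrt (G.treeDet r fun e => Real.exp (u e)) with hC
  have hC0 : 0 ≤ C := by positivity
  have h1 : ∀ t, ENNReal.ofReal (L u t) = ENNReal.ofReal C * ∏ i : {v // v ≠ r}, ENNReal.ofReal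
      (Real.exp (-(G.vsum a i + 1) * t i -
        G.vsum (fun e => Real.exp (u e)) i / 2 * Real.exp (-2 * t i))) := by
    intro t
    rw [← ENNReal.ofReal_prod_of_nonneg (fun _ _ => (Real.exp_pos _).le), ← ENNReal.ofReal_mul hC0]
  simp only [h1]
  rw [lintegral_const_mul' _ _ ENNReal.ofReal_ne_top, lintegral_prod_pi (fun (i : {v // v ≠ r}) y =>
    ENNReal.ofReal (Real.exp (-(G.vsum a i + 1) * y -
        G.vsum (fun e => Real.exp (u e)) i / 2 * Real.exp (-2 * y)))) (fun e => by fun_prop)]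
  rw [Finset.prod_congr rfl fun (i : {v // v ≠ r}) _ => lintegral_lam_neg
    (by linarith [hai i] : 0 < G.vsum a i + 1) (hx i),
    ← ENNReal.ofReal_prod_of_nonneg, ← ENNReal.ofReal_mul hC0, ← ENNReal.ofReal_mul (by positivity),
    Finset.prod_mul_distrib]
  · congr 1
    rw [hC]
    ring
  · intro i _
    have := lam_pos (by linarith [hai i] : 0 < G.vsum a i + 1)
    have := hx i
    positivity

end Gr

/-- For a function invariant under constant shifts, the choice of gauge is irrelevant. -/
theorem lintegral_gauge {E : Type*} [Fintype E] (h ψ₁ ψ₂ : (E → ℝ) → ℝ≥0∞) (K₁ K₂ : ℝ≥0∞)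
    (hh : Measurable h) (h1 : Measurable ψ₁) (h2 : Measurable ψ₂)
    (hinv : ∀ u c, h (fun e => u e + c) = h u)
    (hK1 : ∀ u : E → ℝ, ∫⁻ c : ℝ, ψ₁ (fun e => u e + c) = K₁)
    (hK2 : ∀ u : E → ℝ, ∫⁻ c : ℝ, ψ₂ (fun e => u e + c) = K₂) :
    (∫⁻ u, h u * ψ₁ u) * K₂ = (∫⁻ u, h u * ψ₂ u) * K₁ := by
  have hm : Measurable fun p : (E → ℝ) × ℝ => fun e => p.1 e + p.2 := by fun_prop
  have hm' : Measurable fun p : (E → ℝ) × ℝ => fun e => p.1 e + -p.2 := by fun_prop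
  have e1 : (∫⁻ u, h u * ψ₁ u) * K₂ = ∫⁻ u, ∫⁻ c : ℝ, h u * ψ₁ u * ψ₂ (fun e => u e + c) := by
    rw [← lintegral_mul_const _ (by exact hh.mul h1)]
    refine lintegral_congr fun u => ?_
    rw [lintegral_const_mul (μ := (volume : Measure ℝ)) (f := fun c => ψ₂ fun e => u e + c) _
      (h2.comp (by fun_prop)), hK2]
  have e2 : (∫⁻ u, h u * ψ₂ u) * K₁ =
      ∫⁻ u, ∫⁻ c : ℝ, h u * ψ₂ u * ψ₁ (fun e => u e + -c) := by
    rw [← lintegral_mul_const _ (by exact hh.mul h2)]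
    refine lintegral_congr fun u => ?_
    rw [lintegral_const_mul (μ := (volume : Measure ℝ)) (f := fun c => ψ₁ fun e => u e + -c) _
      (h1.comp (by fun_prop)), ← hK1 u,
      ← lintegral_neg_eq_self (fun c : ℝ => ψ₁ fun e => u e + c)]
  have m1 : AEMeasurable (Function.uncurry fun (u : E → ℝ) (c : ℝ) =>
      h u * ψ₁ u * ψ₂ fun e => u e + c) (volume.prod volume) :=
    (((hh.comp measurable_fst).mul (h1.comp measurable_fst)).mul (h2.comp hm)).aemeasurable
  have m2 : AEMeasurable (Function.uncurry fun (u : E → ℝ) (c : ℝ) =>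
      h u * ψ₂ u * ψ₁ fun e => u e + -c) (volume.prod volume) :=
    (((hh.comp measurable_fst).mul (h2.comp measurable_fst)).mul (h1.comp hm')).aemeasurable
  rw [e1, e2]
  refine (lintegral_lintegral_swap m1).trans (Eq.trans ?_ (lintegral_lintegral_swap m2).symm)
  refine lintegral_congr fun c => ?_
  rw [← lintegral_add_right_eq_self (μ := (volume : Measure (E → ℝ)))
    (fun u => h u * ψ₂ u * ψ₁ fun e => u e + -c) (fun _ => c)]
  refine lintegral_congr fun u => ?_
  have : h (u + fun _ => c) = h u := hinv u c
  simp only [this, Pi.add_apply, add_neg_cancel_right]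
  rw [mul_right_comm]
  rfl

namespace Gr

variable {V E : Type*} [Fintype V] [DecidableEq V] [Fintype E] (G : Gr V E)

/-- Vertex weights of the edge weights `exp (u e)`. -/
noncomputable def ev (u : E → ℝ) (v : V) : ℝ := G.vsum (fun e => Real.exp (u e)) v

theorem ev_pos (hc : G.Connected) (hV : Nontrivial V) (u : E → ℝ) (v : V) : 0 < G.ev u v :=
  G.vsum_pos hc hV _ (fun _ => Real.exp_pos _) v

theorem vsum_smul (c : ℝ) (x : E → ℝ) (v : V) : G.vsum (fun e => c * x e) v = c * G.vsum x v := by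
  simp only [vsum, Finset.mul_sum, mul_assoc]

theorem ev_shift (u : E → ℝ) (c : ℝ) (v : V) :
    G.ev (fun e => u e + c) v = Real.exp c * G.ev u v := by
  simp only [ev, Real.exp_add, mul_comm _ (Real.exp c), vsum_smul]

@[fun_prop]
theorem continuous_ev (v : V) : Continuous fun u => G.ev u v :=
  (G.continuous_vsum v).comp (by fun_prop)

/-- Shift-invariant form of the mixing density for the walk started at `v`. -/
noncomputable def q (v : V) (a u : E → ℝ) : ℝ :=
  Real.exp (∑ e, a e * u e) * Real.sqrt (G.ev u v) *
    (∏ w, G.ev u w ^ (-(G.vsum a w + 1) / 2)) *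
    Real.sqrt (G.treeDet v fun e => Real.exp (u e))

theorem q_nonneg (hc : G.Connected) (hV : Nontrivial V) (v : V) (a u : E → ℝ) : 0 ≤ G.q v a u := by
  have : 0 ≤ ∏ w, G.ev u w ^ (-(G.vsum a w + 1) / 2) :=
    Finset.prod_nonneg fun w _ => Real.rpow_nonneg (G.ev_pos hc hV u w).le _
  unfold q
  positivity

theorem continuous_q (hc : G.Connected) (hV : Nontrivial V) (v : V) (a : E → ℝ) :
    Continuous fun u => G.q v a u := by
  have h1 : ∀ w, Continuous fun u => G.ev u w ^ (-(G.vsum a w + 1) / 2) := fun w =>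
    (G.continuous_ev w).rpow_const fun u => Or.inl (G.ev_pos hc hV u w).ne'
  have h2 := G.continuous_treeDet v
  unfold q
  fun_prop

theorem q_shift (hc : G.Connected) (hV : Nontrivial V) (v : V) (a u : E → ℝ) (c : ℝ) :
    G.q v a (fun e => u e + c) = G.q v a u := by
  unfold q
  simp only [ev_shift]
  have hx := G.ev_pos hc hV u
  have e1 : (∏ w, (Real.exp c * G.ev u w) ^ (-(G.vsum a w + 1) / 2)) =
      Real.exp (∑ w, c * (-(G.vsum a w + 1) / 2)) * ∏ w, G.ev u w ^ (-(G.vsum a w + 1) / 2) := by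
    rw [Real.exp_sum, ← Finset.prod_mul_distrib]
    refine Finset.prod_congr rfl fun w _ => ?_
    rw [Real.mul_rpow (Real.exp_pos _).le (hx w).le, ← Real.exp_mul]
  have e2 : (fun e => Real.exp (u e + c)) = fun e => Real.exp c * Real.exp (u e) := by
    ext e; rw [Real.exp_add, mul_comm]
  have e3 : Real.sqrt (Real.exp c) = Real.exp (c / 2) := by
    rw [Real.exp_half]
  have e4 : ∑ e, a e * (u e + c) = ∑ e, a e * u e + c * ∑ e, a e := by
    simp only [mul_add, Finset.sum_add_distrib, Finset.sum_mul, mul_comm c]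
  have e5 : ∑ w, c * (-(G.vsum a w + 1) / 2) = -c * ∑ e, a e - c * (Fintype.card V) / 2 := by
    rw [← Finset.mul_sum, ← Finset.sum_div, Finset.sum_neg_distrib, Finset.sum_add_distrib,
      sum_vsum]
    simp
    ring
  have e6 : Real.sqrt (Real.exp c ^ Fintype.card {w // w ≠ v}) =
      Real.exp (c * (Fintype.card V - 1) / 2) := by
    rw [← Real.exp_nat_mul, ← Real.exp_half, Fintype.card_subtype_compl]
    simp only [Fintype.card_subtype_eq]
    rw [Nat.cast_sub (Fintype.card_pos_iff.2 ⟨v⟩)]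
    push_cast
    ring_nf
  rw [e1, e2, treeDet_smul, Real.sqrt_mul (Real.exp_pos _).le, Real.sqrt_mul (by positivity), e3, e4,
    e5, e6, Real.exp_add]
  have e7 : Real.exp (c * ∑ e, a e) * Real.exp (c / 2) *
      Real.exp (-c * ∑ e, a e - c * (Fintype.card V) / 2) *
      Real.exp (c * (Fintype.card V - 1) / 2) = 1 := by
    rw [← Real.exp_add, ← Real.exp_add, ← Real.exp_add, Real.exp_eq_one_iff]
    ring
  linear_combination Real.exp (∑ e, a e * u e) * Real.sqrt (G.ev u v) *
    (∏ w, G.ev u w ^ (-(G.vsum a w + 1) / 2)) *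
    Real.sqrt (G.treeDet v fun e => Real.exp (u e)) * e7

/-- The density `q` in the gauge attached to the vertex `l`. -/
noncomputable def qs (l v : V) (a u : E → ℝ) : ℝ :=
  G.q v a u * (G.ev u l * Real.exp (-G.ev u l))

/-- Total mass of `qs`. -/
noncomputable def qmass (v : V) (a : E → ℝ) : ℝ :=
  Real.sqrt (2 * Real.pi) ^ (Fintype.card V - 1) * (∏ e, Real.Gamma (a e)) /
    (lam (G.vsum a v) * ∏ i ∈ Finset.univ.erase v, (lam (G.vsum a i + 1) / 2))

theorem qmass_pos (hc : G.Connected) (hV : Nontrivial V) (v : V) (a : E → ℝ)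
    (ha : ∀ e, 0 < a e) : 0 < G.qmass v a := by
  have h1 := fun w => G.vsum_pos hc hV a ha w
  have h2 : 0 < ∏ i ∈ Finset.univ.erase v, (lam (G.vsum a i + 1) / 2) :=
    Finset.prod_pos fun i _ => half_pos (lam_pos (by linarith [h1 i]))
  have h3 := lam_pos (h1 v)
  have h4 : 0 < ∏ e, Real.Gamma (a e) := Finset.prod_pos fun e _ => Real.Gamma_pos_of_pos (ha e)
  unfold qmass
  positivity

theorem lintegral_qs (hc : G.Connected) (hV : Nontrivial V) (l v : V) (a : E → ℝ)
    (ha : ∀ e, 0 < a e) :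
    ∫⁻ u : E → ℝ, ENNReal.ofReal (G.qs l v a u) = ENNReal.ofReal (G.qmass v a) := by
  have hx := G.ev_pos hc hV
  have hav := fun w => G.vsum_pos hc hV a ha w
  have hlam := lam_pos (hav v)
  have hP : 0 < ∏ i ∈ Finset.univ.erase v, (lam (G.vsum a i + 1) / 2) :=
    Finset.prod_pos fun i _ => half_pos (lam_pos (by linarith [hav i]))
  have hq := fun u => G.q_nonneg hc hV v a u
  have key := lintegral_gauge (fun u => ENNReal.ofReal (G.q v a u))
    (fun u => ENNReal.ofReal (G.ev u l * Real.exp (-G.ev u l)))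
    (fun u => ENNReal.ofReal (G.ev u v ^ (G.vsum a v / 2) * Real.exp (-G.ev u v / 2)))
    (ENNReal.ofReal 1) (ENNReal.ofReal (lam (G.vsum a v)))
    (ENNReal.measurable_ofReal.comp (G.continuous_q hc hV v a).measurable)
    (ENNReal.measurable_ofReal.comp (by fun_prop : Continuous _).measurable)
    (ENNReal.measurable_ofReal.comp (Continuous.measurable
      (((G.continuous_ev v).rpow_const fun u => Or.inl (hx u v).ne').mul (by fun_prop))))
    (fun u c => by simp only [G.q_shift hc hV])
    (fun u => by
      have h1 : ∀ c, ENNReal.ofReal (G.ev (fun e => u e + c) l *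
          Real.exp (-G.ev (fun e => u e + c) l)) = ENNReal.ofReal (G.ev u l) *
          ENNReal.ofReal (Real.exp (1 * c - G.ev u l * Real.exp c)) := by
        intro c
        rw [← ENNReal.ofReal_mul (hx u l).le, ev_shift, sub_eq_add_neg, Real.exp_add, one_mul]
        ring_nf
      simp only [h1]
      rw [lintegral_const_mul' _ _ ENNReal.ofReal_ne_top, lintegral_exp_gamma one_pos (hx u l),
        ← ENNReal.ofReal_mul (hx u l).le]
      congr 1
      have := (hx u l).ne'
      simp [Real.Gamma_one, this])
    (fun u => by
      have h1 : ∀ c, ENNReal.ofReal (G.ev (fun e => u e + c) v ^ (G.vsum a v / 2) *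
          Real.exp (-G.ev (fun e => u e + c) v / 2)) =
          ENNReal.ofReal (G.ev u v ^ (G.vsum a v / 2)) *
          ENNReal.ofReal (Real.exp (G.vsum a v / 2 * c - G.ev u v / 2 * Real.exp c)) := by
        intro c
        rw [← ENNReal.ofReal_mul (Real.rpow_nonneg (hx u v).le _), ev_shift, sub_eq_add_neg,
          Real.exp_add, Real.mul_rpow (Real.exp_pos _).le (hx u v).le, ← Real.exp_mul]
        ring_nf
      simp only [h1]
      rw [lintegral_const_mul' _ _ ENNReal.ofReal_ne_top, lintegral_lam (hav v) (hx u v),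
        ← ENNReal.ofReal_mul (Real.rpow_nonneg (hx u v).le _), ← mul_assoc,
        ← Real.rpow_add (hx u v)]
      ring_nf
      simp)
  have hm := G.lintegral_magic hc hV v a ha
  have e1 : ∀ u : E → ℝ, Real.exp (∑ e, a e * u e) *
      Real.exp (-G.vsum (fun e => Real.exp (u e)) v / 2) *
      (∏ i : {w // w ≠ v}, G.vsum (fun e => Real.exp (u e)) i ^ (-(G.vsum a i + 1) / 2)) *
      Real.sqrt (G.treeDet v fun e => Real.exp (u e)) =
      G.q v a u * (G.ev u v ^ (G.vsum a v / 2) * Real.exp (-G.ev u v / 2)) := by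
    intro u
    have e2 : Real.sqrt (G.ev u v) * G.ev u v ^ (-(G.vsum a v + 1) / 2) *
        G.ev u v ^ (G.vsum a v / 2) = 1 := by
      rw [Real.sqrt_eq_rpow, ← Real.rpow_add (hx u v), ← Real.rpow_add (hx u v)]
      ring_nf
      simp
    unfold q
    rw [Fintype.prod_eq_mul_prod_subtype_ne (fun w => G.ev u w ^ (-(G.vsum a w + 1) / 2)) v]
    change Real.exp (∑ e, a e * u e) * Real.exp (-G.ev u v / 2) *
      (∏ i : {w // w ≠ v}, G.ev u i ^ (-(G.vsum a i + 1) / 2)) * _ = _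
    linear_combination (-1) * Real.exp (∑ e, a e * u e) * Real.exp (-G.ev u v / 2) *
      (∏ i : {w // w ≠ v}, G.ev u i ^ (-(G.vsum a i + 1) / 2)) *
      Real.sqrt (G.treeDet v fun e => Real.exp (u e)) * e2
  have e3 : ∏ i : {w // w ≠ v}, (lam (G.vsum a i + 1) / 2) =
      ∏ i ∈ Finset.univ.erase v, (lam (G.vsum a i + 1) / 2) := by
    rw [Finset.prod_subtype (p := fun w => w ≠ v) (F := inferInstance)]
    simp
  have e4 : Fintype.card {w // w ≠ v} = Fintype.card V - 1 := by
    rw [Fintype.card_subtype_compl]; simp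
  simp only [e1, e3, e4] at hm
  have e5 : ∀ u, ENNReal.ofReal (G.q v a u) * ENNReal.ofReal (G.ev u l * Real.exp (-G.ev u l)) =
      ENNReal.ofReal (G.qs l v a u) := fun u => (ENNReal.ofReal_mul (hq u)).symm
  simp only [e5, ← ENNReal.ofReal_mul (hq _), ENNReal.ofReal_one, mul_one] at key
  rw [← key, mul_assoc, ← ENNReal.ofReal_mul hlam.le] at hm
  unfold qmass
  rw [ENNReal.ofReal_div_of_pos (by positivity), ← hm, ENNReal.mul_div_cancel_right]
  · exact (ENNReal.ofReal_pos.2 (by positivity)).ne'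
  · exact ENNReal.ofReal_ne_top

end Gr

theorem sum_exp_mul_sum_exp_neg_le {E : Type*} [Fintype E] (p f : E → ℝ) (m c : ℝ)
    (hp : ∀ e, 0 ≤ p e) (hf : ∀ e, p e ≠ 0 → m ≤ f e ∧ f e ≤ m + c) :
    (∑ e, p e * Real.exp (f e)) * (∑ e, p e * Real.exp (-f e)) ≤
      (∑ e, p e) ^ 2 * Real.exp (c ^ 2 / 4) := by
  set g : E → ℝ := fun e => f e - m - c / 2 with hg
  have e1 : ∑ e, p e * Real.exp (f e) = Real.exp (m + c / 2) * ∑ e, p e * Real.exp (g e) := by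
    rw [Finset.mul_sum]
    refine Finset.sum_congr rfl fun e _ => ?_
    rw [mul_left_comm, ← Real.exp_add, hg]
    ring_nf
  have e2 : ∑ e, p e * Real.exp (-f e) = Real.exp (-(m + c / 2)) * ∑ e, p e * Real.exp (-g e) := by
    rw [Finset.mul_sum]
    refine Finset.sum_congr rfl fun e _ => ?_
    rw [mul_left_comm, ← Real.exp_add, hg]
    ring_nf
  have e3 : Real.exp (m + c / 2) * Real.exp (-(m + c / 2)) = 1 := by
    rw [← Real.exp_add]; simp
  have e4 : ∑ e, p e * Real.exp (g e) + ∑ e, p e * Real.exp (-g e) ≤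
      2 * (∑ e, p e) * Real.exp (c ^ 2 / 8) := by
    rw [← Finset.sum_add_distrib, mul_assoc, Finset.sum_mul, Finset.mul_sum]
    refine Finset.sum_le_sum fun e _ => ?_
    by_cases h : p e = 0
    · simp [h]
    · have h1 := hf e h
      have h2 : Real.cosh (g e) ≤ Real.exp (c ^ 2 / 8) := by
        calc Real.cosh (g e) ≤ Real.cosh (c / 2) := by
              rw [Real.cosh_le_cosh, abs_le, abs_of_nonneg (by linarith)]
              simp only [hg]
              constructor <;> linarith
          _ ≤ Real.exp ((c / 2) ^ 2 / 2) := Real.cosh_le_exp_half_sq _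
          _ = _ := by ring_nf
      rw [Real.cosh_eq] at h2
      have := mul_le_mul_of_nonneg_left h2 (hp e)
      linarith
  have h5 : 0 ≤ ∑ e, p e * Real.exp (g e) :=
    Finset.sum_nonneg fun e _ => mul_nonneg (hp e) (Real.exp_pos _).le
  have h6 : 0 ≤ ∑ e, p e * Real.exp (-g e) :=
    Finset.sum_nonneg fun e _ => mul_nonneg (hp e) (Real.exp_pos _).le
  have h7 : Real.exp (c ^ 2 / 8) ^ 2 = Real.exp (c ^ 2 / 4) := by
    rw [← Real.exp_nat_mul]
    ring_nf
  rw [e1, e2, ← h7]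
  have h8 := pow_le_pow_left₀ (add_nonneg h5 h6) e4 2
  nlinarith [sq_nonneg (∑ e, p e * Real.exp (g e) - ∑ e, p e * Real.exp (-g e))]

namespace Gr

variable {V E : Type*} [Fintype V] [DecidableEq V] [Fintype E] (G : Gr V E)

/-- The edge `e` joins `v` and `w`. -/
def Joins (e : E) (v w : V) : Prop := (G.s e = v ∧ G.t e = w) ∨ (G.s e = w ∧ G.t e = v)

theorem vsum_update [DecidableEq E] (a : E → ℝ) (e : E) (v w i : V) (h : G.Joins e v w) :
    G.vsum (fun k => a k + if k = e then 1 else 0) i =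
      G.vsum a i + ((if i = v then 1 else 0) + (if i = w then 1 else 0)) := by
  simp only [vsum, add_mul, Finset.sum_add_distrib]
  congr 1
  simp only [ite_mul, zero_mul, one_mul, Finset.sum_ite_eq', Finset.mem_univ, if_true]
  rcases h with ⟨rfl, rfl⟩ | ⟨rfl, rfl⟩ <;> simp only [eq_comm] <;> ring

theorem qmass_step [DecidableEq E] (hc : G.Connected) (hV : Nontrivial V) (a : E → ℝ)
    (ha : ∀ e, 0 < a e) (e : E) (v w : V) (h : G.Joins e v w) :
    G.qmass w (fun k => a k + if k = e then 1 else 0) = a e / G.vsum a v * G.qmass v a := by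
  have hvw : v ≠ w := by
    rintro rfl
    have := G.ne e
    rcases h with h | h <;> exact this (h.1.trans h.2.symm)
  have hav := fun i => G.vsum_pos hc hV a ha i
  have h1 : ∏ k, Real.Gamma (a k + if k = e then 1 else 0) = a e * ∏ k, Real.Gamma (a k) := by
    rw [← Finset.mul_prod_erase _ _ (Finset.mem_univ e),
      ← Finset.mul_prod_erase _ (fun k => Real.Gamma (a k)) (Finset.mem_univ e), if_pos rfl,
      Real.Gamma_add_one (ha e).ne', mul_assoc]
    congr 2
    refine Finset.prod_congr rfl fun k hk => ?_
    rw [if_neg (Finset.ne_of_mem_erase hk), add_zero]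
  have h2 : ∏ i ∈ Finset.univ.erase w, (lam (G.vsum (fun k => a k + if k = e then 1 else 0) i + 1)
      / 2) = (G.vsum a v * lam (G.vsum a v) / 2) *
      ∏ i ∈ (Finset.univ.erase w).erase v, (lam (G.vsum a i + 1) / 2) := by
    rw [← Finset.mul_prod_erase _ _ (Finset.mem_erase.2 ⟨hvw, Finset.mem_univ v⟩),
      G.vsum_update a e v w v h, if_pos rfl, if_neg hvw,
      show G.vsum a v + (1 + 0) + 1 = G.vsum a v + 2 by ring, lam_add_two (hav v)]
    congr 1
    refine Finset.prod_congr rfl fun i hi => ?_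
    rw [G.vsum_update a e v w i h, if_neg (Finset.ne_of_mem_erase hi),
      if_neg (Finset.ne_of_mem_erase (Finset.mem_of_mem_erase hi))]
    simp
  have h3 : ∏ i ∈ Finset.univ.erase v, (lam (G.vsum a i + 1) / 2) = (lam (G.vsum a w + 1) / 2) *
      ∏ i ∈ (Finset.univ.erase w).erase v, (lam (G.vsum a i + 1) / 2) := by
    rw [← Finset.mul_prod_erase _ _ (Finset.mem_erase.2 ⟨hvw.symm, Finset.mem_univ w⟩),
      Finset.erase_right_comm]
  have h4 : 0 < ∏ i ∈ (Finset.univ.erase w).erase v, (lam (G.vsum a i + 1) / 2) :=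
    Finset.prod_pos fun i _ => half_pos (lam_pos (by linarith [hav i]))
  unfold qmass
  rw [h1, h2, h3, G.vsum_update a e v w w h, if_neg hvw.symm, if_pos rfl, zero_add]
  have h5 := lam_pos (hav v)
  have h6 := lam_pos (by linarith [hav w] : 0 < G.vsum a w + 1)
  have h7 := hav v
  field_simp

theorem qmass_eq (hc : G.Connected) (hV : Nontrivial V) (v w : V) (a : E → ℝ)
    (ha : ∀ e, 0 < a e) (h : G.vsum a v = G.vsum a w) : G.qmass v a = G.qmass w a := by
  have hav := fun i => G.vsum_pos hc hV a ha i
  have h1 := fun i => half_pos (lam_pos (by linarith [hav i] : 0 < G.vsum a i + 1))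
  have h2 : ∏ i ∈ Finset.univ.erase v, (lam (G.vsum a i + 1) / 2) =
      ∏ i ∈ Finset.univ.erase w, (lam (G.vsum a i + 1) / 2) := by
    refine mul_left_cancel₀ (h1 v).ne' ?_
    rw [Finset.mul_prod_erase _ (fun i => lam (G.vsum a i + 1) / 2) (Finset.mem_univ v), h,
      Finset.mul_prod_erase _ (fun i => lam (G.vsum a i + 1) / 2) (Finset.mem_univ w)]
  unfold qmass
  rw [h2, h]

theorem q_root (hc : G.Connected) (hV : Nontrivial V) (v w : V) (a u : E → ℝ) :
    G.q w a u = G.q v a u * Real.sqrt (G.ev u w / G.ev u v) := by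
  have h1 := G.ev_pos hc hV u v
  have h2 := G.ev_pos hc hV u w
  unfold q
  rw [G.treeDet_root w v _ (fun e => Real.exp_pos _) hc, Real.sqrt_div h2.le]
  have := Real.sqrt_pos.2 h1
  field_simp

theorem q_mul_le (hc : G.Connected) (hV : Nontrivial V) (z l : V) (a u f : E → ℝ) (m c : V → ℝ)
    (ha : ∀ e, 0 < a e)
    (f₀ : ℝ) (hz : ∀ e, G.s e = z ∨ G.t e = z → f e = f₀)
    (hl : ∀ e, G.s e = l ∨ G.t e = l → f e = 0)
    (hf : ∀ e v, G.s e = v ∨ G.t e = v → m v ≤ f e ∧ f e ≤ m v + c v) :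
    G.q z a u * G.q l a u ≤ Real.exp (∑ v, (G.vsum a v + 1) * c v ^ 2 / 8 - f₀ / 2) *
      (G.q z a (fun e => u e + f e) * G.q l a (fun e => u e - f e)) := by
  have hx := G.ev_pos hc hV
  have hav := fun i => G.vsum_pos hc hV a ha i
  have hw : ∀ v e, (if G.s e = v then (1 : ℝ) else 0) + (if G.t e = v then 1 else 0) ≠ 0 →
      G.s e = v ∨ G.t e = v := by
    intro v e h
    by_contra h'
    push Not at h'
    simp [h'.1, h'.2] at h
  have hxz : G.ev (fun e => u e + f e) z = Real.exp f₀ * G.ev u z := by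
    simp only [ev, vsum, Finset.mul_sum]
    refine Finset.sum_congr rfl fun e _ => ?_
    by_cases h : (if G.s e = z then (1 : ℝ) else 0) + (if G.t e = z then 1 else 0) = 0
    · rw [h]; simp
    · rw [hz e (hw z e h), Real.exp_add]; ring
  have hxl : G.ev (fun e => u e - f e) l = G.ev u l := by
    simp only [ev, vsum]
    refine Finset.sum_congr rfl fun e _ => ?_
    by_cases h : (if G.s e = l then (1 : ℝ) else 0) + (if G.t e = l then 1 else 0) = 0
    · rw [h]; simp
    · rw [hl e (hw l e h), sub_zero]
  have hxv : ∀ v, G.ev (fun e => u e + f e) v * G.ev (fun e => u e - f e) v ≤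
      G.ev u v ^ 2 * Real.exp (c v ^ 2 / 4) := by
    intro v
    have := sum_exp_mul_sum_exp_neg_le (fun e => Real.exp (u e) *
      ((if G.s e = v then (1 : ℝ) else 0) + (if G.t e = v then 1 else 0))) f (m v) (c v)
      (fun e => mul_nonneg (Real.exp_pos _).le (by split_ifs <;> norm_num))
      (fun e he => hf e v (hw v e (right_ne_zero_of_mul he)))
    simp only [ev, vsum, sub_eq_add_neg, Real.exp_add]
    refine le_trans (le_of_eq ?_) this
    congr 1 <;> exact Finset.sum_congr rfl fun e _ => by ring
  have hT : G.treeDet z (fun e => Real.exp (u e)) ≤ 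
      Real.sqrt (G.treeDet z fun e => Real.exp (u e + f e)) *
      Real.sqrt (G.treeDet z fun e => Real.exp (u e - f e)) := by
    rw [← Real.sqrt_mul (G.treeDet_nonneg _ _ fun e => (Real.exp_pos _).le)]
    refine Real.le_sqrt_of_sq_le ?_
    refine G.treeDet_sq_le _ _ _ _ (fun e => (Real.exp_pos _).le) (fun e => (Real.exp_pos _).le) ?_
    intro e
    rw [← Real.exp_nat_mul, ← Real.exp_add]
    ring_nf
  have hP : ∀ v, (G.ev u v ^ (-(G.vsum a v + 1) / 2)) ^ 2 ≤
      Real.exp ((G.vsum a v + 1) * c v ^ 2 / 8) *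
      (G.ev (fun e => u e + f e) v ^ (-(G.vsum a v + 1) / 2) *
      G.ev (fun e => u e - f e) v ^ (-(G.vsum a v + 1) / 2)) := by
    intro v
    rw [← Real.mul_rpow (hx _ v).le (hx _ v).le]
    have h1 := Real.rpow_le_rpow_of_nonpos (mul_pos (hx _ v) (hx _ v)) (hxv v)
      (show -(G.vsum a v + 1) / 2 ≤ 0 by linarith [hav v])
    refine le_trans (le_of_eq ?_) (mul_le_mul_of_nonneg_left h1 (Real.exp_pos _).le)
    rw [Real.mul_rpow (by positivity) (Real.exp_pos _).le, ← Real.exp_mul, mul_left_comm,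
      ← Real.exp_add, ← Real.rpow_natCast, ← Real.rpow_natCast, ← Real.rpow_mul (hx _ v).le,
      ← Real.rpow_mul (hx _ v).le]
    ring_nf
    simp
  have hPP := Finset.prod_le_prod (s := Finset.univ) (fun v _ => by positivity) fun v _ => hP v
  rw [Finset.prod_mul_distrib, Finset.prod_mul_distrib, Finset.prod_pow, ← Real.exp_sum] at hPP
  have hE : Real.exp (∑ e, a e * (u e + f e)) * Real.exp (∑ e, a e * (u e - f e)) =
      Real.exp (∑ e, a e * u e) ^ 2 := by
    rw [← Real.exp_add, ← Finset.sum_add_distrib, ← Real.exp_nat_mul, Finset.mul_sum]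
    congr 1
    exact Finset.sum_congr rfl fun e _ => by push_cast; ring
  have hr : ∀ y : E → ℝ, G.treeDet l (fun e => Real.exp (y e)) =
      G.treeDet z fun e => Real.exp (y e) := fun y =>
    G.treeDet_root l z _ (fun e => Real.exp_pos _) hc
  have hs : Real.sqrt (Real.exp f₀) = Real.exp (f₀ / 2) := by rw [Real.exp_half]
  have hT0 : 0 ≤ G.treeDet z (fun e => Real.exp (u e)) :=
    G.treeDet_nonneg _ _ fun e => (Real.exp_pos _).le
  have h0 : 0 ≤ Real.exp (∑ e, a e * u e) ^ 2 * Real.sqrt (G.ev u z) * Real.sqrt (G.ev u l) := by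
    positivity
  have hmain := mul_le_mul_of_nonneg_left (mul_le_mul hPP hT hT0 (le_trans (by positivity) hPP)) h0
  unfold q
  rw [hr u, hr fun e => u e - f e, hxz, hxl, Real.sqrt_mul (Real.exp_pos _).le, hs, sub_eq_add_neg,
    Real.exp_add, Real.exp_neg]
  have h9 : (Real.exp (f₀ / 2))⁻¹ * Real.exp (f₀ / 2) = 1 := inv_mul_cancel₀ (Real.exp_pos _).ne'
  refine le_trans (le_of_eq ?_) (le_trans hmain (le_of_eq ?_))
  · have h10 := Real.mul_self_sqrt hT0
    linear_combination Real.exp (∑ e, a e * u e) ^ 2 * Real.sqrt (G.ev u z) *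
      Real.sqrt (G.ev u l) * (∏ w, G.ev u w ^ (-(G.vsum a w + 1) / 2)) ^ 2 * h10
  · set A := Real.exp (∑ v, (G.vsum a v + 1) * c v ^ 2 / 8)
    set P1 := ∏ w, G.ev (fun e => u e + f e) w ^ (-(G.vsum a w + 1) / 2)
    set P2 := ∏ w, G.ev (fun e => u e - f e) w ^ (-(G.vsum a w + 1) / 2)
    set T1 := Real.sqrt (G.treeDet z fun e => Real.exp (u e + f e))
    set T2 := Real.sqrt (G.treeDet z fun e => Real.exp (u e - f e))
    linear_combination (-1) * A * P1 * P2 * T1 * T2 * Real.sqrt (G.ev u z) *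
      Real.sqrt (G.ev u l) * hE - A * P1 * P2 * T1 * T2 * Real.sqrt (G.ev u z) *
      Real.sqrt (G.ev u l) * Real.exp (∑ e, a e * (u e + f e)) * Real.exp (∑ e, a e * (u e - f e))
        * h9

end Gr

theorem lintegral_sqrt_mul_le {α : Type*} [MeasurableSpace α] (μ : Measure α) (A B : α → ℝ)
    (hA : Measurable A) (hB : Measurable B) (hA0 : ∀ x, 0 ≤ A x) (hB0 : ∀ x, 0 ≤ B x)
    (K : ℝ) (h1 : ∫⁻ x, ENNReal.ofReal (A x) ∂μ = ENNReal.ofReal K)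
    (h2 : ∫⁻ x, ENNReal.ofReal (B x) ∂μ = ENNReal.ofReal K) :
    ∫⁻ x, ENNReal.ofReal (Real.sqrt (A x * B x)) ∂μ ≤ ENNReal.ofReal K := by
  have h := ENNReal.lintegral_mul_le_Lp_mul_Lq μ Real.HolderConjugate.two_two
    (f := fun x => ENNReal.ofReal (Real.sqrt (A x)))
    (g := fun x => ENNReal.ofReal (Real.sqrt (B x)))
    (ENNReal.measurable_ofReal.comp hA.sqrt).aemeasurable
    (ENNReal.measurable_ofReal.comp hB.sqrt).aemeasurable
  have e1 : ∀ y : ℝ, 0 ≤ y → ENNReal.ofReal (Real.sqrt y) ^ (2 : ℝ) = ENNReal.ofReal y := by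
    intro y hy
    rw [ENNReal.ofReal_rpow_of_nonneg (Real.sqrt_nonneg _) (by norm_num)]
    simp [Real.sq_sqrt hy]
  simp only [e1 _ (hA0 _), e1 _ (hB0 _), h1, h2] at h
  rw [← ENNReal.rpow_add_of_nonneg _ _ (by norm_num) (by norm_num)] at h
  norm_num at h
  refine le_trans (le_of_eq (lintegral_congr fun x => ?_)) h
  rw [← ENNReal.ofReal_mul (Real.sqrt_nonneg _), Real.sqrt_mul (hA0 x)]

namespace Gr

variable {V E : Type*} [Fintype V] [DecidableEq V] [Fintype E] (G : Gr V E)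

theorem qs_nonneg (hc : G.Connected) (hV : Nontrivial V) (l v : V) (a u : E → ℝ) :
    0 ≤ G.qs l v a u :=
  mul_nonneg (G.q_nonneg hc hV v a u) (mul_nonneg (G.ev_pos hc hV u l).le (Real.exp_pos _).le)

theorem continuous_qs (hc : G.Connected) (hV : Nontrivial V) (l v : V) (a : E → ℝ) :
    Continuous fun u => G.qs l v a u := by
  have := G.continuous_q hc hV v a
  unfold qs
  fun_prop

theorem lintegral_hellinger (hc : G.Connected) (hV : Nontrivial V) (z l : V) (a f : E → ℝ)
    (m c : V → ℝ) (ha : ∀ e, 0 < a e) (hzl : G.vsum a z = G.vsum a l)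
    (f₀ : ℝ) (hz : ∀ e, G.s e = z ∨ G.t e = z → f e = f₀)
    (hl : ∀ e, G.s e = l ∨ G.t e = l → f e = 0)
    (hf : ∀ e v, G.s e = v ∨ G.t e = v → m v ≤ f e ∧ f e ≤ m v + c v) :
    ∫⁻ u : E → ℝ, ENNReal.ofReal (G.qs l z a u * (G.ev u l / G.ev u z) ^ (1 / 4 : ℝ)) ≤
      ENNReal.ofReal (Real.exp (∑ v, (G.vsum a v + 1) * c v ^ 2 / 16 - f₀ / 4) *
        G.qmass z a) := by
  have hx := G.ev_pos hc hV
  have hJ := (G.qmass_pos hc hV z a ha).le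
  set C := Real.exp (∑ v, (G.vsum a v + 1) * c v ^ 2 / 16 - f₀ / 4) with hC
  have hC0 : 0 ≤ C := (Real.exp_pos _).le
  set A : (E → ℝ) → ℝ := fun u => G.qs l z a fun e => u e + f e with hA
  set B : (E → ℝ) → ℝ := fun u => G.qs l l a fun e => u e - f e with hB
  have hw : ∀ v e, (if G.s e = v then (1 : ℝ) else 0) + (if G.t e = v then 1 else 0) ≠ 0 →
      G.s e = v ∨ G.t e = v := by
    intro v e h
    by_contra h'
    push Not at h'
    simp [h'.1, h'.2] at h
  have hxl : ∀ u y : E → ℝ, (∀ e, G.s e = l ∨ G.t e = l → y e = 0) →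
      G.ev (fun e => u e + y e) l = G.ev u l := by
    intro u y hy
    simp only [ev, vsum]
    refine Finset.sum_congr rfl fun e _ => ?_
    by_cases h : (if G.s e = l then (1 : ℝ) else 0) + (if G.t e = l then 1 else 0) = 0
    · rw [h]; simp
    · rw [hy e (hw l e h), add_zero]
  have hAi : ∫⁻ u, ENNReal.ofReal (A u) = ENNReal.ofReal (G.qmass z a) := by
    rw [← G.lintegral_qs hc hV l z a ha]
    exact lintegral_add_right_eq_self (μ := (volume : Measure (E → ℝ)))
      (fun u => ENNReal.ofReal (G.qs l z a u)) f
  have hBi : ∫⁻ u, ENNReal.ofReal (B u) = ENNReal.ofReal (G.qmass z a) := by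
    rw [G.qmass_eq hc hV z l a ha hzl, ← G.lintegral_qs hc hV l l a ha]
    exact lintegral_sub_right_eq_self (μ := (volume : Measure (E → ℝ)))
      (fun u => ENNReal.ofReal (G.qs l l a u)) f
  have hAm : Measurable A := ((G.continuous_qs hc hV l z a).comp (by fun_prop)).measurable
  have hBm : Measurable B := ((G.continuous_qs hc hV l l a).comp (by fun_prop)).measurable
  have hA0 : ∀ u, 0 ≤ A u := fun u => G.qs_nonneg hc hV l z a _
  have hB0 : ∀ u, 0 ≤ B u := fun u => G.qs_nonneg hc hV l l a _
  have key := lintegral_sqrt_mul_le volume A B hAm hBm hA0 hB0 _ hAi hBi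
  rw [ENNReal.ofReal_mul hC0]
  refine le_trans ?_ (mul_le_mul_right key (ENNReal.ofReal C))
  rw [← lintegral_const_mul' _ _ ENNReal.ofReal_ne_top]
  refine lintegral_mono fun u => ?_
  rw [← ENNReal.ofReal_mul hC0]
  refine ENNReal.ofReal_le_ofReal ?_
  refine le_of_sq_le_sq ?_ (by positivity)
  rw [mul_pow, mul_pow, Real.sq_sqrt (mul_nonneg (hA0 u) (hB0 u)), ← Real.rpow_natCast (_ ^ _),
    ← Real.rpow_mul (div_pos (hx _ _) (hx _ _)).le]
  have e1 : (G.ev u l / G.ev u z) ^ (1 / 4 * ((2 : ℕ) : ℝ)) = Real.sqrt (G.ev u l / G.ev u z) := by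
    rw [Real.sqrt_eq_rpow]; norm_num
  have e2 : C ^ 2 = Real.exp (∑ v, (G.vsum a v + 1) * c v ^ 2 / 8 - f₀ / 2) := by
    rw [hC, ← Real.exp_nat_mul]
    congr 1
    push_cast
    rw [mul_sub, Finset.mul_sum]
    congr 1
    · exact Finset.sum_congr rfl fun v _ => by ring
    · ring
  have h1 := G.q_mul_le hc hV z l a u f m c ha f₀ hz hl hf
  rw [G.q_root hc hV z l a u] at h1
  have e3 : G.ev (fun e => u e + f e) l = G.ev u l := hxl u f hl
  have e4 : G.ev (fun e => u e - f e) l = G.ev u l := by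
    simp only [sub_eq_add_neg]
    exact hxl u (fun e => -f e) fun e he => by rw [hl e he, neg_zero]
  rw [e1, e2]
  simp only [hA, hB, qs, e3, e4]
  have h2 := mul_le_mul_of_nonneg_right h1 (sq_nonneg (G.ev u l * Real.exp (-G.ev u l)))
  refine le_trans (le_of_eq ?_) (le_trans h2 (le_of_eq ?_)) <;> ring

end Gr

namespace Gr

variable {V E : Type*} [Fintype V] [DecidableEq V] [Fintype E] (G : Gr V E)

theorem q_step [DecidableEq E] (hc : G.Connected) (hV : Nontrivial V) (a u : E → ℝ) (e : E)
    (v w : V) (h : G.Joins e v w) :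
    G.q w (fun k => a k + if k = e then 1 else 0) u =
      G.q v a u * (Real.exp (u e) / G.ev u v) := by
  have hx := G.ev_pos hc hV u
  rw [G.q_root hc hV v w]
  unfold q
  have e1 : ∑ k, (a k + if k = e then 1 else 0) * u k = ∑ k, a k * u k + u e := by
    simp [add_mul, Finset.sum_add_distrib]
  have e2 : ∏ i, G.ev u i ^ (-(G.vsum (fun k => a k + if k = e then 1 else 0) i + 1) / 2) =
      (∏ i, G.ev u i ^ (-(G.vsum a i + 1) / 2)) *
        ((Real.sqrt (G.ev u v))⁻¹ * (Real.sqrt (G.ev u w))⁻¹) := by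
    have h1 : ∀ j i, G.ev u i ^ (-(if i = j then (1 : ℝ) else 0) / 2) =
        if i = j then (Real.sqrt (G.ev u j))⁻¹ else 1 := by
      intro j i
      split_ifs with hij
      · rw [hij, Real.sqrt_eq_rpow, ← Real.rpow_neg (hx j).le]; norm_num
      · simp
    have h2 : ∀ j, ∏ i, G.ev u i ^ (-(if i = j then (1 : ℝ) else 0) / 2) =
        (Real.sqrt (G.ev u j))⁻¹ := by
      intro j
      simp [h1]
    rw [← h2 v, ← h2 w, ← Finset.prod_mul_distrib, ← Finset.prod_mul_distrib]
    refine Finset.prod_congr rfl fun i _ => ?_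
    rw [G.vsum_update a e v w i h, ← Real.rpow_add (hx i), ← Real.rpow_add (hx i)]
    ring_nf
  rw [e1, e2, Real.exp_add, Real.sqrt_div (hx w).le]
  have h3 := Real.sqrt_pos.2 (hx v)
  have h4 := Real.sqrt_pos.2 (hx w)
  have h5 := hx v
  have h6 := Real.sq_sqrt (hx v).le
  field_simp
  rw [h6]
  ring

/-- Edge weights reinforced by the first `n` steps of the edge sequence `e`. -/
noncomputable def addCount (a : E → ℝ) (e : ℕ → E) (n : ℕ) (k : E) : ℝ :=
  a k + (((Finset.range n).filter fun s => e s = k).card : ℝ)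

theorem addCount_pos (a : E → ℝ) (ha : ∀ k, 0 < a k) (e : ℕ → E) (n : ℕ) (k : E) :
    0 < addCount a e n k :=
  add_pos_of_pos_of_nonneg (ha k) (Nat.cast_nonneg _)

theorem addCount_succ (a : E → ℝ) (e : ℕ → E) (n : ℕ) :
    addCount a e (n + 1) = fun k => addCount a e n k + if k = e n then 1 else 0 := by
  ext k
  simp only [addCount, Finset.range_add_one, Finset.filter_insert, eq_comm (a := k)]
  split_ifs with h
  · rw [Finset.card_insert_of_notMem (by simp)]
    push_cast
    ring
  · ring

theorem lintegral_path (hc : G.Connected) (hV : Nontrivial V) (l : V) (a : E → ℝ)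
    (ha : ∀ e, 0 < a e) (v : ℕ → V) (e : ℕ → E) (n : ℕ)
    (hj : ∀ t < n, G.Joins (e t) (v t) (v (t + 1))) :
    ENNReal.ofReal ((∏ t ∈ Finset.range n, addCount a e t (e t) / G.vsum (addCount a e t) (v t)) *
      G.qmass (v 0) a) =
    ∫⁻ u : E → ℝ, ENNReal.ofReal (G.qs l (v 0) a u *
      ∏ t ∈ Finset.range n, Real.exp (u (e t)) / G.ev u (v t)) := by
  have h0 : addCount a e 0 = a := by ext; simp [addCount]
  have h1 : G.qmass (v n) (addCount a e n) =
      (∏ t ∈ Finset.range n, addCount a e t (e t) / G.vsum (addCount a e t) (v t)) *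
      G.qmass (v 0) a := by
    induction n with
    | zero => simp [h0]
    | succ n ih =>
      rw [addCount_succ, G.qmass_step hc hV _ (addCount_pos a ha e n) (e n) (v n) (v (n + 1))
        (hj n n.lt_succ_self), ih fun t ht => hj t (ht.trans n.lt_succ_self),
        Finset.prod_range_succ]
      ring
  have h2 : ∀ u, G.q (v n) (addCount a e n) u =
      G.q (v 0) a u * ∏ t ∈ Finset.range n, Real.exp (u (e t)) / G.ev u (v t) := by
    intro u
    clear h1
    induction n with
    | zero => simp [h0]
    | succ n ih =>
      rw [addCount_succ, G.q_step hc hV _ u (e n) (v n) (v (n + 1))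
        (hj n n.lt_succ_self), ih fun t ht => hj t (ht.trans n.lt_succ_self),
        Finset.prod_range_succ]
      ring
  rw [← h1, ← G.lintegral_qs hc hV l _ _ (addCount_pos a ha e n)]
  refine lintegral_congr fun u => ?_
  rw [qs, h2, qs]
  ring_nf

/-- Probability that the Markov chain with conductances `x` visits `l` within `k` steps without
visiting `z` before. -/
noncomputable def hitProb (x : E → ℝ) (z l : V) : ℕ → V → ℝ
  | 0, v => if v = l then 1 else 0
  | k + 1, v => if v = l then 1 else if v = z then 0 else
      ∑ w, G.wmat x v w / G.vsum x v * hitProb x z l k w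

/-- One step of the Markov chain followed by `hitProb`. -/
noncomputable def escProb (x : E → ℝ) (z l : V) (k : ℕ) (v : V) : ℝ :=
  ∑ w, G.wmat x v w / G.vsum x v * G.hitProb x z l k w

theorem sum_wmat_div (x : E → ℝ) (hp : ∀ v, 0 < G.vsum x v) (v : V) :
    ∑ w, G.wmat x v w / G.vsum x v = 1 := by
  rw [← Finset.sum_div, ← G.vsum_eq_sum_wmat]
  exact div_self (hp v).ne'

theorem hitProb_mem (x : E → ℝ) (hx : ∀ e, 0 ≤ x e) (hp : ∀ v, 0 < G.vsum x v) (z l : V) (k : ℕ) :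
    ∀ v, 0 ≤ G.hitProb x z l k v ∧ G.hitProb x z l k v ≤ G.hitProb x z l (k + 1) v ∧
      G.hitProb x z l k v ≤ 1 := by
  have hw := fun v w => div_nonneg (G.wmat_nonneg x hx v w) (hp v).le
  induction k with
  | zero =>
    intro v
    simp only [hitProb]
    split_ifs <;> norm_num
    exact hw v l
  | succ k ih =>
    intro v
    rw [hitProb.eq_def _ _ _ _ (k + 1 + 1)]
    simp only
    rw [hitProb]
    split_ifs
    · norm_num
    · norm_num
    · refine ⟨Finset.sum_nonneg fun w _ => mul_nonneg (hw v w) (ih w).1,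
        Finset.sum_le_sum fun w _ => mul_le_mul_of_nonneg_left (ih w).2.1 (hw v w), ?_⟩
      rw [← G.sum_wmat_div x hp v]
      exact Finset.sum_le_sum fun w _ => mul_le_of_le_one_right (hw v w) (ih w).2.2

theorem escProb_nonneg (x : E → ℝ) (hx : ∀ e, 0 ≤ x e) (hp : ∀ v, 0 < G.vsum x v) (z l : V)
    (k : ℕ) (v : V) : 0 ≤ G.escProb x z l k v :=
  Finset.sum_nonneg fun w _ => mul_nonneg (div_nonneg (G.wmat_nonneg x hx v w) (hp v).le)
    (G.hitProb_mem x hx hp z l k w).1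

theorem escProb_le_one (x : E → ℝ) (hx : ∀ e, 0 ≤ x e) (hp : ∀ v, 0 < G.vsum x v) (z l : V)
    (k : ℕ) (v : V) : G.escProb x z l k v ≤ 1 := by
  rw [← G.sum_wmat_div x hp v]
  exact Finset.sum_le_sum fun w _ => mul_le_of_le_one_right
    (div_nonneg (G.wmat_nonneg x hx v w) (hp v).le) (G.hitProb_mem x hx hp z l k w).2.2

theorem escProb_le_div (x : E → ℝ) (hx : ∀ e, 0 ≤ x e) (hp : ∀ v, 0 < G.vsum x v) (z l : V)
    (hzl : z ≠ l) (k : ℕ) : G.escProb x z l k z ≤ G.vsum x l / G.vsum x z := by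
  rw [le_div_iff₀ (hp z)]
  have h1 : ∑ v, G.escProb x z l k v * G.vsum x v = ∑ w, G.hitProb x z l k w * G.vsum x w := by
    have : ∀ v, G.escProb x z l k v * G.vsum x v = ∑ w, G.wmat x v w * G.hitProb x z l k w := by
      intro v
      rw [escProb, Finset.sum_mul]
      refine Finset.sum_congr rfl fun w _ => ?_
      have := (hp v).ne'
      field_simp
    simp only [this]
    rw [Finset.sum_comm]
    refine Finset.sum_congr rfl fun w _ => ?_
    rw [← Finset.sum_mul, G.vsum_eq_sum_wmat x w, mul_comm]
    simp only [G.wmat_comm x w]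
  have hl : l ∈ Finset.univ.erase z := Finset.mem_erase.2 ⟨hzl.symm, Finset.mem_univ _⟩
  have hz0 : G.hitProb x z l k z = 0 := by
    cases k <;> simp [hitProb, hzl]
  have hl1 : G.hitProb x z l k l = 1 := by
    cases k <;> simp [hitProb]
  rw [← Finset.add_sum_erase _ _ (Finset.mem_univ z), ← Finset.add_sum_erase _ _ hl,
    ← Finset.add_sum_erase _ (fun w => G.hitProb x z l k w * G.vsum x w) (Finset.mem_univ z),
    ← Finset.add_sum_erase _ (fun w => G.hitProb x z l k w * G.vsum x w) hl, hz0, hl1] at h1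
  have h2 : ∑ w ∈ (Finset.univ.erase z).erase l, G.hitProb x z l k w * G.vsum x w ≤
      ∑ w ∈ (Finset.univ.erase z).erase l, G.escProb x z l k w * G.vsum x w := by
    refine Finset.sum_le_sum fun w hw => mul_le_mul_of_nonneg_right ?_ (hp w).le
    refine (G.hitProb_mem x hx hp z l k w).2.1.trans (le_of_eq ?_)
    rw [hitProb, if_neg (Finset.ne_of_mem_erase hw),
      if_neg (Finset.ne_of_mem_erase (Finset.mem_of_mem_erase hw)), escProb]
  have h3 := mul_nonneg (G.escProb_nonneg x hx hp z l k l) (hp l).le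
  linarith

theorem escProb_le_rpow (hc : G.Connected) (hV : Nontrivial V) (u : E → ℝ) (z l : V)
    (hzl : z ≠ l) (k : ℕ) :
    G.escProb (fun e => Real.exp (u e)) z l k z ≤ (G.ev u l / G.ev u z) ^ (1 / 4 : ℝ) := by
  have hp : ∀ v, 0 < G.vsum (fun e => Real.exp (u e)) v := G.ev_pos hc hV u
  have hx : ∀ e, 0 ≤ Real.exp (u e) := fun e => (Real.exp_pos _).le
  have h1 := G.escProb_le_one _ hx hp z l k z
  have h2 := G.escProb_le_div _ hx hp z l hzl k
  have h3 : 0 < G.ev u l / G.ev u z := div_pos (hp l) (hp z)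
  rcases le_total (G.ev u l / G.ev u z) 1 with h | h
  · refine h2.trans ?_
    have := Real.rpow_le_rpow_of_exponent_ge h3 h (by norm_num : (1 / 4 : ℝ) ≤ 1)
    rwa [Real.rpow_one] at this
  · exact h1.trans (Real.one_le_rpow h (by norm_num))

end Gr

namespace Gr

variable {V E : Type*} [Fintype V] [DecidableEq V] [Fintype E] (G : Gr V E)

theorem wmat_of_not_joins (x : E → ℝ) (v w : V) (h : ∀ e, ¬ G.Joins e v w) : G.wmat x v w = 0 := by
  unfold wmat
  refine Finset.sum_eq_zero fun e _ => ?_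
  have := h e
  simp only [Joins, not_or, not_and] at this
  split_ifs <;> simp_all

theorem wmat_of_joins (x : E → ℝ) (e : E) (v w : V) (h : G.Joins e v w)
    (hs : ∀ e', G.Joins e' v w → e' = e) : G.wmat x v w = x e := by
  unfold wmat
  rw [Finset.sum_eq_single e]
  · have := G.ne e
    rcases h with ⟨rfl, rfl⟩ | ⟨rfl, rfl⟩
    · simp [this]
    · simp [this.symm, this]
  · intro e' _ he'
    have : ¬ G.Joins e' v w := fun h' => he' (hs e' h')
    simp only [Joins, not_or, not_and] at this
    split_ifs <;> simp_all
  · simp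

end Gr

/-- The vertices of `G_r` in a box. -/
noncomputable def box (r M : ℕ) : Finset (ℤ × ℤ) :=
  ((Finset.Icc (-(M : ℤ)) M) ×ˢ (Finset.Icc (-(M : ℤ)) M)).filter (· ∈ Vr r)

theorem linf_le_iff (p : ℤ × ℤ) (M : ℤ) : linf p ≤ M ↔ (-M ≤ p.1 ∧ p.1 ≤ M) ∧ -M ≤ p.2 ∧ p.2 ≤ M := by
  unfold linf
  rw [max_le_iff, abs_le, abs_le]

theorem mem_box (r M : ℕ) (p : ℤ × ℤ) : p ∈ box r M ↔ linf p ≤ M ∧ p ∈ Vr r := by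
  rw [linf_le_iff]
  simp [box]

/-- The subgraph of `G_r` in a box. -/
noncomputable def boxGr (r M : ℕ) : Gr {p // p ∈ box r M}
    {e : {p // p ∈ box r M} × {p // p ∈ box r M} //
      e.2.1 = e.1.1 + (1, 0) ∨ e.2.1 = e.1.1 + (0, 1)} where
  s e := e.1.1
  t e := e.1.2
  ne e h := by
    have h1 := e.2
    rw [← h] at h1
    rcases h1 with h1 | h1 <;> simp at h1

theorem adjG_symm {r : ℕ} {u v : ℤ × ℤ} (h : AdjG r u v) : AdjG r v u :=
  ⟨h.2.1, h.1, by have := h.2.2; linarith [sq_nonneg (u.1 - v.1)]⟩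

theorem eq_add_of_sq_add_sq {u v : ℤ × ℤ} (h : (u.1 - v.1) ^ 2 + (u.2 - v.2) ^ 2 = 1) :
    v = u + (1, 0) ∨ v = u + (-1, 0) ∨ v = u + (0, 1) ∨ v = u + (0, -1) := by
  have h1 : u.1 - v.1 ≤ 1 := by nlinarith [sq_nonneg (u.2 - v.2)]
  have h2 : -1 ≤ u.1 - v.1 := by nlinarith [sq_nonneg (u.2 - v.2)]
  have h3 : u.2 - v.2 ≤ 1 := by nlinarith [sq_nonneg (u.1 - v.1)]
  have h4 : -1 ≤ u.2 - v.2 := by nlinarith [sq_nonneg (u.1 - v.1)]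
  simp only [Prod.ext_iff, Prod.fst_add, Prod.snd_add]
  obtain ⟨p, hp⟩ : ∃ p, p = u.1 - v.1 := ⟨_, rfl⟩
  obtain ⟨q, hq⟩ : ∃ q, q = u.2 - v.2 := ⟨_, rfl⟩
  rw [← hp, ← hq] at h
  rw [← hp] at h1 h2
  rw [← hq] at h3 h4
  interval_cases p <;> interval_cases q <;> omega

theorem exists_joins_iff (r M : ℕ) (v w : {p // p ∈ box r M}) :
    (∃ e, (boxGr r M).Joins e v w) ↔ AdjG r v w := by
  constructor
  · rintro ⟨e, h | h⟩
    · obtain ⟨rfl, rfl⟩ := h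
      refine ⟨((mem_box r M _).1 e.1.1.2).2, ((mem_box r M _).1 e.1.2.2).2, ?_⟩
      have := e.2
      simp only [boxGr]
      rcases this with h | h <;> rw [h] <;> simp
    · obtain ⟨rfl, rfl⟩ := h
      refine ⟨((mem_box r M _).1 e.1.2.2).2, ((mem_box r M _).1 e.1.1.2).2, ?_⟩
      have := e.2
      simp only [boxGr]
      rcases this with h | h <;> rw [h] <;> simp
  · intro h
    rcases eq_add_of_sq_add_sq h.2.2 with h | h | h | h
    · exact ⟨⟨(v, w), Or.inl h⟩, Or.inl ⟨rfl, rfl⟩⟩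
    · exact ⟨⟨(w, v), Or.inl (by rw [h]; ext <;> simp)⟩, Or.inr ⟨rfl, rfl⟩⟩
    · exact ⟨⟨(v, w), Or.inr h⟩, Or.inl ⟨rfl, rfl⟩⟩
    · exact ⟨⟨(w, v), Or.inr (by rw [h]; ext <;> simp)⟩, Or.inr ⟨rfl, rfl⟩⟩

theorem joins_unique (r M : ℕ) (v w : {p // p ∈ box r M}) (e e' : _)
    (h : (boxGr r M).Joins e v w) (h' : (boxGr r M).Joins e' v w) : e = e' := by
  obtain ⟨⟨p, q⟩, he⟩ := e
  obtain ⟨⟨p', q'⟩, he'⟩ := e'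
  simp only [Gr.Joins, boxGr] at h h'
  have hne : ∀ p q : {p // p ∈ box r M}, (q.1 = p.1 + (1, 0) ∨ q.1 = p.1 + (0, 1)) →
      ¬ (p.1 = q.1 + (1, 0) ∨ p.1 = q.1 + (0, 1)) := by
    intro p q h h'
    rcases h with h | h <;> rcases h' with h' | h' <;> rw [h] at h' <;>
      simp [Prod.ext_iff] at h' <;> omega
  rcases h with ⟨rfl, rfl⟩ | ⟨rfl, rfl⟩ <;> rcases h' with ⟨rfl, rfl⟩ | ⟨rfl, rfl⟩
  · rfl
  · exact absurd he' (hne _ _ he)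
  · exact absurd he' (hne _ _ he)
  · rfl

theorem wt_eq_addCount (r M : ℕ) (a : ℝ) (v : ℕ → {p // p ∈ box r M}) (e : ℕ → _) (n : ℕ)
    (hj : ∀ t < n, (boxGr r M).Joins (e t) (v t) (v (t + 1))) (p q : {p // p ∈ box r M}) (k : _)
    (hk : (boxGr r M).Joins k p q) :
    wt a (fun t => (v t).1) n p q = Gr.addCount (fun _ => a) e n k := by
  unfold wt Gr.addCount
  refine congrArg (a + ·) (congrArg _ (congrArg Finset.card ?_))
  ext s
  simp only [Finset.mem_filter, Finset.mem_range]
  refine and_congr_right fun hs => ?_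
  have hs' := hj s hs
  simp only [← Subtype.ext_iff]
  constructor
  · rintro (⟨h1, h2⟩ | ⟨h1, h2⟩)
    · rw [h1, h2] at hs'
      exact joins_unique r M p q _ _ hs' hk
    · rw [h1, h2] at hs'
      exact joins_unique r M p q _ _ (Or.symm hs') hk
  · rintro rfl
    rcases hs' with ⟨h1, h2⟩ | ⟨h1, h2⟩ <;> rcases hk with ⟨h3, h4⟩ | ⟨h3, h4⟩ <;>
      simp only [← h1, ← h2, ← h3, ← h4] <;> simp

theorem totWt_eq_vsum (r M : ℕ) (a : ℝ) (v : ℕ → {p // p ∈ box r M}) (e : ℕ → _) (n : ℕ)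
    (hj : ∀ t < n, (boxGr r M).Joins (e t) (v t) (v (t + 1))) (hn : linf (v n).1 < M) :
    totWt r a (fun t => (v t).1) n = (boxGr r M).vsum (Gr.addCount (fun _ => a) e n) (v n) := by
  rw [Gr.vsum_eq_sum_wmat]
  set F : ℤ × ℤ → ℝ := fun w => if AdjG r (v n) w then wt a (fun t => (v t).1) n (v n) w else 0
    with hF
  have h1 : ∀ w, (boxGr r M).wmat (Gr.addCount (fun _ => a) e n) (v n) w = F w := by
    intro w
    by_cases h : AdjG r (v n) w
    · obtain ⟨k, hk⟩ := (exists_joins_iff r M (v n) w).2 h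
      rw [Gr.wmat_of_joins _ _ k _ _ hk fun e' he' => joins_unique r M _ _ _ _ he' hk]
      simp only [hF, if_pos h, wt_eq_addCount r M a v e n hj _ _ k hk]
    · rw [Gr.wmat_of_not_joins _ _ _ _ fun k hk => h ((exists_joins_iff r M _ _).1 ⟨k, hk⟩)]
      simp only [hF, if_neg h]
  simp only [h1]
  rw [Finset.sum_coe_sort (box r M) F]
  have h2 : totWt r a (fun t => (v t).1) n = ∑ w ∈ (({(1, 0), (-1, 0), (0, 1), (0, -1)} :
      Finset (ℤ × ℤ)).image fun d => (v n).1 + d), F w := by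
    rw [Finset.sum_image fun _ _ _ _ h => add_left_cancel h]
    rfl
  rw [h2]
  refine Finset.sum_congr_of_eq_on_inter ?_ ?_ fun _ _ _ => rfl
  · intro w _ hw
    simp only [hF]
    refine if_neg fun h => hw ?_
    rw [mem_box]
    refine ⟨?_, h.2.1⟩
    have hn' : linf (v n).1 ≤ M - 1 := by omega
    rw [linf_le_iff] at hn' ⊢
    rcases eq_add_of_sq_add_sq h.2.2 with h | h | h | h <;> rw [h] <;> simp <;> omega
  · intro w _ hw
    simp only [hF]
    refine if_neg fun h => hw ?_
    rcases eq_add_of_sq_add_sq h.2.2 with h | h | h | h <;> rw [h] <;> simp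

theorem linf_le_add_one {r : ℕ} {p q : ℤ × ℤ} (h : AdjG r p q) : linf q ≤ linf p + 1 := by
  have h1 := (linf_le_iff p (linf p)).1 le_rfl
  rw [linf_le_iff]
  rcases eq_add_of_sq_add_sq h.2.2 with h | h | h | h <;> rw [h] <;> simp <;> omega

theorem sum_lintegral_le {α ι : Type*} [MeasurableSpace α] (μ : Measure α) (s : Finset ι)
    (f : ι → α → ℝ≥0∞) : ∑ i ∈ s, ∫⁻ x, f i x ∂μ ≤ ∫⁻ x, ∑ i ∈ s, f i x ∂μ := by
  induction s using Finset.induction_on with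
  | empty => simp
  | insert i s hi ih =>
    simp only [Finset.sum_insert hi]
    exact (add_le_add_right ih _).trans (le_lintegral_add _ _)

/-- The trajectories visiting `ℓ` at a time in `(n, n + k]` without visiting the origin in between. -/
def Hit (ℓ : ℤ × ℤ) (n k : ℕ) : Set (ℕ → ℤ × ℤ) :=
  {X | ∃ j, n < j ∧ j ≤ n + k ∧ X j = ℓ ∧ ∀ i, n < i → i ≤ j → X i ≠ (0, 0)}

theorem measure_cylinder (r M : ℕ) (a : ℝ) (ha : 0 < a) (hc : (boxGr r M).Connected)
    (hV : Nontrivial {p // p ∈ box r M}) (P : Measure (ℕ → ℤ × ℤ)) (hP : IsERRW r a P)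
    (l : {p // p ∈ box r M}) (v : ℕ → {p // p ∈ box r M}) (e : ℕ → _) (n : ℕ)
    (hv0 : (v 0).1 = (0, 0)) (hj : ∀ t < n, (boxGr r M).Joins (e t) (v t) (v (t + 1)))
    (hinterior : ∀ t < n, linf (v t).1 < M) :
    P {X | ∀ t ≤ n, X t = (v t).1} * ENNReal.ofReal ((boxGr r M).qmass (v 0) fun _ => a) =
    ∫⁻ u, ENNReal.ofReal ((boxGr r M).qs l (v 0) (fun _ => a) u *
      ∏ t ∈ Finset.range n, Real.exp (u (e t)) / (boxGr r M).ev u (v t)) := by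
  rw [hP.2 n fun t => (v t).1, if_pos ⟨hv0, fun t ht =>
    (exists_joins_iff r M (v t) (v (t + 1))).1 ⟨e t, hj t ht⟩⟩,
    ← (boxGr r M).lintegral_path hc hV l (fun _ => a) (fun _ => ha) v e n hj,
    ← ENNReal.ofReal_mul' ((boxGr r M).qmass_pos hc hV (v 0) _ fun _ => ha).le]
  congr 2
  refine Finset.prod_congr rfl fun t ht => ?_
  have ht' := Finset.mem_range.1 ht
  have hj' : ∀ s < t, (boxGr r M).Joins (e s) (v s) (v (s + 1)) := fun s hs => hj s (hs.trans ht')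
  rw [totWt_eq_vsum r M a v e t hj' (hinterior t ht'),
    wt_eq_addCount r M a v e t hj' (v t) (v (t + 1)) (e t) (hj t ht')]

theorem measure_hit_le (r M : ℕ) (a : ℝ) (ha : 0 < a) (hc : (boxGr r M).Connected)
    (hV : Nontrivial {p // p ∈ box r M}) (P : Measure (ℕ → ℤ × ℤ)) (hP : IsERRW r a P)
    (z l : {p // p ∈ box r M}) (hz : z.1 = (0, 0)) (k : ℕ) :
    ∀ (n : ℕ) (v : ℕ → {p // p ∈ box r M}) (e : ℕ → _), v 0 = z →
    (∀ t < n, (boxGr r M).Joins (e t) (v t) (v (t + 1))) → (∀ t ≤ n, linf (v t).1 ≤ t) →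
    n + k < M →
    P ({X | ∀ t ≤ n, X t = (v t).1} ∩ Hit l.1 n (k + 1)) *
      ENNReal.ofReal ((boxGr r M).qmass z fun _ => a) ≤
    ∫⁻ u, ENNReal.ofReal ((boxGr r M).qs l z (fun _ => a) u *
      (∏ t ∈ Finset.range n, Real.exp (u (e t)) / (boxGr r M).ev u (v t)) *
      (boxGr r M).escProb (fun k => Real.exp (u k)) z l k (v n)) := by
  induction k using Nat.strong_induction_on with
  | _ k ih =>
  intro n v e hv0 hj hl hM
  set G := boxGr r M with hG
  have hx := G.ev_pos hc hV
  set J := ENNReal.ofReal (G.qmass z fun _ => a) with hJ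
  set A : ℤ × ℤ → Set (ℕ → ℤ × ℤ) := fun w =>
    {X | ∀ t ≤ n, X t = (v t).1} ∩ Hit l.1 n (k + 1) ∩ {X | X (n + 1) = w} with hA
  set Q : (_ → ℝ) → ℝ := fun u => G.qs l z (fun _ => a) u *
      (∏ t ∈ Finset.range n, Real.exp (u (e t)) / G.ev u (v t)) with hQ
  have hQ0 : ∀ u, 0 ≤ Q u := fun u => mul_nonneg (G.qs_nonneg hc hV l z _ u)
    (Finset.prod_nonneg fun t _ => div_nonneg (Real.exp_pos _).le (hx u _).le)
  have hT0 : ∀ (u : _ → ℝ) (w : {p // p ∈ box r M}), 0 ≤ G.wmat (fun k => Real.exp (u k)) (v n) w /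
      G.vsum (fun k => Real.exp (u k)) (v n) * G.hitProb (fun k => Real.exp (u k)) z l k w :=
    fun u w => mul_nonneg (div_nonneg (G.wmat_nonneg _ (fun _ => (Real.exp_pos _).le) _ _)
      (hx u _).le) (G.hitProb_mem _ (fun _ => (Real.exp_pos _).le) (hx u) z l k w).1
  -- transitions to non-neighbours are null
  have hzero : ∀ w : ℤ × ℤ, ¬ AdjG r (v n) w → P (A w) = 0 := by
    intro w hw
    have h1 := hP.2 (n + 1) fun t => if t ≤ n then (v t).1 else w
    rw [if_neg] at h1
    · refine measure_mono_null ?_ h1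
      rintro X ⟨⟨hX, -⟩, hX'⟩ t ht
      by_cases htn : t ≤ n
      · simp only [if_pos htn, hX t htn]
      · obtain rfl : t = n + 1 := by omega
        simpa using hX'
    · rintro ⟨-, h2⟩
      have := h2 n n.lt_succ_self
      simp only [le_refl, if_true, if_neg (by omega : ¬ n + 1 ≤ n)] at this
      exact hw this
  have hstep : ∀ w : {p // p ∈ box r M}, P (A w) * J ≤ ∫⁻ u, ENNReal.ofReal (Q u *
      (G.wmat (fun k => Real.exp (u k)) (v n) w / G.vsum (fun k => Real.exp (u k)) (v n) *
        G.hitProb (fun k => Real.exp (u k)) z l k w)) := by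
    intro w
    by_cases hadj : AdjG r (v n) w
    swap
    · rw [hzero w hadj]; simp
    by_cases hwz : w = z
    · have : A w = ∅ := by
        refine Set.eq_empty_iff_forall_notMem.2 ?_
        rintro X ⟨⟨-, j, hj1, -, -, hj2⟩, hX⟩
        exact hj2 (n + 1) (by omega) (by omega) (by rw [hX, hwz, hz])
      rw [this]; simp
    obtain ⟨e₀, he₀⟩ := (exists_joins_iff r M (v n) w).2 hadj
    set v' : ℕ → {p // p ∈ box r M} := fun t => if t ≤ n then v t else w with hv'
    set e' := fun t => if t < n then e t else e₀ with he'
    have hv'1 : ∀ t ≤ n, v' t = v t := fun t ht => if_pos ht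
    have hv'2 : v' (n + 1) = w := if_neg (by omega)
    have he'1 : ∀ t < n, e' t = e t := fun t ht => if_pos ht
    have he'2 : e' n = e₀ := if_neg (lt_irrefl n)
    have hv'0 : v' 0 = z := by rw [hv'1 0 n.zero_le, hv0]
    have hj' : ∀ t < n + 1, G.Joins (e' t) (v' t) (v' (t + 1)) := by
      intro t ht
      rcases Nat.lt_succ_iff_lt_or_eq.1 ht with h | rfl
      · rw [he'1 t h, hv'1 t h.le, hv'1 (t + 1) h]
        exact hj t h
      · rw [he'2, hv'1 _ le_rfl, hv'2]
        exact he₀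
    have hl' : ∀ t ≤ n + 1, linf (v' t).1 ≤ t := by
      intro t ht
      rcases Nat.le_succ_iff.1 ht with h | rfl
      · rw [hv'1 t h]; exact hl t h
      · rw [Nat.succ_eq_add_one, hv'2]
        have := linf_le_add_one hadj
        have := hl n le_rfl
        push_cast
        omega
    have hQ' : ∀ u, Q u * (G.wmat (fun k => Real.exp (u k)) (v n) w /
        G.vsum (fun k => Real.exp (u k)) (v n)) = G.qs l z (fun _ => a) u *
        ∏ t ∈ Finset.range (n + 1), Real.exp (u (e' t)) / G.ev u (v' t) := by
      intro u
      rw [Finset.prod_range_succ, he'2, hv'1 n le_rfl, G.wmat_of_joins _ e₀ _ _ he₀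
        fun k hk => joins_unique r M _ _ _ _ hk he₀]
      simp only [hQ, mul_assoc, Gr.ev]
      congr 2
      refine Finset.prod_congr rfl fun t ht => ?_
      rw [he'1 t (Finset.mem_range.1 ht), hv'1 t (Finset.mem_range.1 ht).le]
    have hAw : A w ⊆ {X | ∀ t ≤ n + 1, X t = (v' t).1} := by
      rintro X ⟨⟨hX, -⟩, hX'⟩ t ht
      rcases Nat.le_succ_iff.1 ht with h | rfl
      · rw [hv'1 t h, hX t h]
      · rw [Nat.succ_eq_add_one, hv'2]
        exact hX'
    simp only [← mul_assoc, hQ']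
    by_cases hwl : w = l
    · have h1 : ∀ u : _ → ℝ, G.hitProb (fun k => Real.exp (u k)) z l k w = 1 := by
        intro u
        cases k <;> simp [Gr.hitProb, hwl]
      simp only [h1, mul_one]
      have h2 := measure_cylinder r M a ha hc hV P hP l v' e' (n + 1) (by rw [hv'0, hz]) hj'
        fun t ht => by
          have := hl' t ht.le
          omega
      rw [hv'0] at h2
      rw [← h2]
      exact mul_le_mul_left (measure_mono hAw) _
    · rcases k with _ | k
      · have : A w = ∅ := by
          refine Set.eq_empty_iff_forall_notMem.2 ?_
          rintro X ⟨⟨-, j, hj1, hj3, hj4, -⟩, hX⟩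
          obtain rfl : j = n + 1 := by omega
          exact hwl (Subtype.ext (hX.symm.trans hj4))
        rw [this]; simp
      · have h1 : ∀ u : _ → ℝ, G.hitProb (fun k => Real.exp (u k)) z l (k + 1) w =
            G.escProb (fun k => Real.exp (u k)) z l k (v' (n + 1)) := by
          intro u
          rw [Gr.hitProb, if_neg hwl, if_neg hwz, hv'2, Gr.escProb]
        simp only [h1]
        refine le_trans (mul_le_mul_left (measure_mono ?_) _) (ih k k.lt_succ_self (n + 1) v' e' hv'0
          hj' hl' (by omega))
        intro X hX
        refine ⟨hAw hX, ?_⟩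
        obtain ⟨⟨-, j, hj1, hj2, hj3, hj4⟩, hX'⟩ := hX
        have : j ≠ n + 1 := by
          rintro rfl
          exact hwl (Subtype.ext (hX'.symm.trans hj3))
        exact ⟨j, by omega, by omega, hj3, fun i hi => hj4 i (by omega)⟩
  have hsub : {X | ∀ t ≤ n, X t = (v t).1} ∩ Hit l.1 n (k + 1) ⊆ ⋃ w, A w :=
    fun X hX => Set.mem_iUnion.2 ⟨X (n + 1), hX, rfl⟩
  have hsum : ∑' w, P (A w) = ∑ w : {p // p ∈ box r M}, P (A w) := by
    rw [Finset.sum_coe_sort (box r M) fun w => P (A w)]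
    refine tsum_eq_sum fun w hw => hzero w fun h => hw ?_
    rw [mem_box]
    have := linf_le_add_one h
    have := hl n le_rfl
    exact ⟨by omega, h.2.1⟩
  calc P ({X | ∀ t ≤ n, X t = (v t).1} ∩ Hit l.1 n (k + 1)) * J
      ≤ (∑' w, P (A w)) * J :=
        mul_le_mul_left ((measure_mono hsub).trans (measure_iUnion_le _)) _
    _ = ∑ w : {p // p ∈ box r M}, P (A w) * J := by rw [hsum, Finset.sum_mul]
    _ ≤ _ := Finset.sum_le_sum fun w _ => hstep w
    _ ≤ _ := sum_lintegral_le _ _ _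
    _ = _ := by
      refine lintegral_congr fun u => ?_
      rw [← ENNReal.ofReal_sum_of_nonneg fun w _ => mul_nonneg (hQ0 u) (hT0 u w),
        ← Finset.mul_sum]
      rfl

/-- Decay rate of the edge tilt across the shell of radius `k`. -/
noncomputable def shellRate (r k : ℕ) : ℝ := if r ∣ k then 0 else 1 / (((k / r : ℕ) : ℝ) + 1)

theorem shellRate_nonneg (r k : ℕ) : 0 ≤ shellRate r k := by
  unfold shellRate
  split_ifs <;> positivity

theorem log_le_sum_shellRate (r : ℕ) (hr : 0 < r) (m : ℕ) :
    ((r : ℝ) - 1) * Real.log (m + 1) ≤ ∑ k ∈ Finset.range (r * m), shellRate r k := by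
  induction m with
  | zero => simp
  | succ m ih =>
    rw [mul_add, mul_one, Finset.sum_range_add]
    obtain ⟨s, rfl⟩ : ∃ s, r = s + 1 := ⟨r - 1, by omega⟩
    have h1 : ∑ j ∈ Finset.range (s + 1), shellRate (s + 1) ((s + 1) * m + j) =
        s * (1 / ((m : ℝ) + 1)) := by
      rw [Finset.sum_range_succ']
      have h0 : shellRate (s + 1) ((s + 1) * m + 0) = 0 := by simp [shellRate]
      rw [h0, add_zero]
      have : ∀ j ∈ Finset.range s, shellRate (s + 1) ((s + 1) * m + (j + 1)) = 1 / ((m : ℝ) + 1) := by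
        intro j hj
        have hj := Finset.mem_range.1 hj
        have hd : ¬ (s + 1) ∣ (s + 1) * m + (j + 1) := by
          rw [Nat.dvd_add_right (Dvd.intro m rfl)]
          exact Nat.not_dvd_of_pos_of_lt (by omega) (by omega)
        rw [shellRate, if_neg hd, Nat.mul_add_div (by omega), Nat.div_eq_of_lt (by omega)]
        simp
      rw [Finset.sum_congr rfl this]
      simp
    rw [h1]
    have h2 : Real.log ((m : ℝ) + 1 + 1) - Real.log ((m : ℝ) + 1) ≤ 1 / ((m : ℝ) + 1) := by
      rw [← Real.log_div (by positivity) (by positivity)]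
      refine (Real.log_le_sub_one_of_pos (by positivity)).trans (le_of_eq ?_)
      field_simp
      ring
    push_cast at ih ⊢
    have hs : (0 : ℝ) ≤ s := by positivity
    nlinarith [mul_le_mul_of_nonneg_left h2 hs]

/-- The maximum norm as a natural number. -/
def nrm (v : ℤ × ℤ) : ℕ := (linf v).toNat

theorem linf_nonneg (v : ℤ × ℤ) : 0 ≤ linf v := le_max_of_le_left (abs_nonneg _)

theorem coe_nrm (v : ℤ × ℤ) : (nrm v : ℤ) = linf v := Int.toNat_of_nonneg (linf_nonneg v)

theorem sum_adj_le (r : ℕ) (hr : 2 ≤ r) (a : ℝ) (ha : 0 ≤ a) (v : ℤ × ℤ) (hv : v ∈ Vr r)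
    (h : ¬ r ∣ nrm v) :
    (∑ d ∈ ({(1, 0), (-1, 0), (0, 1), (0, -1)} : Finset (ℤ × ℤ)),
      if AdjG r v (v + d) then a else 0) ≤ 2 * a := by
  have hite : ∀ p : Prop, (if p then a else 0) ≤ a := fun p => by split_ifs <;> simp [ha]
  have hh : ¬ (r : ℤ) ∣ linf v := by rwa [← coe_nrm, Int.natCast_dvd_natCast]
  have h1 : ∀ x : ℤ, (r : ℤ) ∣ x → ¬ (r : ℤ) ∣ x + 1 ∧ ¬ (r : ℤ) ∣ x + -1 := by
    intro x hx
    rw [Int.dvd_add_right hx, Int.dvd_add_right hx, dvd_neg]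
    have : ¬ (r : ℤ) ∣ 1 := fun h => by
      have := Int.le_of_dvd one_pos h
      omega
    exact ⟨this, this⟩
  rw [Finset.sum_insert (by decide), Finset.sum_insert (by decide), Finset.sum_insert (by decide),
    Finset.sum_singleton]
  obtain ⟨x, y⟩ := v
  simp only [linf] at hh
  rcases hv with hx | hy
  · have hy : ¬ (r : ℤ) ∣ y := fun hy => hh (by
      rcases max_choice |x| |y| with e | e <;> rw [e, dvd_abs] <;> assumption)
    rw [if_neg, if_neg]
    · linarith [hite (AdjG r (x, y) ((x, y) + (0, 1))), hite (AdjG r (x, y) ((x, y) + (0, -1)))]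
    · rintro ⟨-, h, -⟩
      simp [Vr, hy, (h1 x hx).2] at h
    · rintro ⟨-, h, -⟩
      simp [Vr, hy, (h1 x hx).1] at h
  · have hx : ¬ (r : ℤ) ∣ x := fun hx => hh (by
      rcases max_choice |x| |y| with e | e <;> rw [e, dvd_abs] <;> assumption)
    rw [if_neg (c := AdjG r (x, y) ((x, y) + (0, 1))), if_neg (c := AdjG r (x, y) ((x, y) + (0, -1)))]
    · linarith [hite (AdjG r (x, y) ((x, y) + (1, 0))), hite (AdjG r (x, y) ((x, y) + (-1, 0)))]
    · rintro ⟨-, h, -⟩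
      simp [Vr, hx, (h1 y hy).2] at h
    · rintro ⟨-, h, -⟩
      simp [Vr, hx, (h1 y hy).1] at h

theorem sum_adj_of_mem_Lr (r : ℕ) (a : ℝ) (v : ℤ × ℤ) (hv : v ∈ Lr r) :
    (∑ d ∈ ({(1, 0), (-1, 0), (0, 1), (0, -1)} : Finset (ℤ × ℤ)),
      if AdjG r v (v + d) then a else 0) = 4 * a := by
  have h : ∀ d ∈ ({(1, 0), (-1, 0), (0, 1), (0, -1)} : Finset (ℤ × ℤ)),
      (if AdjG r v (v + d) then a else 0) = a := by
    intro d hd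
    refine if_pos ⟨Or.inl hv.1, ?_, ?_⟩
    · simp only [Finset.mem_insert, Finset.mem_singleton] at hd
      rcases hd with rfl | rfl | rfl | rfl
      · exact Or.inr (by simpa using hv.2)
      · exact Or.inr (by simpa using hv.2)
      · exact Or.inl (by simpa using hv.1)
      · exact Or.inl (by simpa using hv.1)
    · simp only [Finset.mem_insert, Finset.mem_singleton] at hd
      rcases hd with rfl | rfl | rfl | rfl <;> simp
  rw [Finset.sum_congr rfl h, Finset.sum_const]
  rw [show Finset.card ({(1, 0), (-1, 0), (0, 1), (0, -1)} : Finset (ℤ × ℤ)) = 4 from by decide]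
  simp

theorem nonempty_edge (r M : ℕ) (hM : 0 < M) :
    Nonempty {e : {p // p ∈ box r M} × {p // p ∈ box r M} //
      e.2.1 = e.1.1 + (1, 0) ∨ e.2.1 = e.1.1 + (0, 1)} := by
  have h0 : ((0, 0) : ℤ × ℤ) ∈ box r M := (mem_box r M _).2 ⟨by simp [linf], by simp [Vr]⟩
  have h1 : ((1, 0) : ℤ × ℤ) ∈ box r M := (mem_box r M _).2 ⟨by simp [linf]; omega, by simp [Vr]⟩
  exact ⟨⟨(⟨_, h0⟩, ⟨_, h1⟩), by simp⟩⟩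

theorem vsum_const_eq (r M : ℕ) (a : ℝ) (v : {p // p ∈ box r M}) (hv : linf v.1 < M) :
    (boxGr r M).vsum (fun _ => a) v =
      ∑ d ∈ ({(1, 0), (-1, 0), (0, 1), (0, -1)} : Finset (ℤ × ℤ)),
        if AdjG r v (v + d) then a else 0 := by
  obtain ⟨e⟩ := nonempty_edge r M (by have := linf_nonneg v.1; omega)
  have h := totWt_eq_vsum r M a (fun _ => v) (fun _ => e) 0 (by simp) hv
  have h0 : Gr.addCount (fun _ => a) (fun _ => e) 0 = fun _ => a := by
    funext k
    simp [Gr.addCount]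
  rw [h0] at h
  rw [← h]
  simp [totWt, wt]

theorem card_shell_le (r : ℕ) (hr : 0 < r) (s : Finset (ℤ × ℤ)) (hs : ∀ v ∈ s, v ∈ Vr r) (k : ℕ)
    (hk : ¬ r ∣ k) : ((s.filter fun v => nrm v = k).card : ℝ) ≤ 8 * (((k / r : ℕ) : ℝ) + 1) := by
  set q := k / r with hq
  have hsub : (s.filter fun v => nrm v = k) ⊆
      ((Finset.Icc (-(q : ℤ)) q) ×ˢ ({(k : ℤ), -(k : ℤ)} : Finset ℤ)).image
        (fun p => ((r : ℤ) * p.1, p.2)) ∪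
      ((Finset.Icc (-(q : ℤ)) q) ×ˢ ({(k : ℤ), -(k : ℤ)} : Finset ℤ)).image
        (fun p => (p.2, (r : ℤ) * p.1)) := by
    intro v hv
    obtain ⟨hvs, hvk⟩ := Finset.mem_filter.1 hv
    have hl : linf v = k := by rw [← coe_nrm, hvk]
    have hk' : ¬ (r : ℤ) ∣ k := by rwa [Int.natCast_dvd_natCast]
    have hmul : ∀ i : ℤ, |(r : ℤ) * i| ≤ k → i ∈ Finset.Icc (-(q : ℤ)) q := by
      intro i hi
      rw [abs_mul, Nat.abs_cast] at hi
      rw [Finset.mem_Icc, ← abs_le, hq, Int.natCast_div, Int.le_ediv_iff_mul_le (by exact_mod_cast hr)]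
      linarith
    have hor : ∀ y : ℤ, |y| = k → y ∈ ({(k : ℤ), -(k : ℤ)} : Finset ℤ) := by
      intro y hy
      rcases (abs_eq (by positivity)).1 hy with h | h <;> simp [h]
    obtain ⟨x, y⟩ := v
    simp only [linf] at hl
    have hx' : |x| ≤ k := hl ▸ le_max_left _ _
    have hy' : |y| ≤ k := hl ▸ le_max_right _ _
    rw [Finset.mem_union, Finset.mem_image, Finset.mem_image]
    rcases hs _ hvs with hx | hy
    · left
      have hne : |x| ≠ k := fun h => hk' (h ▸ (dvd_abs _ _).2 hx)
      have hy : |y| = k := by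
        rcases max_choice |x| |y| with e | e <;> omega
      obtain ⟨i, rfl⟩ := hx
      exact ⟨(i, y), Finset.mem_product.2 ⟨hmul i hx', hor y hy⟩, rfl⟩
    · right
      have hne : |y| ≠ k := fun h => hk' (h ▸ (dvd_abs _ _).2 hy)
      have hx : |x| = k := by
        rcases max_choice |x| |y| with e | e <;> omega
      obtain ⟨i, rfl⟩ := hy
      exact ⟨(i, x), Finset.mem_product.2 ⟨hmul i hy', hor x hx⟩, rfl⟩
  have hc := (Finset.card_le_card hsub).trans (Finset.card_union_le _ _)
  have hp : ((Finset.Icc (-(q : ℤ)) q) ×ˢ ({(k : ℤ), -(k : ℤ)} : Finset ℤ)).card ≤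
      (2 * q + 1) * 2 := by
    rw [Finset.card_product]
    refine Nat.mul_le_mul ?_ Finset.card_le_two
    rw [Int.card_Icc]
    omega
  have h3 : (s.filter fun v => nrm v = k).card ≤ 8 * (q + 1) := by
    refine hc.trans ((add_le_add Finset.card_image_le Finset.card_image_le).trans ?_)
    omega
  exact_mod_cast h3

theorem apply_eq_apply_zero (f : ℤ → ℝ) (M : ℤ)
    (h : ∀ y, -M ≤ y → y + 1 ≤ M → f y = f (y + 1)) (y : ℤ) (h1 : -M ≤ y) (h2 : y ≤ M) :
    f y = f 0 := by
  induction y using Int.induction_on with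
  | zero => rfl
  | succ n ih => rw [← h n (by omega) h2, ih (by omega) (by omega)]
  | pred n ih =>
    have := h (-n - 1) h1 (by omega)
    rw [this, sub_add_cancel, ih (by omega) (by omega)]

theorem connected_boxGr (r M : ℕ) : (boxGr r M).Connected := by
  intro φ hφ
  set g : ℤ × ℤ → ℝ := fun p => if h : p ∈ box r M then φ ⟨p, h⟩ else 0 with hg
  have hstep : ∀ p q, p ∈ box r M → q ∈ box r M → (q = p + (1, 0) ∨ q = p + (0, 1)) →
      g p = g q := by
    intro p q hp hq h
    simp only [hg, dif_pos hp, dif_pos hq]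
    exact hφ ⟨(⟨p, hp⟩, ⟨q, hq⟩), h⟩
  have hb : ∀ x y : ℤ, (x, y) ∈ box r M ↔
      ((-(M : ℤ) ≤ x ∧ x ≤ M) ∧ -(M : ℤ) ≤ y ∧ y ≤ M) ∧ ((r : ℤ) ∣ x ∨ (r : ℤ) ∣ y) := by
    intro x y
    rw [mem_box, linf_le_iff]
    rfl
  have hv : ∀ x y : ℤ, (r : ℤ) ∣ x → (x, y) ∈ box r M → g (x, y) = g (x, 0) := by
    intro x y hx hp
    rw [hb] at hp
    refine apply_eq_apply_zero (fun y => g (x, y)) M (fun y h1 h2 => ?_) y hp.1.2.1 hp.1.2.2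
    exact hstep _ _ ((hb _ _).2 ⟨⟨hp.1.1, by omega⟩, Or.inl hx⟩)
      ((hb _ _).2 ⟨⟨hp.1.1, by omega⟩, Or.inl hx⟩) (Or.inr (by simp))
  have hh : ∀ x y : ℤ, (r : ℤ) ∣ y → (x, y) ∈ box r M → g (x, y) = g (0, y) := by
    intro x y hy hp
    rw [hb] at hp
    refine apply_eq_apply_zero (fun x => g (x, y)) M (fun x h1 h2 => ?_) x hp.1.1.1 hp.1.1.2
    exact hstep _ _ ((hb _ _).2 ⟨⟨by omega, hp.1.2⟩, Or.inr hy⟩)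
      ((hb _ _).2 ⟨⟨by omega, hp.1.2⟩, Or.inr hy⟩) (Or.inl (by simp))
  have hall : ∀ p ∈ box r M, g p = g (0, 0) := by
    rintro ⟨x, y⟩ hp
    have hp' := (hb _ _).1 hp
    rcases hp'.2 with hx | hy
    · rw [hv x y hx hp, hh x 0 (dvd_zero _) ((hb _ _).2 ⟨⟨hp'.1.1, by omega⟩, Or.inl hx⟩)]
    · rw [hh x y hy hp, hv 0 y (dvd_zero _) ((hb _ _).2 ⟨⟨by omega, hp'.1.2⟩, Or.inr hy⟩)]
  intro v w
  have h1 := hall _ v.2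
  have h2 := hall _ w.2
  simp only [hg, dif_pos v.2, dif_pos w.2] at h1 h2
  exact h1.trans h2.symm

theorem nontrivial_box (r M : ℕ) (hM : 0 < M) : Nontrivial {p // p ∈ box r M} := by
  obtain ⟨e⟩ := nonempty_edge r M hM
  exact ⟨_, _, (boxGr r M).ne e⟩

theorem sum_shell_le (r M m : ℕ) (hr : 2 ≤ r) (a γ : ℝ) (ha : 0 ≤ a) (hM : r * m ≤ M) :
    ∑ v, ((boxGr r M).vsum (fun _ => a) v + 1) *
      (if nrm v.1 < r * m then γ * shellRate r (nrm v.1) else 0) ^ 2 / 16 ≤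
    (2 * a + 1) * γ ^ 2 / 2 * ∑ k ∈ Finset.range (r * m), shellRate r k := by
  set F : ℤ × ℤ → ℝ := fun v =>
    if nrm v < r * m then (2 * a + 1) * γ ^ 2 / 16 * shellRate r (nrm v) ^ 2 else 0 with hF
  have h1 : ∀ v : {p // p ∈ box r M}, ((boxGr r M).vsum (fun _ => a) v + 1) *
      (if nrm v.1 < r * m then γ * shellRate r (nrm v.1) else 0) ^ 2 / 16 ≤ F v.1 := by
    intro v
    simp only [hF]
    split_ifs with h
    · by_cases hd : r ∣ nrm v.1
      · simp [shellRate, hd]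
      · have h2 : (boxGr r M).vsum (fun _ => a) v ≤ 2 * a := by
          rw [vsum_const_eq r M a v (by rw [← coe_nrm]; exact_mod_cast h.trans_le hM)]
          exact sum_adj_le r hr a ha v.1 ((mem_box r M _).1 v.2).2 hd
        have := mul_le_mul_of_nonneg_right h2 (sq_nonneg (γ * shellRate r (nrm v.1)))
        linarith
    · simp
  refine (Finset.sum_le_sum fun v _ => h1 v).trans ?_
  rw [Finset.sum_coe_sort (box r M) F, ← Finset.sum_filter,
    ← Finset.sum_fiberwise_of_maps_to (t := Finset.range (r * m)) (g := nrm)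
      fun v hv => Finset.mem_range.2 (Finset.mem_filter.1 hv).2, Finset.mul_sum]
  refine Finset.sum_le_sum fun k _ => ?_
  have h2 : ∀ v ∈ ((box r M).filter fun v => nrm v < r * m).filter fun v => nrm v = k,
      (2 * a + 1) * γ ^ 2 / 16 * shellRate r (nrm v) ^ 2 =
      (2 * a + 1) * γ ^ 2 / 16 * shellRate r k ^ 2 := fun v hv => by
    rw [(Finset.mem_filter.1 hv).2]
  rw [Finset.sum_congr rfl h2, Finset.sum_const, nsmul_eq_mul]
  by_cases hd : r ∣ k
  · simp [shellRate, hd]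
  · have h3 := card_shell_le r (by omega) ((box r M).filter fun v => nrm v < r * m)
      (fun v hv => ((mem_box r M v).1 (Finset.mem_filter.1 hv).1).2) k hd
    have hq : (0 : ℝ) < ((k / r : ℕ) : ℝ) + 1 := by positivity
    have hC : 0 ≤ (2 * a + 1) * γ ^ 2 / 16 * shellRate r k ^ 2 := by positivity
    refine (mul_le_mul_of_nonneg_right h3 hC).trans (le_of_eq ?_)
    rw [shellRate, if_neg hd]
    field_simp
    ring

/-- The radial tilt accumulated outside radius `k`. -/
noncomputable def tilt (r m k : ℕ) : ℝ := ∑ j ∈ Finset.Ico k (r * m), shellRate r j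

theorem tilt_eq_add (r m k : ℕ) :
    tilt r m k = tilt r m (k + 1) + if k < r * m then shellRate r k else 0 := by
  unfold tilt
  split_ifs with h
  · rw [Finset.sum_eq_sum_Ico_succ_bot h, add_comm]
  · rw [Finset.Ico_eq_empty (by omega), Finset.Ico_eq_empty (by omega)]
    simp

theorem tilt_eq_zero (r m k : ℕ) (h : r * m ≤ k) : tilt r m k = 0 := by
  rw [tilt, Finset.Ico_eq_empty (by omega), Finset.sum_empty]

theorem adjG_edge (r M : ℕ) (e : _) : AdjG r ((boxGr r M).s e).1 ((boxGr r M).t e).1 :=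
  (exists_joins_iff r M _ _).1 ⟨e, Or.inl ⟨rfl, rfl⟩⟩

theorem lintegral_boxGr_le (r M m : ℕ) (hr : 2 ≤ r) (a : ℝ) (ha : 0 < a)
    (har : 256 * a + 129 ≤ r) (hm : 0 < m) (hM : r * m < M) (z l : {p // p ∈ box r M})
    (hz : z.1 = (0, 0)) (hl : l.1 ∈ Lr r) (hlm : nrm l.1 = r * m) :
    ∫⁻ u, ENNReal.ofReal ((boxGr r M).qs l z (fun _ => a) u *
      ((boxGr r M).ev u l / (boxGr r M).ev u z) ^ (1 / 4 : ℝ)) ≤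
    ENNReal.ofReal ((1 / (m : ℝ)) ^ (4 : ℝ) * (boxGr r M).qmass z fun _ => a) := by
  have hM0 : 0 < M := by omega
  set γ : ℝ := 1 / (4 * (2 * a + 1)) with hγ
  have hγ0 : 0 < γ := by positivity
  have hnz : nrm z.1 = 0 := by rw [hz]; rfl
  have hnbr : ∀ e, nrm ((boxGr r M).t e).1 ≤ nrm ((boxGr r M).s e).1 + 1 ∧
      nrm ((boxGr r M).s e).1 ≤ nrm ((boxGr r M).t e).1 + 1 := by
    intro e
    have h1 := linf_le_add_one (adjG_edge r M e)
    have h2 := linf_le_add_one (adjG_symm (adjG_edge r M e))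
    rw [← coe_nrm, ← coe_nrm] at h1 h2
    omega
  have hcast : ∀ v : {p // p ∈ box r M}, nrm v.1 < M → linf v.1 < M := fun v h => by
    rw [← coe_nrm]
    exact_mod_cast h
  have h01 : tilt r m 1 = tilt r m 0 := by
    rw [tilt_eq_add r m 0]
    simp [shellRate]
  have key := (boxGr r M).lintegral_hellinger (connected_boxGr r M) (nontrivial_box r M hM0) z l
    (fun _ => a)
    (fun e => γ * tilt r m (max (nrm ((boxGr r M).s e).1) (nrm ((boxGr r M).t e).1)))
    (fun v => γ * tilt r m (nrm v.1 + 1))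
    (fun v => if nrm v.1 < r * m then γ * shellRate r (nrm v.1) else 0)
    (fun _ => ha)
    (by rw [vsum_const_eq r M a z (hcast z (by omega)), vsum_const_eq r M a l (hcast l (by omega)),
          sum_adj_of_mem_Lr r a z.1 (by rw [hz]; simp [Lr]), sum_adj_of_mem_Lr r a l.1 hl])
    (γ * tilt r m 0)
    (by
      intro e he
      have h1 : max (nrm ((boxGr r M).s e).1) (nrm ((boxGr r M).t e).1) = 0 ∨
          max (nrm ((boxGr r M).s e).1) (nrm ((boxGr r M).t e).1) = 1 := by
        have := hnbr e
        rcases he with he | he <;> rw [he, hnz] at this ⊢ <;> omega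
      rcases h1 with h1 | h1 <;> rw [h1]
      rw [h01])
    (by
      intro e he
      rw [tilt_eq_zero, mul_zero]
      rcases he with he | he <;> rw [he, hlm]
      · exact le_max_left _ _
      · exact le_max_right _ _)
    (by
      intro e v he
      have h1 : max (nrm ((boxGr r M).s e).1) (nrm ((boxGr r M).t e).1) = nrm v.1 ∨
          max (nrm ((boxGr r M).s e).1) (nrm ((boxGr r M).t e).1) = nrm v.1 + 1 := by
        have := hnbr e
        rcases he with he | he <;> rw [he] at this ⊢ <;> omega
      have h2 := tilt_eq_add r m (nrm v.1)
      have h3 : 0 ≤ (if nrm v.1 < r * m then γ * shellRate r (nrm v.1) else 0) := by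
        split_ifs
        · exact mul_nonneg hγ0.le (shellRate_nonneg _ _)
        · exact le_rfl
      have h4 : γ * tilt r m (nrm v.1) = γ * tilt r m (nrm v.1 + 1) +
          (if nrm v.1 < r * m then γ * shellRate r (nrm v.1) else 0) := by
        rw [h2, mul_add, mul_ite, mul_zero]
      rcases h1 with h1 | h1 <;> rw [h1]
      · exact ⟨by linarith, h4.le⟩
      · exact ⟨le_rfl, by linarith⟩)
  refine key.trans (ENNReal.ofReal_le_ofReal (mul_le_mul_of_nonneg_right ?_
    ((boxGr r M).qmass_pos (connected_boxGr r M) (nontrivial_box r M hM0) z _ fun _ => ha).le))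
  have hm' : (0 : ℝ) < m := by exact_mod_cast hm
  rw [Real.rpow_def_of_pos (by positivity), Real.exp_le_exp, one_div, Real.log_inv]
  have h1 := sum_shell_le r M m hr a γ ha.le hM.le
  have h2 := log_le_sum_shellRate r (by omega) m
  have h3 : tilt r m 0 = ∑ k ∈ Finset.range (r * m), shellRate r k := by
    rw [tilt, Finset.range_eq_Ico]
  rw [h3]
  set S := ∑ k ∈ Finset.range (r * m), shellRate r k with hS
  have h4 : (2 * a + 1) * γ ^ 2 / 2 * S - γ * S / 4 = -(S / (32 * (2 * a + 1))) := by
    rw [hγ]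
    field_simp
    ring
  have h5 : Real.log m ≤ Real.log (m + 1) := Real.log_le_log hm' (by linarith)
  have h6 : 0 ≤ Real.log (m : ℝ) := Real.log_nonneg (by exact_mod_cast hm)
  have h7 : 4 * Real.log m ≤ S / (32 * (2 * a + 1)) := by
    rw [le_div_iff₀ (by positivity)]
    nlinarith
  linarith

theorem measure_hit_le_rpow (r m : ℕ) (hr : 2 ≤ r) (a : ℝ) (ha : 0 < a)
    (har : 256 * a + 129 ≤ r) (hm : 0 < m) (P : Measure (ℕ → ℤ × ℤ)) (hP : IsERRW r a P)
    (ℓ : ℤ × ℤ) (hℓ : ℓ ∈ Lr r) (hℓm : nrm ℓ = r * m) (k : ℕ) :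
    P (Hit ℓ 0 (k + 1)) ≤ ENNReal.ofReal ((1 / (m : ℝ)) ^ (4 : ℝ)) := by
  set M := k + r * m + 1 with hM
  have hM0 : 0 < M := by omega
  have hc := connected_boxGr r M
  have hV := nontrivial_box r M hM0
  have hzb : ((0, 0) : ℤ × ℤ) ∈ box r M := (mem_box r M _).2 ⟨by simp [linf], by simp [Vr]⟩
  have hlb : ℓ ∈ box r M := (mem_box r M _).2
    ⟨by rw [← coe_nrm, hℓm]; exact_mod_cast (by omega), Or.inl hℓ.1⟩
  have hne : (⟨(0, 0), hzb⟩ : {p // p ∈ box r M}) ≠ ⟨ℓ, hlb⟩ := by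
    intro h
    have h' : (0, 0) = ℓ := congrArg Subtype.val h
    rw [← h'] at hℓm
    have : 0 < r * m := by positivity
    rw [← hℓm] at this
    simp [nrm, linf] at this
  obtain ⟨e⟩ := nonempty_edge r M hM0
  have hq := (boxGr r M).qmass_pos hc hV ⟨(0, 0), hzb⟩ _ fun _ => ha
  have h1 := measure_hit_le r M a ha hc hV P hP ⟨(0, 0), hzb⟩ ⟨ℓ, hlb⟩ rfl k 0
    (fun _ => ⟨(0, 0), hzb⟩) (fun _ => e) rfl (by simp) (by simp [linf]) (by
      have : 0 < r * m := by positivity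
      omega)
  have h2 := lintegral_boxGr_le r M m hr a ha har hm (by omega) ⟨(0, 0), hzb⟩ ⟨ℓ, hlb⟩ rfl hℓ hℓm
  have h3 : P (Hit ℓ 0 (k + 1)) =
      P ({X | ∀ t ≤ 0, X t = ((0, 0) : ℤ × ℤ)} ∩ Hit ℓ 0 (k + 1)) := by
    have := hP.1
    have h := hP.2 0 fun _ => (0, 0)
    simp only [true_and, not_lt_zero, IsEmpty.forall_iff, implies_true, if_true,
      Finset.range_zero, Finset.prod_empty, ENNReal.ofReal_one] at h
    have hmeas : MeasurableSet {X : ℕ → ℤ × ℤ | ∀ t ≤ 0, X t = (0, 0)} := by measurability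
    rw [Set.inter_comm, measure_inter_conull]
    rw [measure_compl hmeas (by rw [h]; simp), h]
    simp
  rw [h3]
  have h4 := h1.trans ((lintegral_mono fun u => ENNReal.ofReal_le_ofReal (by
    rw [Finset.range_zero, Finset.prod_empty, mul_one]
    exact mul_le_mul_of_nonneg_left ((boxGr r M).escProb_le_rpow hc hV u _ _ hne k)
      ((boxGr r M).qs_nonneg hc hV _ _ _ _))).trans h2)
  rw [ENNReal.ofReal_mul (by positivity)] at h4
  exact (ENNReal.mul_le_mul_iff_left (by simpa using hq) ENNReal.ofReal_ne_top).1 h4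

theorem tau_lt_subset (ℓ : ℤ × ℤ) :
    {X | tau {ℓ} X < tau {(0, 0)} X} ⊆ ⋃ k, Hit ℓ 0 (k + 1) := by
  intro X hX
  have hX : tau {ℓ} X < tau {(0, 0)} X := hX
  rcases Set.eq_empty_or_nonempty ((fun t : ℕ => (t : ℕ∞)) '' {t : ℕ | 1 ≤ t ∧ X t ∈ ({ℓ} : Set _)})
    with h | h
  · rw [tau, h, sInf_empty] at hX
    exact absurd hX not_top_lt
  · obtain ⟨j, ⟨hj1, hj2⟩, hj⟩ := csInf_mem h
    have hj' : (j : ℕ∞) = tau {ℓ} X := hj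
    refine Set.mem_iUnion.2 ⟨j, j, hj1, by omega, hj2, fun i hi hij h0 => ?_⟩
    have h1 : tau {(0, 0)} X ≤ i := sInf_le ⟨i, ⟨hi, h0⟩, rfl⟩
    rw [← hj'] at hX
    have := hX.trans_le h1
    have : j < i := by exact_mod_cast this
    omega

theorem monotone_hit (ℓ : ℤ × ℤ) : Monotone fun k => Hit ℓ 0 (k + 1) := by
  rintro k k' hk X ⟨j, h1, h2, h3⟩
  exact ⟨j, h1, by omega, h3⟩

end ERRWZ2

/-- Theorem 1.2(a) (Hitting probabilities): for `r ≥ 130` and `0 < a < (r-129)/256`,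
there are `l₀ ∈ ℕ` and `ξ > 0` such that for every `ℓ ∈ rℤ²` with `|ℓ|_∞ ≥ l₀`, the
edge-reinforced random walk hits `ℓ` before returning to `0` with probability at most
`(r/|ℓ|_∞)^{1+ξ}`. -/
theorem errw_hitting_vertex (r : ℕ) (hr : 130 ≤ r) (a : ℝ) (ha : 0 < a)
    (ha' : a < ((r : ℝ) - 129) / 256) :
    ∃ (l₀ : ℕ) (ξ : ℝ), 0 < ξ ∧
      ∀ ℓ : ℤ × ℤ, ℓ ∈ ERRWZ2.Lr r → (l₀ : ℤ) ≤ ERRWZ2.linf ℓ →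
        ∀ P : Measure (ℕ → ℤ × ℤ), ERRWZ2.IsERRW r a P →
          P {X | ERRWZ2.tau {ℓ} X < ERRWZ2.tau {(0, 0)} X}
            ≤ ENNReal.ofReal (((r : ℝ) / (ERRWZ2.linf ℓ : ℝ)) ^ (1 + ξ)) := by
  refine ⟨1, 3, by norm_num, fun ℓ hℓ hl P hP => ?_⟩
  have hd : (r : ℤ) ∣ (ERRWZ2.nrm ℓ : ℤ) := by
    rw [ERRWZ2.coe_nrm]
    unfold ERRWZ2.linf
    rcases max_choice |ℓ.1| |ℓ.2| with e | e <;> rw [e, dvd_abs]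
    · exact hℓ.1
    · exact hℓ.2
  obtain ⟨m, hm⟩ := Int.natCast_dvd_natCast.1 hd
  have hm0 : 0 < m := by
    rw [← ERRWZ2.coe_nrm, hm] at hl
    refine Nat.pos_of_ne_zero fun h => ?_
    simp [h] at hl
  have hr0 : (r : ℝ) ≠ 0 := by
    have : r ≠ 0 := by omega
    exact_mod_cast this
  have hrat : (r : ℝ) / (ERRWZ2.linf ℓ : ℝ) = 1 / (m : ℝ) := by
    rw [← ERRWZ2.coe_nrm, hm]
    push_cast
    field_simp
  rw [hrat, show (1 : ℝ) + 3 = 4 by norm_num]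
  refine (measure_mono (ERRWZ2.tau_lt_subset ℓ)).trans ?_
  rw [(ERRWZ2.monotone_hit ℓ).measure_iUnion]
  exact iSup_le fun k => ERRWZ2.measure_hit_le_rpow r m (by omega) a ha
    (by linarith [(lt_div_iff₀ (by norm_num : (0 : ℝ) < 256)).1 ha']) hm0 P hP ℓ hℓ hm k
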